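/- Let r > 9/4. There is θ₀ > 0 such that for every θ ∈ (0,θ₀) there exists a constant C = C(r,θ) with the following property: for all ε, μ ∈ (0,1], all T > 0, and every solution (η, v) of the two-dimensional Whitham–Boussinesq system ∂_t η + ∇·v + ε∇·(η v) = 0, ∂_t v + T_μ(D)∇η + (ε/2)∇(|v|²) = 0 on [0,T], with t ↦ (η(·,t), v(·,t)) a C¹ curve in the Schwartz space and ∂_{x₂} v₁ = ∂_{x₁} v₂ (curl-free), the quantity 𝒫(t) = ‖∇η(t)‖_{L^∞} + ‖∇v(t)‖_{L^∞} + ‖T_μ^{−1/2}(D)∇v(t)‖_{L^∞} satisfies (∫_0^T 𝒫(t)² dt)^{1/2} ≤ C [ μ^{−1/6+5θ/36} T^{1/6+5θ/18} sup_{t∈[0,T]} ‖(η,v)(t)‖_{V^r_μ} + ε μ^{−1/3+θ/9} T^{5/6+2θ/9} ( sup_{t∈[0,T]} ‖(η,v)(t)‖_{V^r_μ} )² ]. -/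

import Mathlib

noncomputable section

open MeasureTheory SchwartzMap
open scoped FourierTransform ENNReal

/-- The plane `ℝ²` as a Euclidean space. -/
abbrev E2 := EuclideanSpace ℝ (Fin 2)

/-- The Japanese bracket `⟨x⟩ = (1 + x²)^{1/2}`. -/
def jap (x : ℝ) : ℝ := (1 + x ^ 2) ^ ((1 : ℝ) / 2)

/-- The radial symbol `T_μ(ξ) = tanh(√μ |ξ|)/(√μ |ξ|)` for `ξ ≠ 0`, with value `1` at `0`,
expressed through `r = |ξ|`. -/
def Tsymb (μ r : ℝ) : ℝ :=
  if r = 0 then 1 else Real.tanh (Real.sqrt μ * r) / (Real.sqrt μ * r)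

/-- Complexification of a real-valued function on `ℝ²`. -/
def cc2 (f : E2 → ℝ) : E2 → ℂ := fun x => (f x : ℂ)

/-- Generic Fourier multiplier `a(D) g = (a(ξ) ĝ(ξ))^∨` with real symbol `a` on `ℝ²`. -/
def fmul2 (a : E2 → ℝ) (g : E2 → ℂ) : E2 → ℂ :=
  𝓕⁻ (fun ξ : E2 => ((a ξ : ℝ) : ℂ) * 𝓕 g ξ)

/-- The multiplier `T_μ(D)`. -/
def Tmul2 (μ : ℝ) (g : E2 → ℂ) : E2 → ℂ := fmul2 (fun ξ => Tsymb μ ‖ξ‖) g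

/-- The multiplier `T_μ^{−1/2}(D)`. -/
def Tinvhalf2 (μ : ℝ) (g : E2 → ℂ) : E2 → ℂ :=
  fmul2 (fun ξ => Tsymb μ ‖ξ‖ ^ (-(1 : ℝ) / 2)) g

/-- The partial derivative `∂_{x_i} f` on `ℝ²`. -/
def pd (i : Fin 2) (f : E2 → ℝ) (x : E2) : ℝ :=
  fderiv ℝ f x (EuclideanSpace.single i 1)

/-- The `H^r`-norm `‖f‖_{H^r} = ‖⟨ξ⟩^r f̂‖_{L²}`. -/
def HsN2 (r : ℝ) (f : E2 → ℂ) : ℝ≥0∞ :=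
  eLpNorm (fun ξ : E2 => jap ‖ξ‖ ^ r * ‖𝓕 f ξ‖) 2 volume

/-- The `H^r`-norm of `|D|^{1/2} f`, that is `‖⟨ξ⟩^r |ξ|^{1/2} f̂‖_{L²}`. -/
def HsDN2 (r : ℝ) (f : E2 → ℂ) : ℝ≥0∞ :=
  eLpNorm (fun ξ : E2 => jap ‖ξ‖ ^ r * ‖ξ‖ ^ ((1 : ℝ) / 2) * ‖𝓕 f ξ‖) 2 volume

/-- The `V^r_μ`-norm, `‖(η,v)‖_{V^r_μ} = (‖η‖_{H^r}² + ‖v‖_{H^r}² + √μ ‖|D|^{1/2}v‖_{H^r}²)^{1/2}`. -/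
def Vnorm (μ r : ℝ) (η v₁ v₂ : E2 → ℝ) : ℝ≥0∞ :=
  (HsN2 r (cc2 η) ^ 2 + HsN2 r (cc2 v₁) ^ 2 + HsN2 r (cc2 v₂) ^ 2 +
      ENNReal.ofReal (Real.sqrt μ) *
        (HsDN2 r (cc2 v₁) ^ 2 + HsDN2 r (cc2 v₂) ^ 2)) ^ ((1 : ℝ) / 2)

/-- The quantity `𝒫(t) = ‖∇η‖_{L^∞} + ‖∇v‖_{L^∞} + ‖T_μ^{−1/2}(D)∇v‖_{L^∞}`. -/
def Pfun (μ : ℝ) (η v₁ v₂ : E2 → ℝ) : ℝ :=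
  (eLpNorm (fun x => ‖fderiv ℝ η x‖) ⊤ volume).toReal +
    (eLpNorm (fun x => ‖fderiv ℝ v₁ x‖ + ‖fderiv ℝ v₂ x‖) ⊤ volume).toReal +
    (eLpNorm (fun x =>
        ‖Tinvhalf2 μ (cc2 (pd 0 v₁)) x‖ + ‖Tinvhalf2 μ (cc2 (pd 1 v₁)) x‖ +
          ‖Tinvhalf2 μ (cc2 (pd 0 v₂)) x‖ + ‖Tinvhalf2 μ (cc2 (pd 1 v₂)) x‖) ⊤
      volume).toReal

/-- First derivative test (increasing positive derivative). -/
lemma vdc1_pos {φ φ' φ'' : ℝ → ℝ} {a b Λ : ℝ} (hab : a ≤ b) (hΛ : 0 < Λ)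
    (h1 : ∀ x ∈ Set.Icc a b, HasDerivAt φ (φ' x) x)
    (h2 : ∀ x ∈ Set.Icc a b, HasDerivAt φ' (φ'' x) x)
    (hc : ContinuousOn φ'' (Set.Icc a b))
    (hpos : ∀ x ∈ Set.Icc a b, 0 ≤ φ'' x)
    (hL : ∀ x ∈ Set.Icc a b, Λ ≤ φ' x) :
    ‖∫ x in a..b, Complex.exp (Complex.I * φ x)‖ ≤ 2 / Λ := by
  have hu : Set.uIcc a b = Set.Icc a b := Set.uIcc_of_le hab
  have hφc : ContinuousOn φ (Set.Icc a b) := fun x hx => (h1 x hx).continuousAt.continuousWithinAt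
  have hφ'c : ContinuousOn φ' (Set.Icc a b) := fun x hx => (h2 x hx).continuousAt.continuousWithinAt
  have hne : ∀ x ∈ Set.Icc a b, φ' x ≠ 0 := fun x hx => (lt_of_lt_of_le hΛ (hL x hx)).ne'
  have hsqc : ContinuousOn (fun x => φ'' x / (φ' x) ^ 2) (Set.Icc a b) :=
    hc.div (hφ'c.pow 2) (fun x hx => pow_ne_zero 2 (hne x hx))
  have hexpc : ContinuousOn (fun x => Complex.exp (Complex.I * φ x)) (Set.Icc a b) := by
    apply Complex.continuous_exp.comp_continuousOn
    exact continuousOn_const.mul (Complex.continuous_ofReal.comp_continuousOn hφc)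
  -- derivative of u = exp(iφ)/(i φ')
  have hder : ∀ x ∈ Set.uIcc a b, HasDerivAt
      (fun x => Complex.exp (Complex.I * φ x) * (-Complex.I) * ((1 / φ' x : ℝ) : ℂ))
      (Complex.exp (Complex.I * φ x) +
        Complex.exp (Complex.I * φ x) * Complex.I * ((φ'' x / (φ' x) ^ 2 : ℝ) : ℂ)) x := by
    intro x hx
    rw [hu] at hx
    have e1 : HasDerivAt (fun x => Complex.exp (Complex.I * φ x))
        (Complex.exp (Complex.I * φ x) * (Complex.I * φ' x)) x :=
      (((h1 x hx).ofReal_comp).const_mul Complex.I).cexp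
    have e2 : HasDerivAt (fun x => (1 / φ' x : ℝ)) (-(φ'' x) / (φ' x) ^ 2) x := by
      have := (h2 x hx).fun_inv (hne x hx)
      simpa [one_div] using this
    have e3 := (e1.mul_const (-Complex.I)).mul e2.ofReal_comp
    refine e3.congr_deriv ?_
    have hn : (φ' x : ℂ) ≠ 0 := by exact_mod_cast hne x hx
    push_cast
    field_simp
    have hI := Complex.I_sq
    ring_nf
    rw [hI]; ring
  have hint1 : IntervalIntegrable (fun x => Complex.exp (Complex.I * φ x)) volume a b :=
    (hu ▸ hexpc : ContinuousOn _ (Set.uIcc a b)).intervalIntegrable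
  have hint2c : ContinuousOn (fun x => Complex.exp (Complex.I * φ x) * Complex.I *
      ((φ'' x / (φ' x) ^ 2 : ℝ) : ℂ)) (Set.Icc a b) :=
    (hexpc.mul continuousOn_const).mul (Complex.continuous_ofReal.comp_continuousOn hsqc)
  have hint2 : IntervalIntegrable (fun x => Complex.exp (Complex.I * φ x) * Complex.I *
      ((φ'' x / (φ' x) ^ 2 : ℝ) : ℂ)) volume a b :=
    (hu ▸ hint2c : ContinuousOn _ (Set.uIcc a b)).intervalIntegrable
  have key := intervalIntegral.integral_eq_sub_of_hasDerivAt hder (hint1.add hint2)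
  rw [intervalIntegral.integral_add hint1 hint2] at key
  have hb2 : ‖∫ x in a..b, Complex.exp (Complex.I * φ x) * Complex.I *
      ((φ'' x / (φ' x) ^ 2 : ℝ) : ℂ)‖ ≤ 1 / φ' a - 1 / φ' b := by
    have e : ∫ x in a..b, φ'' x / (φ' x) ^ 2 = 1 / φ' a - 1 / φ' b := by
      have : ∀ x ∈ Set.uIcc a b, HasDerivAt (fun x => -(1 / φ' x : ℝ)) (φ'' x / (φ' x) ^ 2) x := by
        intro x hx
        rw [hu] at hx
        have := ((h2 x hx).fun_inv (hne x hx)).fun_neg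
        simpa [one_div, neg_div] using this
      rw [intervalIntegral.integral_eq_sub_of_hasDerivAt this
        (hu ▸ hsqc : ContinuousOn _ (Set.uIcc a b)).intervalIntegrable]
      ring
    rw [← e]
    apply intervalIntegral.norm_integral_le_of_norm_le hab
    · refine Filter.Eventually.of_forall fun x hx => ?_
      have hx' : x ∈ Set.Icc a b := ⟨hx.1.le, hx.2⟩
      rw [norm_mul, norm_mul, Complex.norm_exp]
      simp only [Complex.norm_I, Complex.norm_real, Real.norm_eq_abs]
      rw [abs_of_nonneg (div_nonneg (hpos x hx') (sq_nonneg _))]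
      simp
    · exact (hu ▸ hsqc : ContinuousOn _ (Set.uIcc a b)).intervalIntegrable
  have hend : ∀ x, ‖Complex.exp (Complex.I * φ x) * (-Complex.I) * ((1 / φ' x : ℝ) : ℂ)‖ = |1 / φ' x| := by
    intro x
    rw [norm_mul, norm_mul, Complex.norm_exp]
    simp
  have ha := hL a ⟨le_rfl, hab⟩
  have hb := hL b ⟨hab, le_rfl⟩
  have ha0 : 0 < φ' a := lt_of_lt_of_le hΛ ha
  have hb0 : 0 < φ' b := lt_of_lt_of_le hΛ hb
  have : ∫ x in a..b, Complex.exp (Complex.I * φ x) =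
      (Complex.exp (Complex.I * φ b) * (-Complex.I) * ((1 / φ' b : ℝ) : ℂ)
      - Complex.exp (Complex.I * φ a) * (-Complex.I) * ((1 / φ' a : ℝ) : ℂ))
      - ∫ x in a..b, Complex.exp (Complex.I * φ x) * Complex.I *
      ((φ'' x / (φ' x) ^ 2 : ℝ) : ℂ) := by
    rw [← key]; ring
  rw [this]
  calc _ ≤ (|1 / φ' b| + |1 / φ' a|) + (1 / φ' a - 1 / φ' b) := by
        refine (norm_sub_le _ _).trans (add_le_add ((norm_sub_le _ _).trans ?_) hb2)
        rw [hend, hend]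
    _ = 2 / φ' a := by
        rw [abs_of_pos (by positivity), abs_of_pos (by positivity)]; ring
    _ ≤ 2 / Λ := by gcongr

lemma vdc1_neg {φ φ' φ'' : ℝ → ℝ} {a b Λ : ℝ} (hab : a ≤ b) (hΛ : 0 < Λ)
    (h1 : ∀ x ∈ Set.Icc a b, HasDerivAt φ (φ' x) x)
    (h2 : ∀ x ∈ Set.Icc a b, HasDerivAt φ' (φ'' x) x)
    (hc : ContinuousOn φ'' (Set.Icc a b))
    (hpos : ∀ x ∈ Set.Icc a b, 0 ≤ φ'' x)
    (hL : ∀ x ∈ Set.Icc a b, φ' x ≤ -Λ) :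
    ‖∫ x in a..b, Complex.exp (Complex.I * φ x)‖ ≤ 2 / Λ := by
  -- substitute x ↦ -x
  have hm : ∀ x ∈ Set.Icc (-b) (-a), -x ∈ Set.Icc a b := fun x hx => ⟨by linarith [hx.2], by linarith [hx.1]⟩
  have := vdc1_pos (φ := fun x => φ (-x)) (φ' := fun x => -φ' (-x)) (φ'' := fun x => φ'' (-x))
    (a := -b) (b := -a) (Λ := Λ) (by linarith) hΛ
    (fun x hx => by
      have := (h1 (-x) (hm x hx)).comp x (hasDerivAt_neg x)
      simpa [Function.comp_def] using this)
    (fun x hx => by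
      have := ((h2 (-x) (hm x hx)).comp x (hasDerivAt_neg x)).fun_neg
      simpa [Function.comp_def] using this)
    (hc.comp continuousOn_neg hm)
    (fun x hx => hpos _ (hm x hx))
    (fun x hx => by have := hL _ (hm x hx); linarith)
  rw [intervalIntegral.integral_comp_neg (fun x => Complex.exp (Complex.I * φ x))] at this
  simpa using this

lemma norm_osc_le {φ : ℝ → ℝ} {a b : ℝ} (hab : a ≤ b) :
    ‖∫ x in a..b, Complex.exp (Complex.I * φ x)‖ ≤ b - a := by
  have := intervalIntegral.norm_integral_le_of_norm_le_const (a := a) (b := b) (C := 1)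
    (f := fun x => Complex.exp (Complex.I * φ x)) (fun x _ => by rw [Complex.norm_exp]; simp)
  simpa [abs_of_nonneg (sub_nonneg.2 hab)] using this

/-- Half of the second derivative test. -/
lemma vdc2_half {φ φ' φ'' : ℝ → ℝ} {a b l : ℝ} (hab : a ≤ b) (hl : 0 < l)
    (h1 : ∀ x ∈ Set.Icc a b, HasDerivAt φ (φ' x) x)
    (h2 : ∀ x ∈ Set.Icc a b, HasDerivAt φ' (φ'' x) x)
    (hc : ContinuousOn φ'' (Set.Icc a b))
    (hL : ∀ x ∈ Set.Icc a b, l ≤ φ'' x) (h0 : 0 ≤ φ' a) :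
    ‖∫ x in a..b, Complex.exp (Complex.I * φ x)‖ ≤ 3 / Real.sqrt l := by
  have hs : 0 < Real.sqrt l := Real.sqrt_pos.2 hl
  have hss : Real.sqrt l * Real.sqrt l = l := Real.mul_self_sqrt hl.le
  set e := 1 / Real.sqrt l with he
  have he0 : 0 < e := by positivity
  rcases le_total b (a + e) with hb | hb
  · refine (norm_osc_le hab).trans ?_
    have : e ≤ 3 / Real.sqrt l := by rw [he]; gcongr; norm_num
    linarith
  · have hφc : ContinuousOn φ (Set.Icc a b) := fun x hx => (h1 x hx).continuousAt.continuousWithinAt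
    have hexpc : ContinuousOn (fun x => Complex.exp (Complex.I * φ x)) (Set.Icc a b) := by
      apply Complex.continuous_exp.comp_continuousOn
      exact continuousOn_const.mul (Complex.continuous_ofReal.comp_continuousOn hφc)
    have hi : IntervalIntegrable (fun x => Complex.exp (Complex.I * φ x)) volume a b := by
      apply ContinuousOn.intervalIntegrable; rwa [Set.uIcc_of_le hab]
    have hmem : a + e ∈ Set.Icc a b := ⟨by linarith, hb⟩
    rw [← intervalIntegral.integral_add_adjacent_intervals (b := a + e)
      (hi.mono_set (by
        rw [Set.uIcc_of_le (by linarith), Set.uIcc_of_le hab]; exact Set.Icc_subset_Icc le_rfl hb))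
      (hi.mono_set (by
        rw [Set.uIcc_of_le hb, Set.uIcc_of_le hab]; exact Set.Icc_subset_Icc (by linarith) le_rfl))]
    have hsub : Set.Icc (a + e) b ⊆ Set.Icc a b := Set.Icc_subset_Icc (by linarith) le_rfl
    have mvt : ∀ x ∈ Set.Icc a b, l * (x - a) ≤ φ' x := by
      intro x hx
      have := (convex_Icc a b).mul_sub_le_image_sub_of_le_deriv (f := φ') (C := l)
        (fun y hy => (h2 y hy).continuousAt.continuousWithinAt)
        (fun y hy => ((h2 y (interior_subset hy)).differentiableAt).differentiableWithinAt)
        (fun y hy => by rw [(h2 y (interior_subset hy)).deriv]; exact hL y (interior_subset hy))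
        a ⟨le_rfl, hab⟩ x hx hx.1
      linarith
    have hle : l * e = Real.sqrt l := by
      rw [he, mul_one_div, div_eq_iff hs.ne', hss]
    have k1 := norm_osc_le (φ := φ) (a := a) (b := a + e) (by linarith)
    have k2 := vdc1_pos (φ := φ) (φ' := φ') (φ'' := φ'') (a := a + e) (b := b) (Λ := Real.sqrt l) hb hs
      (fun x hx => h1 x (hsub hx)) (fun x hx => h2 x (hsub hx)) (hc.mono hsub)
      (fun x hx => hl.le.trans (hL x (hsub hx)))
      (fun x hx => by
        refine le_trans ?_ (mvt x (hsub hx))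
        rw [← hle]; have := hx.1; gcongr; linarith)
    refine (norm_add_le _ _).trans ?_
    have : (3:ℝ) / Real.sqrt l = e + 2 / Real.sqrt l := by rw [he]; ring
    rw [this]; linarith

lemma vdc2_half' {φ φ' φ'' : ℝ → ℝ} {a b l : ℝ} (hab : a ≤ b) (hl : 0 < l)
    (h1 : ∀ x ∈ Set.Icc a b, HasDerivAt φ (φ' x) x)
    (h2 : ∀ x ∈ Set.Icc a b, HasDerivAt φ' (φ'' x) x)
    (hc : ContinuousOn φ'' (Set.Icc a b))
    (hL : ∀ x ∈ Set.Icc a b, l ≤ φ'' x) (h0 : φ' b ≤ 0) :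
    ‖∫ x in a..b, Complex.exp (Complex.I * φ x)‖ ≤ 3 / Real.sqrt l := by
  have hm : ∀ x ∈ Set.Icc (-b) (-a), -x ∈ Set.Icc a b := fun x hx => ⟨by linarith [hx.2], by linarith [hx.1]⟩
  have := vdc2_half (φ := fun x => φ (-x)) (φ' := fun x => -φ' (-x)) (φ'' := fun x => φ'' (-x))
    (a := -b) (b := -a) (l := l) (by linarith) hl
    (fun x hx => by
      have := (h1 (-x) (hm x hx)).comp x (hasDerivAt_neg x)
      simpa [Function.comp_def] using this)
    (fun x hx => by
      have := ((h2 (-x) (hm x hx)).comp x (hasDerivAt_neg x)).fun_neg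
      simpa [Function.comp_def] using this)
    (hc.comp continuousOn_neg hm)
    (fun x hx => hL _ (hm x hx))
    (by simpa using h0)
  rw [intervalIntegral.integral_comp_neg (fun x => Complex.exp (Complex.I * φ x))] at this
  simpa using this

/-- Second derivative test. -/
lemma vdc2 {φ φ' φ'' : ℝ → ℝ} {a b l : ℝ} (hab : a ≤ b) (hl : 0 < l)
    (h1 : ∀ x ∈ Set.Icc a b, HasDerivAt φ (φ' x) x)
    (h2 : ∀ x ∈ Set.Icc a b, HasDerivAt φ' (φ'' x) x)
    (hc : ContinuousOn φ'' (Set.Icc a b))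
    (hL : ∀ x ∈ Set.Icc a b, l ≤ φ'' x) :
    ‖∫ x in a..b, Complex.exp (Complex.I * φ x)‖ ≤ 6 / Real.sqrt l := by
  have hs : 0 < Real.sqrt l := Real.sqrt_pos.2 hl
  have h36 : 3 / Real.sqrt l ≤ 6 / Real.sqrt l := by gcongr; norm_num
  rcases le_total 0 (φ' a) with ha | ha
  · exact (vdc2_half hab hl h1 h2 hc hL ha).trans h36
  rcases le_total (φ' b) 0 with hb | hb
  · exact (vdc2_half' hab hl h1 h2 hc hL hb).trans h36
  have hφ'c : ContinuousOn φ' (Set.Icc a b) := fun x hx => (h2 x hx).continuousAt.continuousWithinAt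
  obtain ⟨p, hp, hp0⟩ := intermediate_value_Icc hab hφ'c (show (0:ℝ) ∈ Set.Icc (φ' a) (φ' b) from ⟨ha, hb⟩)
  have s1 : Set.Icc a p ⊆ Set.Icc a b := Set.Icc_subset_Icc le_rfl hp.2
  have s2 : Set.Icc p b ⊆ Set.Icc a b := Set.Icc_subset_Icc hp.1 le_rfl
  have hφc : ContinuousOn φ (Set.Icc a b) := fun x hx => (h1 x hx).continuousAt.continuousWithinAt
  have hexpc : ContinuousOn (fun x => Complex.exp (Complex.I * φ x)) (Set.Icc a b) := by
    apply Complex.continuous_exp.comp_continuousOn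
    exact continuousOn_const.mul (Complex.continuous_ofReal.comp_continuousOn hφc)
  have hi1 : IntervalIntegrable (fun x => Complex.exp (Complex.I * φ x)) volume a p := by
    apply ContinuousOn.intervalIntegrable; rw [Set.uIcc_of_le hp.1]; exact hexpc.mono s1
  have hi2 : IntervalIntegrable (fun x => Complex.exp (Complex.I * φ x)) volume p b := by
    apply ContinuousOn.intervalIntegrable; rw [Set.uIcc_of_le hp.2]; exact hexpc.mono s2
  rw [← intervalIntegral.integral_add_adjacent_intervals hi1 hi2]
  have k1 := vdc2_half' hp.1 hl (fun x hx => h1 x (s1 hx)) (fun x hx => h2 x (s1 hx)) (hc.mono s1)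
    (fun x hx => hL x (s1 hx)) hp0.le
  have k2 := vdc2_half hp.2 hl (fun x hx => h1 x (s2 hx)) (fun x hx => h2 x (s2 hx)) (hc.mono s2)
    (fun x hx => hL x (s2 hx)) hp0.ge
  refine (norm_add_le _ _).trans ?_
  have : (6:ℝ) / Real.sqrt l = 3 / Real.sqrt l + 3 / Real.sqrt l := by ring
  rw [this]; linarith

/-- Adding the amplitude `x` on `[N, 2 N]`. -/
lemma amp_le {φ : ℝ → ℝ} {N B : ℝ} (hN : 0 < N) (hφc : ContinuousOn φ (Set.Icc N (2 * N)))
    (hB : ∀ y ∈ Set.Icc N (2 * N), ‖∫ x in N..y, Complex.exp (Complex.I * φ x)‖ ≤ B) :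
    ‖∫ x in N..(2 * N), Complex.exp (Complex.I * φ x) * x‖ ≤ 3 * N * B := by
  have hab : N ≤ 2 * N := by linarith
  have hu : Set.uIcc N (2 * N) = Set.Icc N (2 * N) := Set.uIcc_of_le hab
  have hexpc : ContinuousOn (fun x => Complex.exp (Complex.I * φ x)) (Set.Icc N (2 * N)) := by
    apply Complex.continuous_exp.comp_continuousOn
    exact continuousOn_const.mul (Complex.continuous_ofReal.comp_continuousOn hφc)
  have hi : IntervalIntegrable (fun x => Complex.exp (Complex.I * φ x)) volume N (2 * N) := by
    apply ContinuousOn.intervalIntegrable; rwa [hu]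
  set F : ℝ → ℂ := fun y => ∫ x in N..y, Complex.exp (Complex.I * φ x) with hF
  have hFc : ContinuousOn F (Set.uIcc N (2 * N)) := by
    apply intervalIntegral.continuousOn_primitive_interval
    rw [hu]; exact hexpc.integrableOn_Icc
  have key := intervalIntegral.integral_mul_deriv_eq_deriv_mul_of_hasDeriv_right
    (a := N) (b := 2 * N) (u := fun x => (x : ℂ)) (v := F) (u' := fun _ => 1)
    (v' := fun x => Complex.exp (Complex.I * φ x)) (Complex.continuous_ofReal.continuousOn) hFc
    (fun x _ => (hasDerivAt_id x).ofReal_comp.hasDerivWithinAt)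
    (fun x hx => by
      rw [min_eq_left hab, max_eq_right hab] at hx
      have hx' : Set.Icc N (2*N) ∈ nhds x := Icc_mem_nhds hx.1 hx.2
      refine (intervalIntegral.integral_hasDerivAt_right ?_ ?_ ?_).hasDerivWithinAt
      · exact hi.mono_set (by
          rw [hu, Set.uIcc_of_le hx.1.le]; exact Set.Icc_subset_Icc le_rfl hx.2.le)
      · exact ⟨_, hx', hexpc.aestronglyMeasurable measurableSet_Icc⟩
      · exact hexpc.continuousAt hx')
    (by simp) hi
  have e : ∫ x in N..(2 * N), Complex.exp (Complex.I * φ x) * x =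
      ∫ x in N..(2 * N), (x : ℂ) * Complex.exp (Complex.I * φ x) := by
    congr 1; ext x; ring
  rw [e, key]
  have hF0 : F N = 0 := by simp [hF]
  have hB0 : 0 ≤ B := (norm_nonneg _).trans (hB N ⟨le_rfl, hab⟩)
  rw [hF0]
  have k1 : ‖((2 * N : ℝ) : ℂ) * F (2 * N)‖ ≤ 2 * N * B := by
    rw [norm_mul, Complex.norm_real, Real.norm_of_nonneg (by linarith)]
    gcongr; exact hB _ ⟨hab, le_rfl⟩
  have k2 : ‖∫ x in N..(2 * N), 1 * F x‖ ≤ B * |2 * N - N| := by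
    apply intervalIntegral.norm_integral_le_of_norm_le_const
    intro x hx
    rw [Set.uIoc_of_le hab] at hx
    rw [one_mul]; exact hB x ⟨hx.1.le, hx.2⟩
  have : |2 * N - N| = N := by rw [abs_of_pos] <;> linarith
  rw [this] at k2
  refine (norm_sub_le _ _).trans ?_
  rw [mul_zero, sub_zero]
  linarith

def wth (k : ℝ) : ℝ := Real.sqrt (k * Real.tanh k)
def wth1 (k : ℝ) : ℝ := (Real.tanh k + k * (1 - Real.tanh k ^ 2)) / (2 * wth k)
def wth2 (k : ℝ) : ℝ :=
  -((Real.tanh k - k * (1 - Real.tanh k ^ 2)) ^ 2 +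
    4 * k ^ 2 * (1 - Real.tanh k ^ 2) * Real.tanh k ^ 2) / (4 * wth k ^ 3)

lemma tanh_hasDeriv (k : ℝ) : HasDerivAt Real.tanh (1 - Real.tanh k ^ 2) k := by
  have hc := (Real.cosh_pos k).ne'
  have : Real.tanh = fun x => Real.sinh x / Real.cosh x := by ext x; exact Real.tanh_eq_sinh_div_cosh x
  rw [this]
  refine ((Real.hasDerivAt_sinh k).div (Real.hasDerivAt_cosh k) hc).congr_deriv ?_
  field_simp

lemma tanh_facts {k : ℝ} (hk : 0 < k) : k / (1 + k) ≤ Real.tanh k ∧ Real.tanh k < 1 ∧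
    Real.tanh k ≤ k ∧ k * (1 - Real.tanh k ^ 2) ≤ 1 / 2 := by
  have hc := Real.cosh_pos k
  have hcs := Real.cosh_sq k
  have hs : k ≤ Real.sinh k := Real.self_le_sinh_iff.2 hk.le
  have h1 : Real.tanh k < 1 := Real.tanh_lt_one k
  have hE : 2 * k + 1 ≤ Real.exp (2 * k) := by linarith [Real.add_one_le_exp (2 * k)]
  refine ⟨?_, h1, ?_, ?_⟩
  · rw [Real.tanh_eq_sinh_div_cosh, div_le_div_iff₀ (by linarith) hc, Real.sinh_eq, Real.cosh_eq]
    have e0 : 0 < Real.exp (-k) := Real.exp_pos _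
    have : Real.exp k = Real.exp (2 * k) * Real.exp (-k) := by rw [← Real.exp_add]; ring_nf
    rw [this]
    nlinarith
  · -- tanh k ≤ k : via mean value (derivative ≤ 1)
    have := (convex_Ici (0:ℝ)).image_sub_le_mul_sub_of_deriv_le (f := Real.tanh) (C := 1)
      (fun y _ => (tanh_hasDeriv y).continuousAt.continuousWithinAt)
      (fun y _ => (tanh_hasDeriv y).differentiableAt.differentiableWithinAt)
      (fun y _ => by rw [(tanh_hasDeriv y).deriv]; nlinarith [sq_nonneg (Real.tanh y)])
      0 (by simp) k (by simpa using hk.le) hk.le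
    simpa using this
  · have e : 1 - Real.tanh k ^ 2 = 1 / Real.cosh k ^ 2 := by
      rw [Real.tanh_eq_sinh_div_cosh]; field_simp; linarith
    rw [e, mul_one_div, div_le_div_iff₀ (by positivity) (by norm_num)]
    nlinarith [sq_nonneg (k - 1)]

lemma wth_pos {k : ℝ} (hk : 0 < k) : 0 < wth k := by
  have := (tanh_facts hk).1
  have h : 0 < Real.tanh k := lt_of_lt_of_le (by positivity) this
  exact Real.sqrt_pos.2 (by positivity)

lemma wth_hasDeriv {k : ℝ} (hk : 0 < k) : HasDerivAt wth (wth1 k) k := by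
  have h : 0 < Real.tanh k := lt_of_lt_of_le (by positivity) (tanh_facts hk).1
  have := ((hasDerivAt_id k).mul (tanh_hasDeriv k)).sqrt (by simp; constructor <;> positivity)
  refine this.congr_deriv ?_
  simp [wth1, wth]

lemma wth_sq {k : ℝ} (hk : 0 < k) : wth k ^ 2 = k * Real.tanh k := by
  have h : 0 < Real.tanh k := lt_of_lt_of_le (by positivity) (tanh_facts hk).1
  exact Real.sq_sqrt (by positivity)

lemma wth1_hasDeriv {k : ℝ} (hk : 0 < k) : HasDerivAt wth1 (wth2 k) k := by
  have hw := wth_pos hk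
  have d1 := (tanh_hasDeriv k).fun_add ((hasDerivAt_id' k).fun_mul (((tanh_hasDeriv k).fun_pow 2).const_sub 1))
  have d2 := (wth_hasDeriv hk).const_mul 2
  have := d1.fun_div d2 (by positivity)
  refine this.congr_deriv ?_
  have hsq := wth_sq hk
  rw [wth2, wth1]
  set τ := Real.tanh k
  set w := wth k
  field_simp
  push_cast
  ring_nf
  simp only [hsq]
  ring

lemma wth2_cont {k : ℝ} (hk : 0 < k) : ContinuousAt wth2 k := by
  have hw := wth_pos hk
  have c1 := (tanh_hasDeriv k).continuousAt
  have c2 := (wth_hasDeriv hk).continuousAt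
  unfold wth2
  refine ContinuousAt.div (by fun_prop) (by fun_prop) (by positivity)

lemma wth1_ge {k : ℝ} (hk : 0 < k) : 1 / (2 * Real.sqrt (1 + k)) ≤ wth1 k := by
  obtain ⟨h1, h2, h3, h4⟩ := tanh_facts hk
  have hτ : 0 < Real.tanh k := lt_of_lt_of_le (by positivity) h1
  have hw := wth_pos hk
  have hsq := wth_sq hk
  have hP : 0 < Real.sqrt (1 + k) := Real.sqrt_pos.2 (by linarith)
  have hPs : Real.sqrt (1 + k) ^ 2 = 1 + k := Real.sq_sqrt (by linarith)
  rw [wth1, div_le_div_iff₀ (by positivity) (by positivity)]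
  have hs : 0 ≤ 1 - Real.tanh k ^ 2 := by nlinarith
  have : wth k ≤ Real.tanh k * Real.sqrt (1 + k) := by
    refine (sq_le_sq₀ (by positivity) (by positivity)).1 ?_
    rw [mul_pow, hPs, hsq]
    rw [div_le_iff₀ (by linarith)] at h1
    nlinarith
  have h5 : 0 ≤ k * (1 - Real.tanh k ^ 2) * Real.sqrt (1 + k) := by positivity
  nlinarith

lemma wth2_le {k : ℝ} (hk : 0 < k) : k / (100 * Real.sqrt (1 + k) ^ 5) ≤ -wth2 k := by
  obtain ⟨h1, h2, h3, h4⟩ := tanh_facts hk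
  have hτ : 0 < Real.tanh k := lt_of_lt_of_le (by positivity) h1
  have hw := wth_pos hk
  have hsq := wth_sq hk
  have hP : 0 < Real.sqrt (1 + k) := Real.sqrt_pos.2 (by linarith)
  have hPs : Real.sqrt (1 + k) ^ 2 = 1 + k := Real.sq_sqrt (by linarith)
  set P := Real.sqrt (1 + k) with hPdef
  set τ := Real.tanh k with hτdef
  have hs : 0 ≤ 1 - τ ^ 2 := by nlinarith
  set q := k / (1 + k) with hq
  have hq0 : 0 < q := by positivity
  have hq1 : q ≤ 1 := by rw [hq, div_le_one (by linarith)]; linarith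
  have hqk : q ≤ k := by rw [hq, div_le_iff₀ (by linarith)]; nlinarith
  -- lower bound for D
  have hD : 0.16 * q ^ 4 ≤ (τ - k * (1 - τ ^ 2)) ^ 2 + 4 * k ^ 2 * (1 - τ ^ 2) * τ ^ 2 := by
    have hq4 : q ^ 4 ≤ 1 := pow_le_one₀ hq0.le hq1
    rcases le_total (1 - τ ^ 2) (1 / 10) with hc | hc
    · have : 0.94 ≤ τ := by nlinarith
      have h5 : 0.4 ≤ τ - k * (1 - τ ^ 2) := by linarith
      have h6 : 0 ≤ 4 * k ^ 2 * (1 - τ ^ 2) * τ ^ 2 := by positivity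
      nlinarith
    · have h5 : q ^ 4 ≤ k ^ 2 * τ ^ 2 := by
        have : q ^ 2 ≤ k * τ := by rw [sq]; exact mul_le_mul hqk h1 hq0.le hk.le
        calc q ^ 4 = (q ^ 2) ^ 2 := by ring
          _ ≤ (k * τ) ^ 2 := by gcongr
          _ = _ := by ring
      have h6 : 0 ≤ k ^ 2 * τ ^ 2 := by positivity
      nlinarith [sq_nonneg (τ - k * (1 - τ ^ 2))]
  have hwle : wth k ≤ 1.42 * k / P := by
    rw [le_div_iff₀ hP]
    refine (sq_le_sq₀ (by positivity) (by positivity)).1 ?_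
    rw [mul_pow, hPs, hsq]
    have : τ * (1 + k) ≤ 2 * k := by
      rcases le_total k 1 with h | h <;> nlinarith
    nlinarith
  have hw3 : wth k ^ 3 ≤ 3 * k ^ 3 / P ^ 3 := by
    calc wth k ^ 3 ≤ (1.42 * k / P) ^ 3 := by gcongr
      _ = (1.42 ^ 3 * k ^ 3) / P ^ 3 := by rw [div_pow, mul_pow]
      _ ≤ _ := by gcongr; norm_num
  have hP8 : q = k / P ^ 2 := by rw [hPs]
  have e : -wth2 k = ((τ - k * (1 - τ ^ 2)) ^ 2 + 4 * k ^ 2 * (1 - τ ^ 2) * τ ^ 2) / (4 * wth k ^ 3) := by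
    rw [wth2, neg_div, neg_neg]
  rw [e]
  calc k / (100 * P ^ 5) ≤ 0.16 * q ^ 4 / (4 * (3 * k ^ 3 / P ^ 3)) := by
        rw [hP8]
        rw [show 0.16 * (k / P ^ 2) ^ 4 / (4 * (3 * k ^ 3 / P ^ 3)) = (0.16 / 12) * (k / P ^ 5) by
          field_simp; norm_num]
        rw [show k / (100 * P ^ 5) = (1/100) * (k / P ^ 5) by field_simp]
        exact mul_le_mul_of_nonneg_right (by norm_num) (by positivity)
    _ ≤ 0.16 * q ^ 4 / (4 * wth k ^ 3) := by gcongr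
    _ ≤ _ := by gcongr

lemma angular_ibp {J J0 : ℝ → ℂ} {B0 R δ : ℝ} (hB0 : 0 ≤ B0) (hR : R ≠ 0)
    (hδ : 0 < δ) (hδ1 : δ ≤ Real.pi / 2) (hJ : Continuous J)
    (hd : ∀ c, HasDerivAt J0 (2 * Real.pi * Complex.I * J c) c)
    (hb0 : ∀ c, ‖J0 c‖ ≤ B0) :
    ‖∫ α in δ..(Real.pi / 2), J (R * Real.cos α)‖ ≤ B0 / (2 * |R| * δ) := by
  have hu : Set.uIcc δ (Real.pi / 2) = Set.Icc δ (Real.pi / 2) := Set.uIcc_of_le hδ1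
  have hpi := Real.pi_pos
  have hsin : ∀ α ∈ Set.Icc δ (Real.pi / 2), 0 < Real.sin α := fun α hα =>
    Real.sin_pos_of_pos_of_lt_pi (by linarith [hα.1]) (by linarith [hα.2])
  have hcos : ∀ α ∈ Set.Icc δ (Real.pi / 2), 0 ≤ Real.cos α := fun α hα =>
    Real.cos_nonneg_of_neg_pi_div_two_le_of_le (by linarith [hα.1]) (by linarith [hα.2])
  have hJ0 : Continuous J0 := continuous_iff_continuousAt.2 fun c => (hd c).continuousAt
  set a : ℝ := 1 / (2 * Real.pi * R) with ha
  have hinv : ∀ α ∈ Set.uIcc δ (Real.pi / 2), HasDerivAt (fun α => (Real.sin α)⁻¹)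
      (-Real.cos α / Real.sin α ^ 2) α := by
    intro α hα; rw [hu] at hα
    exact (Real.hasDerivAt_sin α).fun_inv (hsin α hα).ne'
  have hcc : ContinuousOn (fun α => Real.cos α / Real.sin α ^ 2) (Set.uIcc δ (Real.pi / 2)) := by
    rw [hu]
    exact Real.continuous_cos.continuousOn.div (Real.continuous_sin.pow 2).continuousOn
      (fun α hα => pow_ne_zero 2 (hsin α hα).ne')
  have hder : ∀ α ∈ Set.uIcc δ (Real.pi / 2), HasDerivAt
      (fun α => (a * Complex.I) * (((Real.sin α)⁻¹ : ℝ) : ℂ) * J0 (R * Real.cos α))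
      (J (R * Real.cos α) - (a * Complex.I) * ((Real.cos α / Real.sin α ^ 2 : ℝ) : ℂ) * J0 (R * Real.cos α)) α := by
    intro α hα
    have e1 := ((hinv α hα).ofReal_comp).const_mul (a * Complex.I)
    have e2 : HasDerivAt (fun α => J0 (R * Real.cos α))
        ((R * -Real.sin α) • (2 * Real.pi * Complex.I * J (R * Real.cos α))) α :=
      (hd (R * Real.cos α)).scomp α ((Real.hasDerivAt_cos α).const_mul R)
    refine (e1.mul e2).congr_deriv ?_
    rw [hu] at hα
    have h1 : (Real.sin α : ℂ) ≠ 0 := by exact_mod_cast (hsin α hα).ne'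
    have h2 : (R : ℂ) ≠ 0 := by exact_mod_cast hR
    have h3 : (Real.pi : ℂ) ≠ 0 := by exact_mod_cast hpi.ne'
    rw [ha, Complex.real_smul]
    push_cast at h1 ⊢
    field_simp
    have hI := Complex.I_sq
    ring_nf
    rw [hI]; ring
  have i1 : IntervalIntegrable (fun α => J (R * Real.cos α)) volume δ (Real.pi / 2) :=
    (hJ.comp (continuous_const.mul Real.continuous_cos)).intervalIntegrable _ _
  have i2 : IntervalIntegrable (fun α => (a * Complex.I) * ((Real.cos α / Real.sin α ^ 2 : ℝ) : ℂ) *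
      J0 (R * Real.cos α)) volume δ (Real.pi / 2) := by
    apply ContinuousOn.intervalIntegrable
    exact (continuousOn_const.mul (Complex.continuous_ofReal.comp_continuousOn hcc)).mul
      (hJ0.comp (continuous_const.mul Real.continuous_cos)).continuousOn
  have key := intervalIntegral.integral_eq_sub_of_hasDerivAt hder (i1.sub i2)
  rw [intervalIntegral.integral_sub i1 i2, sub_eq_iff_eq_add] at key
  have hsδ : 2 / Real.pi * δ ≤ Real.sin δ := Real.mul_le_sin hδ.le hδ1
  have hsδ0 : 0 < Real.sin δ := hsin δ ⟨le_rfl, hδ1⟩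
  have hb2 : ‖∫ α in δ..(Real.pi / 2), (a * Complex.I) * ((Real.cos α / Real.sin α ^ 2 : ℝ) : ℂ) *
      J0 (R * Real.cos α)‖ ≤ |a| * B0 * ((Real.sin δ)⁻¹ - 1) := by
    have e : ∫ α in δ..(Real.pi / 2), |a| * B0 * (Real.cos α / Real.sin α ^ 2) =
        |a| * B0 * ((Real.sin δ)⁻¹ - 1) := by
      rw [intervalIntegral.integral_const_mul]
      congr 1
      have : ∀ α ∈ Set.uIcc δ (Real.pi / 2), HasDerivAt (fun α => -(Real.sin α)⁻¹)
          (Real.cos α / Real.sin α ^ 2) α := by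
        intro α hα
        refine (hinv α hα).fun_neg.congr_deriv ?_
        rw [neg_div, neg_neg]
      rw [intervalIntegral.integral_eq_sub_of_hasDerivAt this hcc.intervalIntegrable]
      simp; ring
    rw [← e]
    apply intervalIntegral.norm_integral_le_of_norm_le hδ1
    · refine Filter.Eventually.of_forall fun α hα => ?_
      have hα' : α ∈ Set.Icc δ (Real.pi / 2) := ⟨hα.1.le, hα.2⟩
      have h1 : 0 ≤ Real.cos α / Real.sin α ^ 2 := div_nonneg (hcos α hα') (sq_nonneg _)
      simp only [norm_mul, Complex.norm_I, Complex.norm_real, Real.norm_eq_abs, mul_one]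
      rw [abs_of_nonneg h1]
      have := hb0 (R * Real.cos α)
      calc |a| * (Real.cos α / Real.sin α ^ 2) * ‖J0 (R * Real.cos α)‖
          ≤ |a| * (Real.cos α / Real.sin α ^ 2) * B0 := by gcongr
        _ = _ := by ring
    · exact (hcc.intervalIntegrable).const_mul _
  have hend : ∀ α, ‖(a * Complex.I) * (((Real.sin α)⁻¹ : ℝ) : ℂ) * J0 (R * Real.cos α)‖ ≤
      |a| * |(Real.sin α)⁻¹| * B0 := by
    intro α
    simp only [norm_mul, Complex.norm_I, Complex.norm_real, Real.norm_eq_abs, mul_one]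
    have := hb0 (R * Real.cos α)
    gcongr
  have e1 := hend (Real.pi / 2)
  have e2 := hend δ
  rw [abs_of_pos (inv_pos.2 hsδ0)] at e2
  rw [Real.sin_pi_div_two] at e1
  rw [key]
  have hfin : |a| * 1 * B0 + |a| * (Real.sin δ)⁻¹ * B0 + |a| * B0 * ((Real.sin δ)⁻¹ - 1) ≤
      B0 / (2 * |R| * δ) := by
    have : (Real.sin δ)⁻¹ ≤ (2 / Real.pi * δ)⁻¹ := by gcongr
    have hRa : 0 < |R| := abs_pos.2 hR
    have ha' : |a| = 1 / (2 * Real.pi * |R|) := by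
      rw [ha, abs_div, abs_mul, abs_mul, abs_one, abs_of_pos hpi]; simp
    calc _ = 2 * |a| * B0 * (Real.sin δ)⁻¹ := by ring
      _ ≤ 2 * |a| * B0 * (2 / Real.pi * δ)⁻¹ := by gcongr
      _ = _ := by rw [ha']; field_simp
  refine le_trans ?_ hfin
  refine (norm_add_le _ _).trans (add_le_add ((norm_sub_le _ _).trans (add_le_add ?_ e2)) hb2)
  simpa using e1

lemma angular_quarter {J J0 : ℝ → ℂ} {B0 R N : ℝ} (hB0 : 0 ≤ B0) (hR : R ≠ 0) (hN : 0 < N)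
    (hJ : Continuous J)
    (hd : ∀ c, HasDerivAt J0 (2 * Real.pi * Complex.I * J c) c)
    (hb0 : ∀ c, ‖J0 c‖ ≤ B0) (hb : ∀ c, ‖J c‖ ≤ 3 * N * B0) :
    ‖∫ α in (0:ℝ)..(Real.pi / 2), J (R * Real.cos α)‖ ≤ 5 * B0 * Real.sqrt (N / |R|) := by
  have hRa : 0 < |R| := abs_pos.2 hR
  have hpi := Real.pi_pos
  have hpi3 := Real.pi_gt_three
  have hpi4 := Real.pi_lt_d2
  have triv : ∀ x, 0 ≤ x → ‖∫ α in (0:ℝ)..x, J (R * Real.cos α)‖ ≤ 3 * N * B0 * x := by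
    intro x hx
    have := intervalIntegral.norm_integral_le_of_norm_le_const (a := 0) (b := x) (C := 3 * N * B0)
      (f := fun α => J (R * Real.cos α)) (fun α _ => hb _)
    simpa [abs_of_nonneg hx] using this
  rcases le_total (N * |R|) 1 with h | h
  · have : N ≤ Real.sqrt (N / |R|) := by
      apply Real.le_sqrt_of_sq_le
      rw [le_div_iff₀ hRa]; nlinarith
    calc _ ≤ 3 * N * B0 * (Real.pi / 2) := triv _ (by positivity)
      _ ≤ 3 * Real.sqrt (N / |R|) * B0 * (3.15 / 2) := by gcongr
      _ ≤ _ := by nlinarith [mul_nonneg (Real.sqrt_nonneg (N / |R|)) hB0]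
  · set δ := 1 / Real.sqrt (N * |R|) with hδ
    have hs : 1 ≤ Real.sqrt (N * |R|) := Real.one_le_sqrt.2 h
    have hs0 : 0 < Real.sqrt (N * |R|) := by linarith
    have hss : Real.sqrt (N * |R|) ^ 2 = N * |R| := Real.sq_sqrt (by positivity)
    have hδ0 : 0 < δ := by positivity
    have hδ1 : δ ≤ 1 := by rw [hδ, div_le_one hs0]; exact hs
    have hc : Continuous (fun α => J (R * Real.cos α)) := hJ.comp (continuous_const.mul Real.continuous_cos)
    rw [← intervalIntegral.integral_add_adjacent_intervals (b := δ)
      (hc.intervalIntegrable _ _) (hc.intervalIntegrable _ _)]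
    have k1 := triv δ hδ0.le
    have k2 := angular_ibp hB0 hR hδ0 (by linarith) hJ hd hb0
    have f1 : N * δ = Real.sqrt (N / |R|) := by
      symm
      rw [Real.sqrt_eq_iff_mul_self_eq (by positivity) (by positivity), hδ]
      field_simp
      exact hss
    have f2 : 1 / (|R| * δ) = Real.sqrt (N / |R|) := by
      rw [← f1, hδ]; field_simp; rw [mul_comm |R| N]; exact hss
    calc _ ≤ 3 * N * B0 * δ + B0 / (2 * |R| * δ) := (norm_add_le _ _).trans (add_le_add k1 k2)
      _ = 3 * B0 * (N * δ) + B0 / 2 * (1 / (|R| * δ)) := by field_simp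
      _ = 3 * B0 * Real.sqrt (N / |R|) + B0 / 2 * Real.sqrt (N / |R|) := by rw [f1, f2]
      _ ≤ _ := by nlinarith [mul_nonneg (Real.sqrt_nonneg (N / |R|)) hB0]

lemma angular_full {J J0 : ℝ → ℂ} {B0 R N : ℝ} (hB0 : 0 ≤ B0) (hR : 0 < R) (hN : 0 < N)
    (hJ : Continuous J)
    (hd : ∀ c, HasDerivAt J0 (2 * Real.pi * Complex.I * J c) c)
    (hb0 : ∀ c, ‖J0 c‖ ≤ B0) (hb : ∀ c, ‖J c‖ ≤ 3 * N * B0) :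
    ‖∫ α in (-Real.pi)..Real.pi, J (R * Real.cos α)‖ ≤ 20 * B0 * Real.sqrt (N / R) := by
  have q1 := angular_quarter hB0 hR.ne' hN hJ hd hb0 hb
  have q2 := angular_quarter hB0 (neg_ne_zero.2 hR.ne') hN hJ hd hb0 hb
  rw [abs_neg] at q2
  rw [abs_of_pos hR] at q1 q2
  have hc : Continuous (fun α => J (R * Real.cos α)) := hJ.comp (continuous_const.mul Real.continuous_cos)
  have hi : ∀ a b, IntervalIntegrable (fun α => J (R * Real.cos α)) volume a b :=
    fun a b => hc.intervalIntegrable a b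
  have e1 : ∫ α in (Real.pi / 2)..Real.pi, J (R * Real.cos α) =
      ∫ α in (0:ℝ)..(Real.pi / 2), J (-R * Real.cos α) := by
    have := intervalIntegral.integral_comp_sub_left (a := 0) (b := Real.pi / 2)
      (fun α => J (R * Real.cos α)) Real.pi
    simp only [Real.cos_pi_sub, sub_zero] at this
    rw [show Real.pi - Real.pi / 2 = Real.pi / 2 by ring] at this
    rw [← this]; congr 1; ext α; ring_nf
  have e2 : ∫ α in (-Real.pi)..0, J (R * Real.cos α) = ∫ α in (0:ℝ)..Real.pi, J (R * Real.cos α) := by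
    have := intervalIntegral.integral_comp_neg (a := 0) (b := Real.pi) (fun α => J (R * Real.cos α))
    simp only [Real.cos_neg, neg_zero] at this
    exact this.symm
  have e3 := intervalIntegral.integral_add_adjacent_intervals (hi 0 (Real.pi / 2)) (hi (Real.pi / 2) Real.pi)
  have e4 := intervalIntegral.integral_add_adjacent_intervals (hi (-Real.pi) 0) (hi 0 Real.pi)
  rw [← e4, e2, ← e3, e1]
  refine (norm_add_le _ _).trans ?_
  have := norm_add_le (∫ α in (0:ℝ)..(Real.pi / 2), J (R * Real.cos α))
    (∫ α in (0:ℝ)..(Real.pi / 2), J (-R * Real.cos α))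
  linarith

/-- dispersion relation -/
def omg (μ ρ : ℝ) : ℝ := wth (Real.sqrt μ * ρ) / Real.sqrt μ

/-- radial phase -/
def rph (μ t c ρ : ℝ) : ℝ := 2 * Real.pi * (c * ρ - t * omg μ ρ)

lemma wth_cont : Continuous wth := by
  unfold wth
  apply Real.continuous_sqrt.comp
  apply continuous_id.mul
  exact continuous_iff_continuousAt.2 fun x => (tanh_hasDeriv x).continuousAt

lemma omg_cont (μ : ℝ) : Continuous (omg μ) := by
  unfold omg
  exact (wth_cont.comp (continuous_const.mul continuous_id)).div_const _

lemma rph_deriv {μ t c ρ : ℝ} (hμ : 0 < μ) (hρ : 0 < ρ) :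
    HasDerivAt (rph μ t c) (2 * Real.pi * (c - t * wth1 (Real.sqrt μ * ρ))) ρ := by
  have hs : 0 < Real.sqrt μ := Real.sqrt_pos.2 hμ
  have h1 : HasDerivAt (fun ρ => wth (Real.sqrt μ * ρ)) (wth1 (Real.sqrt μ * ρ) * (Real.sqrt μ)) ρ := by
    have := (wth_hasDeriv (k := Real.sqrt μ * ρ) (by positivity)).comp ρ
      ((hasDerivAt_id ρ).const_mul (Real.sqrt μ))
    exact this.congr_deriv (by rw [mul_one])
  have h2 := ((((hasDerivAt_id ρ).const_mul c).fun_sub ((h1.div_const (Real.sqrt μ)).const_mul t)).const_mul (2 * Real.pi))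
  refine h2.congr_deriv ?_
  field_simp

lemma rph_deriv2 {μ t c ρ : ℝ} (hμ : 0 < μ) (hρ : 0 < ρ) :
    HasDerivAt (fun ρ => 2 * Real.pi * (c - t * wth1 (Real.sqrt μ * ρ)))
      (2 * Real.pi * (t * Real.sqrt μ * (- wth2 (Real.sqrt μ * ρ)))) ρ := by
  have hs : 0 < Real.sqrt μ := Real.sqrt_pos.2 hμ
  have h1 : HasDerivAt (fun ρ => wth1 (Real.sqrt μ * ρ)) (wth2 (Real.sqrt μ * ρ) * (Real.sqrt μ)) ρ := by
    have := (wth1_hasDeriv (k := Real.sqrt μ * ρ) (by positivity)).comp ρ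
      ((hasDerivAt_id ρ).const_mul (Real.sqrt μ))
    exact this.congr_deriv (by rw [mul_one])
  have h2 := ((h1.const_mul t).const_sub c).const_mul (2 * Real.pi)
  refine h2.congr_deriv ?_
  ring

lemma rad_common {μ t N c : ℝ} (hμ : 0 < μ) (ht : 0 < t) (hN : 0 < N) :
    (∀ x ∈ Set.Icc N (2 * N), HasDerivAt (rph μ t c) (2 * Real.pi * (c - t * wth1 (Real.sqrt μ * x))) x) ∧
    (∀ x ∈ Set.Icc N (2 * N), HasDerivAt (fun ρ => 2 * Real.pi * (c - t * wth1 (Real.sqrt μ * ρ)))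
      (2 * Real.pi * (t * Real.sqrt μ * (- wth2 (Real.sqrt μ * x)))) x) ∧
    ContinuousOn (fun x => 2 * Real.pi * (t * Real.sqrt μ * (- wth2 (Real.sqrt μ * x)))) (Set.Icc N (2 * N)) ∧
    (∀ x ∈ Set.Icc N (2 * N), 2 * Real.pi * (t * Real.sqrt μ *
        (Real.sqrt μ * N / (600 * Real.sqrt (1 + Real.sqrt μ * N) ^ 5))) ≤
      2 * Real.pi * (t * Real.sqrt μ * (- wth2 (Real.sqrt μ * x)))) ∧
    (∀ x ∈ Set.Icc N (2 * N), 1 / (3 * Real.sqrt (1 + Real.sqrt μ * N)) ≤ wth1 (Real.sqrt μ * x)) := by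
  have hs : 0 < Real.sqrt μ := Real.sqrt_pos.2 hμ
  have hpi := Real.pi_pos
  have hP : ∀ x ∈ Set.Icc N (2 * N), Real.sqrt (1 + Real.sqrt μ * x) ≤
      Real.sqrt 2 * Real.sqrt (1 + Real.sqrt μ * N) := by
    intro x hx
    rw [← Real.sqrt_mul (by norm_num)]
    apply Real.sqrt_le_sqrt
    nlinarith [hx.2, hx.1]
  have h2 : Real.sqrt 2 ≤ 1.415 := by
    rw [Real.sqrt_le_left (by norm_num)]; norm_num
  have hPp : 0 < Real.sqrt (1 + Real.sqrt μ * N) := Real.sqrt_pos.2 (by positivity)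
  refine ⟨fun x hx => rph_deriv hμ (by linarith [hx.1]), fun x hx => rph_deriv2 hμ (by linarith [hx.1]), ?_, ?_, ?_⟩
  · intro x hx
    have hx0 : 0 < x := by linarith [hx.1]
    have : ContinuousAt (fun x => wth2 (Real.sqrt μ * x)) x :=
      ContinuousAt.comp (f := fun x => Real.sqrt μ * x) (wth2_cont (by positivity)) (by fun_prop)
    exact (continuousAt_const.mul (continuousAt_const.mul this.neg)).continuousWithinAt
  · intro x hx
    have hx0 : 0 < x := by linarith [hx.1]
    have h := wth2_le (k := Real.sqrt μ * x) (by positivity)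
    have h5 : Real.sqrt (1 + Real.sqrt μ * x) ^ 5 ≤ 6 * Real.sqrt (1 + Real.sqrt μ * N) ^ 5 := by
      calc _ ≤ (1.415 * Real.sqrt (1 + Real.sqrt μ * N)) ^ 5 := by
            gcongr; exact (hP x hx).trans (by gcongr)
        _ = 1.415 ^ 5 * Real.sqrt (1 + Real.sqrt μ * N) ^ 5 := by ring
        _ ≤ _ := by gcongr; norm_num
    have hpx : 0 < Real.sqrt (1 + Real.sqrt μ * x) := Real.sqrt_pos.2 (by positivity)
    have : Real.sqrt μ * N / (600 * Real.sqrt (1 + Real.sqrt μ * N) ^ 5) ≤ -wth2 (Real.sqrt μ * x) := by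
      refine le_trans ?_ h
      have hxN := hx.1
      rw [div_le_div_iff₀ (by positivity) (by positivity)]
      have : Real.sqrt μ * N * (100 * Real.sqrt (1 + Real.sqrt μ * x) ^ 5) ≤
        Real.sqrt μ * x * (100 * (6 * Real.sqrt (1 + Real.sqrt μ * N) ^ 5)) := by gcongr
      linarith
    gcongr
  · intro x hx
    have hx0 : 0 < x := by linarith [hx.1]
    have h := wth1_ge (k := Real.sqrt μ * x) (by positivity)
    have hpx : 0 < Real.sqrt (1 + Real.sqrt μ * x) := Real.sqrt_pos.2 (by positivity)
    refine le_trans ?_ h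
    have := hP x hx
    apply one_div_le_one_div_of_le (by positivity)
    nlinarith

lemma rad_sub {μ t N c : ℝ} (hμ : 0 < μ) (ht : 0 < t) (hN : 0 < N) {y : ℝ} (hy : y ∈ Set.Icc N (2 * N)) :
    ‖∫ x in N..y, Complex.exp (Complex.I * rph μ t c x)‖ ≤
      60 * Real.sqrt (Real.sqrt (1 + Real.sqrt μ * N) ^ 5 / (t * Real.sqrt μ * (Real.sqrt μ * N))) := by
  obtain ⟨a1, a2, a3, a4, a5⟩ := rad_common (c := c) hμ ht hN
  have hs : 0 < Real.sqrt μ := Real.sqrt_pos.2 hμ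
  have hpi := Real.pi_pos
  have hpi3 := Real.pi_gt_three
  have hPp : 0 < Real.sqrt (1 + Real.sqrt μ * N) := Real.sqrt_pos.2 (by positivity)
  have hsub : Set.Icc N y ⊆ Set.Icc N (2 * N) := Set.Icc_subset_Icc_right hy.2
  refine (vdc2 hy.1 (l := 2 * Real.pi * (t * Real.sqrt μ *
        (Real.sqrt μ * N / (600 * Real.sqrt (1 + Real.sqrt μ * N) ^ 5)))) (by positivity)
    (fun x hx => a1 x (hsub hx)) (fun x hx => a2 x (hsub hx)) (a3.mono hsub) (fun x hx => a4 x (hsub hx))).trans ?_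
  set Q := Real.sqrt (1 + Real.sqrt μ * N) ^ 5 / (t * Real.sqrt μ * (Real.sqrt μ * N)) with hQ
  have hQ0 : 0 < Q := by positivity
  have e : 2 * Real.pi * (t * Real.sqrt μ *
        (Real.sqrt μ * N / (600 * Real.sqrt (1 + Real.sqrt μ * N) ^ 5))) = 2 * Real.pi / 600 / Q := by
    rw [hQ]; field_simp
  rw [e]
  have h1 : 1 / (10 * Real.sqrt Q) ≤ Real.sqrt (2 * Real.pi / 600 / Q) := by
    apply Real.le_sqrt_of_sq_le
    rw [div_pow, mul_pow, Real.sq_sqrt hQ0.le, le_div_iff₀ hQ0]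
    field_simp; linarith
  calc 6 / Real.sqrt (2 * Real.pi / 600 / Q) ≤ 6 / (1 / (10 * Real.sqrt Q)) := by
        have : 0 < Real.sqrt Q := Real.sqrt_pos.2 hQ0
        gcongr
    _ = 60 * Real.sqrt Q := by field_simp; ring

lemma rad_sub' {μ t N c : ℝ} (hμ : 0 < μ) (ht : 0 < t) (hN : 0 < N) {y : ℝ} (hy : y ∈ Set.Icc N (2 * N))
    (hc : c ≤ t / (6 * Real.sqrt (1 + Real.sqrt μ * N))) :
    ‖∫ x in N..y, Complex.exp (Complex.I * rph μ t c x)‖ ≤ 2 * Real.sqrt (1 + Real.sqrt μ * N) / t := by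
  obtain ⟨a1, a2, a3, a4, a5⟩ := rad_common (c := c) hμ ht hN
  have hs : 0 < Real.sqrt μ := Real.sqrt_pos.2 hμ
  have hpi := Real.pi_pos
  have hpi3 := Real.pi_gt_three
  have hPp : 0 < Real.sqrt (1 + Real.sqrt μ * N) := Real.sqrt_pos.2 (by positivity)
  set P := Real.sqrt (1 + Real.sqrt μ * N)
  have hsub : Set.Icc N y ⊆ Set.Icc N (2 * N) := Set.Icc_subset_Icc_right hy.2
  refine (vdc1_neg hy.1 (Λ := t / P) (by positivity)
    (fun x hx => a1 x (hsub hx)) (fun x hx => a2 x (hsub hx)) (a3.mono hsub)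
    (fun x hx => le_trans (by positivity) (a4 x (hsub hx))) ?_).trans ?_
  · intro x hx
    have h := a5 x (hsub hx)
    have h2 : t * (1 / (3 * P)) ≤ t * wth1 (Real.sqrt μ * x) := by gcongr
    have h3 : c - t * wth1 (Real.sqrt μ * x) ≤ -(t / (6 * P)) := by
      have : t * (1 / (3 * P)) = 2 * (t / (6 * P)) := by field_simp; norm_num
      linarith
    have h4 : t / P = 6 * (t / (6 * P)) := by field_simp
    have : 0 < t / (6 * P) := by positivity
    rw [h4]
    nlinarith
  · rw [div_div_eq_mul_div]

def J0r (μ t N c : ℝ) : ℂ := ∫ ρ in N..(2 * N), Complex.exp (Complex.I * rph μ t c ρ)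
def J1r (μ t N c : ℝ) : ℂ := ∫ ρ in N..(2 * N), Complex.exp (Complex.I * rph μ t c ρ) * ρ

lemma rph_cont (μ t : ℝ) : Continuous (fun p : ℝ × ℝ => rph μ t p.1 p.2) := by
  unfold rph
  have := omg_cont μ
  fun_prop

lemma J1r_cont (μ t N : ℝ) : Continuous (J1r μ t N) := by
  unfold J1r
  apply intervalIntegral.continuous_parametric_intervalIntegral_of_continuous'
  have := rph_cont μ t
  simp only [Function.uncurry_def]
  fun_prop

lemma J0r_deriv (μ t N c : ℝ) :
    HasDerivAt (J0r μ t N) (2 * Real.pi * Complex.I * J1r μ t N c) c := by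
  have hcont := rph_cont μ t
  have hc1 : ∀ c, Continuous (rph μ t c) := fun c => hcont.comp (by fun_prop : Continuous fun ρ : ℝ => (c, ρ))
  have := (intervalIntegral.hasDerivAt_integral_of_dominated_loc_of_deriv_le
    (μ := volume) (a := N) (b := 2 * N) (x₀ := c) (s := Set.univ)
    (F := fun c ρ => Complex.exp (Complex.I * rph μ t c ρ))
    (F' := fun c ρ => 2 * Real.pi * Complex.I * (Complex.exp (Complex.I * rph μ t c ρ) * ρ))
    (bound := fun ρ => 2 * Real.pi * |ρ|) Filter.univ_mem
    (Filter.Eventually.of_forall fun c => by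
      have := hc1 c
      exact (by fun_prop : Continuous _).aestronglyMeasurable)
    (by have := hc1 c
        exact (by fun_prop : Continuous _).intervalIntegrable _ _)
    (by have := hc1 c
        exact (by fun_prop : Continuous _).aestronglyMeasurable)
    (Filter.Eventually.of_forall fun ρ _ c _ => by
      simp only [norm_mul, Complex.norm_exp]
      simp [abs_of_pos Real.pi_pos])
    ((by fun_prop : Continuous _).intervalIntegrable _ _)
    (Filter.Eventually.of_forall fun ρ _ c _ => by
      have h1 : HasDerivAt (fun c => rph μ t c ρ) (2 * Real.pi * ρ) c := by
        unfold rph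
        have := (((hasDerivAt_id c).mul_const ρ).sub_const (t * omg μ ρ)).const_mul (2 * Real.pi)
        simpa using this
      have h2 := (h1.ofReal_comp.const_mul Complex.I).cexp
      refine h2.congr_deriv ?_
      push_cast; ring)).2
  unfold J0r
  refine this.congr_deriv ?_
  rw [intervalIntegral.integral_const_mul]; rfl

lemma J_angular {μ t N R : ℝ} (hμ : 0 < μ) (ht : 0 < t) (hN : 0 < N) (hR : 0 ≤ R) :
    ‖∫ α in (-Real.pi)..Real.pi, J1r μ t N (R * Real.cos α)‖ ≤
      3000 * Real.sqrt (1 + Real.sqrt μ * N) ^ 3 / (Real.sqrt μ * t) := by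
  have hs : 0 < Real.sqrt μ := Real.sqrt_pos.2 hμ
  have hpi := Real.pi_pos
  have hpi4 := Real.pi_lt_d2
  have hPp : 0 < Real.sqrt (1 + Real.sqrt μ * N) := Real.sqrt_pos.2 (by positivity)
  have hP2 : Real.sqrt (1 + Real.sqrt μ * N) ^ 2 = 1 + Real.sqrt μ * N := Real.sq_sqrt (by positivity)
  have hcc : ∀ c, ContinuousOn (rph μ t c) (Set.Icc N (2 * N)) := fun c =>
    ((rph_cont μ t).comp (by fun_prop : Continuous fun ρ : ℝ => (c, ρ))).continuousOn
  set P := Real.sqrt (1 + Real.sqrt μ * N) with hP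
  rcases le_or_gt R (t / (6 * P)) with h | h
  · have hb : ∀ α, ‖J1r μ t N (R * Real.cos α)‖ ≤ 3 * N * (2 * P / t) := by
      intro α
      apply amp_le hN (hcc _)
      intro y hy
      apply rad_sub' hμ ht hN hy
      refine le_trans ?_ h
      nlinarith [Real.cos_le_one α]
    have := intervalIntegral.norm_integral_le_of_norm_le_const (a := -Real.pi) (b := Real.pi)
      (C := 3 * N * (2 * P / t)) (f := fun α => J1r μ t N (R * Real.cos α)) (fun α _ => hb _)
    refine this.trans ?_
    rw [show Real.pi - -Real.pi = 2 * Real.pi by ring, abs_of_pos (by positivity)]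
    calc 3 * N * (2 * P / t) * (2 * Real.pi) = 12 * Real.pi * (Real.sqrt μ * N) * P / (Real.sqrt μ * t) := by
          field_simp; ring
      _ ≤ 3000 * P ^ 2 * P / (Real.sqrt μ * t) := by
          gcongr ?_ * P / _
          rw [hP2]
          have : 0 < Real.sqrt μ * N := by positivity
          nlinarith
      _ = _ := by ring
  · have hR0 : 0 < R := lt_trans (by positivity) h
    set B0 := 60 * Real.sqrt (P ^ 5 / (t * Real.sqrt μ * (Real.sqrt μ * N))) with hB0
    have hh := angular_full (B0 := B0) (by positivity) hR0 hN (J1r_cont μ t N) (J0r_deriv μ t N)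
      (fun c => rad_sub hμ ht hN ⟨by linarith, le_rfl⟩)
      (fun c => amp_le hN (hcc _) (fun y hy => rad_sub hμ ht hN hy))
    refine hh.trans ?_
    have h1 : Real.sqrt (N / R) ≤ Real.sqrt (6 * P * N / t) := by
      apply Real.sqrt_le_sqrt
      rw [div_le_div_iff₀ hR0 ht]
      rw [div_lt_iff₀ (by positivity)] at h
      nlinarith
    have h2 : Real.sqrt (P ^ 5 / (t * Real.sqrt μ * (Real.sqrt μ * N))) * Real.sqrt (6 * P * N / t) ≤
        2.5 * P ^ 3 / (Real.sqrt μ * t) := by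
      rw [← Real.sqrt_mul (by positivity)]
      apply Real.sqrt_le_iff.2 ⟨by positivity, ?_⟩
      rw [div_pow, mul_pow]
      have : P ^ 5 / (t * Real.sqrt μ * (Real.sqrt μ * N)) * (6 * P * N / t) = 6 * (P ^ 3) ^ 2 / (Real.sqrt μ * t) ^ 2 := by
        field_simp
      rw [this]
      gcongr; norm_num
    calc 20 * B0 * Real.sqrt (N / R) ≤ 20 * B0 * Real.sqrt (6 * P * N / t) := by gcongr
      _ = 1200 * (Real.sqrt (P ^ 5 / (t * Real.sqrt μ * (Real.sqrt μ * N))) * Real.sqrt (6 * P * N / t)) := by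
          rw [hB0]; ring
      _ ≤ 1200 * (2.5 * P ^ 3 / (Real.sqrt μ * t)) := by gcongr
      _ = _ := by ring

def Ann (N : ℝ) : Set E2 := {ξ | N < ‖ξ‖ ∧ ‖ξ‖ ≤ 2 * N}

lemma Ann_meas (N : ℝ) : MeasurableSet (Ann N) :=
  (measurableSet_lt measurable_const measurable_norm).inter (measurableSet_le measurable_norm measurable_const)

/-- oscillating factor -/
def osc (μ t : ℝ) (x ξ : E2) : ℂ :=
  Complex.exp (Complex.I * ((2 * Real.pi * (inner ℝ x ξ - t * omg μ ‖ξ‖) : ℝ) : ℂ))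

lemma osc_norm (μ t : ℝ) (x ξ : E2) : ‖osc μ t x ξ‖ = 1 := by
  unfold osc; rw [mul_comm, Complex.norm_exp_ofReal_mul_I]

lemma osc_cont (μ : ℝ) : Continuous (fun p : ℝ × E2 × E2 => osc μ p.1 p.2.1 p.2.2) := by
  unfold osc
  have := omg_cont μ
  fun_prop

def Ker (μ N t : ℝ) (x : E2) : ℂ := ∫ ξ in Ann N, osc μ t x ξ

lemma inner_polar (x : E2) : ∃ R β : ℝ, 0 ≤ R ∧ ∀ ρ α : ℝ,
    inner ℝ x (Complex.orthonormalBasisOneI.repr (Complex.polarCoord.symm (ρ, α))) =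
      R * Real.cos (α - β) * ρ := by
  set z := Complex.orthonormalBasisOneI.repr.symm x with hz
  refine ⟨‖z‖, Complex.arg z, norm_nonneg _, fun ρ α => ?_⟩
  have hx : x = Complex.orthonormalBasisOneI.repr z := by rw [hz, LinearIsometryEquiv.apply_symm_apply]
  rw [hx, LinearIsometryEquiv.inner_map_map, Complex.inner, Complex.polarCoord_symm_apply]
  have h1 := Complex.norm_mul_cos_arg z
  have h2 := Complex.norm_mul_sin_arg z
  rw [Real.cos_sub]
  simp [Complex.cos_ofReal_re, Complex.sin_ofReal_re, Complex.cos_ofReal_im]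
  linear_combination (-ρ * Real.cos α) * h1 - ρ * Real.sin α * h2

lemma Ker_polar (μ N t : ℝ) (hN : 0 < N) (x : E2) : ∃ R : ℝ, 0 ≤ R ∧
    Ker μ N t x = ∫ α in (-Real.pi)..Real.pi, J1r μ t N (R * Real.cos α) := by
  obtain ⟨R, β, hR, hin⟩ := inner_polar x
  refine ⟨R, hR, ?_⟩
  have hpi := Real.pi_pos
  have e1 : Ker μ N t x = ∫ z : ℂ, (Ann N).indicator (osc μ t x) (Complex.orthonormalBasisOneI.repr z) := by
    unfold Ker
    rw [← integral_indicator (Ann_meas N)]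
    exact ((LinearIsometryEquiv.measurePreserving Complex.orthonormalBasisOneI.repr).integral_comp
      Complex.orthonormalBasisOneI.repr.toHomeomorph.measurableEmbedding _).symm
  rw [e1, ← Complex.integral_comp_polarCoord_symm]
  set G : ℝ × ℝ → ℂ := fun p => Complex.exp (Complex.I * rph μ t (R * Real.cos (p.2 - β)) p.1) * p.1 with hG
  have hGc : Continuous G := by
    have := rph_cont μ t
    rw [hG]; 
    have h2 : Continuous (fun p : ℝ × ℝ => rph μ t (R * Real.cos (p.2 - β)) p.1) :=
      this.comp (by fun_prop : Continuous fun p : ℝ × ℝ => (R * Real.cos (p.2 - β), p.1))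
    fun_prop
  have e2 : ∫ p in polarCoord.target, p.1 • (Ann N).indicator (osc μ t x)
      (Complex.orthonormalBasisOneI.repr (Complex.polarCoord.symm p)) =
      ∫ p in polarCoord.target, (Set.Ioc N (2 * N) ×ˢ (Set.univ : Set ℝ)).indicator G p := by
    apply setIntegral_congr_fun polarCoord.open_target.measurableSet
    rintro ⟨ρ, α⟩ hp
    have hρ : 0 < ρ := hp.1
    have hn : ‖Complex.orthonormalBasisOneI.repr (Complex.polarCoord.symm (ρ, α))‖ = ρ := by
      rw [LinearIsometryEquiv.norm_map, Complex.norm_polarCoord_symm]; exact abs_of_pos hρ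
    by_cases h : ρ ∈ Set.Ioc N (2 * N)
    · have h' : Complex.orthonormalBasisOneI.repr (Complex.polarCoord.symm (ρ, α)) ∈ Ann N := by
        simp only [Ann, Set.mem_ofPred_eq, hn]; exact h
      simp only
      rw [Set.indicator_of_mem h', Set.indicator_of_mem (by exact ⟨h, Set.mem_univ _⟩)]
      simp only [osc, hn, hin, hG, rph, Complex.real_smul]
      rw [mul_comm]
    · have h' : Complex.orthonormalBasisOneI.repr (Complex.polarCoord.symm (ρ, α)) ∉ Ann N := by
        simp only [Ann, Set.mem_ofPred_eq, hn]; exact h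
      simp only
      rw [Set.indicator_of_notMem h', Set.indicator_of_notMem (by exact fun hh => h hh.1), smul_zero]
  rw [e2, setIntegral_indicator (measurableSet_Ioc.prod MeasurableSet.univ)]
  have e3 : polarCoord.target ∩ (Set.Ioc N (2 * N) ×ˢ (Set.univ : Set ℝ)) =
      Set.Ioc N (2 * N) ×ˢ Set.Ioo (-Real.pi) Real.pi := by
    ext ⟨ρ, α⟩
    simp only [polarCoord_target, Set.mem_inter_iff, Set.mem_prod, Set.mem_Ioi, Set.mem_univ, and_true]
    constructor
    · rintro ⟨⟨a, b⟩, c⟩; exact ⟨c, b⟩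
    · rintro ⟨a, b⟩; exact ⟨⟨hN.trans a.1, b⟩, a⟩
  rw [e3]
  have hIntg : IntegrableOn (fun p : ℝ × ℝ => G p.swap) (Set.Ioo (-Real.pi) Real.pi ×ˢ Set.Ioc N (2 * N)) (volume.prod volume) := by
    refine IntegrableOn.mono_set (t := Set.Icc (-Real.pi) Real.pi ×ˢ Set.Icc N (2 * N)) ?_
      (Set.prod_mono Set.Ioo_subset_Icc_self Set.Ioc_subset_Icc_self)
    exact (hGc.comp continuous_swap).continuousOn.integrableOn_compact (isCompact_Icc.prod isCompact_Icc)
  have e4 := setIntegral_prod_swap (μ := (volume : Measure ℝ)) (ν := (volume : Measure ℝ)) (Set.Ioc N (2 * N)) (Set.Ioo (-Real.pi) Real.pi) G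
  rw [Measure.volume_eq_prod, ← e4, setIntegral_prod _ hIntg]
  have e5 : ∀ α, ∫ ρ in Set.Ioc N (2 * N), G ((α, ρ) : ℝ × ℝ).swap = J1r μ t N (R * Real.cos (α - β)) := by
    intro α
    rw [J1r, intervalIntegral.integral_of_le (by linarith)]
    rfl
  simp_rw [e5]
  rw [← integral_Ioc_eq_integral_Ioo, ← intervalIntegral.integral_of_le (by linarith),
    intervalIntegral.integral_comp_sub_right (fun α => J1r μ t N (R * Real.cos α))]
  have hper : Function.Periodic (fun α => J1r μ t N (R * Real.cos α)) (2 * Real.pi) := by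
    intro α; simp only [Real.cos_add_two_pi]
  have := hper.intervalIntegral_add_eq (-Real.pi - β) (-Real.pi)
  rw [show -Real.pi - β + 2 * Real.pi = Real.pi - β by ring, show -Real.pi + 2 * Real.pi = Real.pi by ring] at this
  exact this

lemma Ker_neg (μ N t : ℝ) (x : E2) : ‖Ker μ N (-t) x‖ = ‖Ker μ N t (-x)‖ := by
  unfold Ker
  have : ∀ ξ, osc μ (-t) x ξ = (starRingEnd ℂ) (osc μ t (-x) ξ) := by
    intro ξ
    unfold osc
    rw [← Complex.exp_conj]
    congr 1
    simp only [map_mul, Complex.conj_I, Complex.conj_ofReal, inner_neg_left]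
    push_cast; ring
  simp_rw [this]
  rw [integral_conj, RCLike.norm_conj]

lemma Ker_bound {μ N t : ℝ} (hμ : 0 < μ) (hN : 0 < N) (ht : t ≠ 0) (x : E2) :
    ‖Ker μ N t x‖ ≤ 3000 * Real.sqrt (1 + Real.sqrt μ * N) ^ 3 / (Real.sqrt μ * |t|) := by
  have pos : ∀ t, 0 < t → ∀ x : E2, ‖Ker μ N t x‖ ≤ 3000 * Real.sqrt (1 + Real.sqrt μ * N) ^ 3 / (Real.sqrt μ * |t|) := by
    intro t ht x
    obtain ⟨R, hR, h⟩ := Ker_polar μ N t hN x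
    rw [h, abs_of_pos ht]
    exact J_angular hμ ht hN hR
  rcases lt_or_gt_of_ne ht with h | h
  · have := pos (-t) (by linarith) (-x)
    rw [Ker_neg, neg_neg, abs_neg] at this
    exact this
  · exact pos t h x

lemma Ker_triv {μ N t : ℝ} (hN : 0 < N) (x : E2) :
    ‖Ker μ N t x‖ ≤ 20 * N ^ 2 := by
  obtain ⟨R, hR, h⟩ := Ker_polar μ N t hN x
  have hpi := Real.pi_pos
  have hpi4 := Real.pi_lt_d2
  rw [h]
  have hb : ∀ c, ‖J1r μ t N c‖ ≤ 3 * N * N := by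
    intro c
    apply amp_le hN
    · exact ((rph_cont μ t).comp (by fun_prop : Continuous fun ρ : ℝ => (c, ρ))).continuousOn
    · intro y hy
      exact (norm_osc_le hy.1).trans (by linarith [hy.2])
  have := intervalIntegral.norm_integral_le_of_norm_le_const (a := -Real.pi) (b := Real.pi)
      (C := 3 * N * N) (f := fun α => J1r μ t N (R * Real.cos α)) (fun α _ => hb _)
  refine this.trans ?_
  rw [show Real.pi - -Real.pi = 2 * Real.pi by ring, abs_of_pos (by positivity)]
  nlinarith [sq_nonneg N]

lemma TTstar {S X : Type*} [MeasurableSpace S] [MeasurableSpace X] {lam : Measure S} {ν : Measure X}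
    [IsFiniteMeasure lam] [IsFiniteMeasure ν] {e : S → X → ℂ} (hem : Measurable (Function.uncurry e))
    (he : ∀ t ξ, ‖e t ξ‖ ≤ 1) {g : X → ℂ} (hgm : Measurable g) (hg : Integrable (fun ξ => ‖g ξ‖ ^ 2) ν)
    {A : ℝ} (hA : 0 < A)
    (hk : ∀ᵐ t ∂lam, ∫ t', ‖∫ ξ, e t ξ * (starRingEnd ℂ) (e t' ξ) ∂ν‖ ∂lam ≤ A) :
    ∫ t, ‖∫ ξ, e t ξ * g ξ ∂ν‖ ^ 2 ∂lam ≤ A * ∫ ξ, ‖g ξ‖ ^ 2 ∂ν := by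
  classical
  have conjm : Measurable (starRingEnd ℂ) := Complex.continuous_conj.measurable
  have hg1 : Integrable g ν := by
    refine Integrable.mono' (hg.add (integrable_const (1:ℝ))) hgm.aestronglyMeasurable
      (Filter.Eventually.of_forall fun ξ => ?_)
    simp only [Pi.add_apply]
    nlinarith [sq_nonneg (‖g ξ‖ - 1), norm_nonneg (g ξ)]
  have het : ∀ t, Measurable (e t) := fun t => hem.comp measurable_prodMk_left
  have heξ : ∀ ξ, Measurable (fun t => e t ξ) := fun ξ => hem.comp measurable_prodMk_right
  set U : S → ℂ := fun t => ∫ ξ, e t ξ * g ξ ∂ν with hU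
  have hUm : Measurable U := by
    have : StronglyMeasurable (Function.uncurry fun t ξ => e t ξ * g ξ) :=
      (hem.mul (hgm.comp measurable_snd)).stronglyMeasurable
    exact this.integral_prod_right.measurable
  set M := ∫ ξ, ‖g ξ‖ ∂ν with hM
  have hM0 : 0 ≤ M := integral_nonneg fun _ => norm_nonneg _
  have hUb : ∀ t, ‖U t‖ ≤ M := by
    intro t
    refine (norm_integral_le_integral_norm _).trans ?_
    refine integral_mono_of_nonneg (Filter.Eventually.of_forall fun _ => norm_nonneg _) hg1.norm
      (Filter.Eventually.of_forall fun ξ => ?_)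
    simp only [norm_mul]
    exact mul_le_of_le_one_left (norm_nonneg _) (he t ξ)
  set k : S → S → ℂ := fun t t' => ∫ ξ, e t ξ * (starRingEnd ℂ) (e t' ξ) ∂ν with hkd
  have hkm : Measurable (Function.uncurry k) := by
    have : StronglyMeasurable (Function.uncurry fun (p : S × S) ξ => e p.1 ξ * (starRingEnd ℂ) (e p.2 ξ)) := by
      apply Measurable.stronglyMeasurable
      apply Measurable.mul
      · exact hem.comp ((measurable_fst.comp measurable_fst).prodMk measurable_snd)
      · exact conjm.comp (hem.comp ((measurable_snd.comp measurable_fst).prodMk measurable_snd))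
    exact this.integral_prod_right.measurable
  have hkb : ∀ t t', ‖k t t'‖ ≤ ν.real Set.univ := by
    intro t t'
    have := norm_integral_le_of_norm_le_const (μ := ν) (C := 1) (f := fun ξ => e t ξ * (starRingEnd ℂ) (e t' ξ))
      (Filter.Eventually.of_forall fun ξ => by
        rw [norm_mul, RCLike.norm_conj]
        exact mul_le_one₀ (he _ _) (norm_nonneg _) (he _ _))
    simpa using this
  have hksymm : ∀ t t', ‖k t t'‖ = ‖k t' t‖ := by
    intro t t'
    have : k t' t = (starRingEnd ℂ) (k t t') := by
      simp only [hkd]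
      rw [← integral_conj]
      congr 1; ext ξ; simp [mul_comm]
    rw [this, RCLike.norm_conj]
  set H : X → ℂ := fun ξ => ∫ t, (starRingEnd ℂ) (U t) * e t ξ ∂lam with hH
  have hHm : Measurable H := by
    have : StronglyMeasurable (Function.uncurry fun t ξ => (starRingEnd ℂ) (U t) * e t ξ) :=
      ((conjm.comp (hUm.comp measurable_fst)).mul hem).stronglyMeasurable
    exact this.integral_prod_left'.measurable
  have hUeb : ∀ t ξ, ‖(starRingEnd ℂ) (U t) * e t ξ‖ ≤ M := by
    intro t ξ
    rw [norm_mul, RCLike.norm_conj]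
    calc _ ≤ M * 1 := mul_le_mul (hUb t) (he t ξ) (norm_nonneg _) hM0
      _ = M := mul_one _
  have hHb : ∀ ξ, ‖H ξ‖ ≤ M * lam.real Set.univ := fun ξ =>
    norm_integral_le_of_norm_le_const (Filter.Eventually.of_forall fun t => hUeb t ξ)
  -- integrability
  have iU2 : Integrable (fun t => ‖U t‖ ^ 2) lam :=
    Integrable.of_bound (hUm.norm.pow_const 2).aestronglyMeasurable (M ^ 2)
      (Filter.Eventually.of_forall fun t => by
        rw [norm_pow, norm_norm]; exact pow_le_pow_left₀ (norm_nonneg _) (hUb t) 2)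
  have iH2 : Integrable (fun ξ => ‖H ξ‖ ^ 2) ν :=
    Integrable.of_bound (hHm.norm.pow_const 2).aestronglyMeasurable ((M * lam.real Set.univ) ^ 2)
      (Filter.Eventually.of_forall fun t => by
        rw [norm_pow, norm_norm]; exact pow_le_pow_left₀ (norm_nonneg _) (hHb t) 2)
  -- step 1
  have s1 : ((∫ t, ‖U t‖ ^ 2 ∂lam : ℝ) : ℂ) = ∫ ξ, g ξ * H ξ ∂ν := by
    rw [← integral_complex_ofReal]
    have e1 : ∀ t, ((‖U t‖ ^ 2 : ℝ) : ℂ) = ∫ ξ, (starRingEnd ℂ) (U t) * e t ξ * g ξ ∂ν := by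
      intro t
      simp_rw [mul_assoc]
      rw [integral_const_mul]
      push_cast
      rw [← Complex.conj_mul']
    simp_rw [e1]
    rw [integral_integral_swap]
    · congr 1; ext ξ
      rw [integral_mul_const, mul_comm]
    · have : Integrable (fun p : S × X => M * ‖g p.2‖) (lam.prod ν) := (hg1.norm.comp_snd lam).const_mul M
      refine this.mono' ?_ (Filter.Eventually.of_forall fun p => ?_)
      · exact (((conjm.comp (hUm.comp measurable_fst)).mul hem).mul (hgm.comp measurable_snd)).aestronglyMeasurable
      · simp only [Function.uncurry]
        rw [norm_mul]
        exact mul_le_mul_of_nonneg_right (hUeb _ _) (norm_nonneg _)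
  -- step 2
  have s2 : ∫ ξ, ‖H ξ‖ ^ 2 ∂ν ≤ A * ∫ t, ‖U t‖ ^ 2 ∂lam := by
    have e1 : ((∫ ξ, ‖H ξ‖ ^ 2 ∂ν : ℝ) : ℂ) =
        ∫ p : S × S, (starRingEnd ℂ) (U p.1) * U p.2 * k p.1 p.2 ∂(lam.prod lam) := by
      rw [← integral_complex_ofReal]
      have e2 : ∀ ξ, ((‖H ξ‖ ^ 2 : ℝ) : ℂ) = ∫ p : S × S, ((starRingEnd ℂ) (U p.1) * e p.1 ξ) *
          (U p.2 * (starRingEnd ℂ) (e p.2 ξ)) ∂(lam.prod lam) := by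
        intro ξ
        rw [integral_prod_mul (fun t => (starRingEnd ℂ) (U t) * e t ξ) (fun t => U t * (starRingEnd ℂ) (e t ξ))]
        push_cast
        rw [← Complex.mul_conj']
        congr 1
        simp only [hH]
        rw [← integral_conj]
        congr 1; ext t; simp
      simp_rw [e2]
      rw [integral_integral_swap]
      · congr 1; ext p
        simp only [hkd]
        rw [← integral_const_mul]
        congr 1; ext ξ; ring
      · refine Integrable.of_bound (C := M * M) ?_ (Filter.Eventually.of_forall fun p => ?_)
        · apply Measurable.aestronglyMeasurable
          apply Measurable.mul
          · apply Measurable.mul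
            · exact conjm.comp (hUm.comp (measurable_fst.comp measurable_snd))
            · exact hem.comp ((measurable_fst.comp measurable_snd).prodMk measurable_fst)
          · apply Measurable.mul
            · exact (hUm.comp (measurable_snd.comp measurable_snd))
            · exact conjm.comp (hem.comp ((measurable_snd.comp measurable_snd).prodMk measurable_fst))
        · simp only [Function.uncurry]
          rw [norm_mul]
          refine mul_le_mul (hUeb _ _) ?_ (norm_nonneg _) hM0
          have := hUeb p.2.2 p.1
          rw [norm_mul, RCLike.norm_conj] at this
          rw [norm_mul, RCLike.norm_conj]; exact this
    have ik : Integrable (fun p : S × S => ‖U p.1‖ ^ 2 * ‖k p.1 p.2‖) (lam.prod lam) := by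
      refine Integrable.of_bound (C := M ^ 2 * ν.real Set.univ) ?_ (Filter.Eventually.of_forall fun p => ?_)
      · exact (((hUm.comp measurable_fst).norm.pow_const 2).mul hkm.norm).aestronglyMeasurable
      · rw [norm_mul, norm_pow, norm_norm, norm_norm]
        exact mul_le_mul (pow_le_pow_left₀ (norm_nonneg _) (hUb _) 2) (hkb _ _) (norm_nonneg _) (by positivity)
    have ik' : Integrable (fun p : S × S => ‖U p.2‖ ^ 2 * ‖k p.1 p.2‖) (lam.prod lam) := by
      have := ik.swap
      refine this.congr (Filter.Eventually.of_forall fun p => ?_)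
      simp only [Function.comp, Prod.fst_swap, Prod.snd_swap, hksymm p.2 p.1]
    have v1 : ∫ p : S × S, ‖U p.1‖ ^ 2 * ‖k p.1 p.2‖ ∂(lam.prod lam) ≤ A * ∫ t, ‖U t‖ ^ 2 ∂lam := by
      rw [integral_prod _ ik, ← integral_const_mul]
      refine integral_mono_ae ik.integral_prod_left (iU2.const_mul A) ?_
      filter_upwards [hk] with t hk
      rw [integral_const_mul, mul_comm]
      exact mul_le_mul_of_nonneg_right hk (by positivity)
    have v2 : ∫ p : S × S, ‖U p.2‖ ^ 2 * ‖k p.1 p.2‖ ∂(lam.prod lam) =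
        ∫ p : S × S, ‖U p.1‖ ^ 2 * ‖k p.1 p.2‖ ∂(lam.prod lam) := by
      rw [← integral_prod_swap]
      congr 1; ext p
      simp only [Prod.fst_swap, Prod.snd_swap, hksymm p.2 p.1]
    have h0 : 0 ≤ ∫ ξ, ‖H ξ‖ ^ 2 ∂ν := integral_nonneg fun _ => by positivity
    have e3 : ∫ ξ, ‖H ξ‖ ^ 2 ∂ν = ‖∫ p : S × S, (starRingEnd ℂ) (U p.1) * U p.2 * k p.1 p.2 ∂(lam.prod lam)‖ := by
      rw [← e1, Complex.norm_real, Real.norm_of_nonneg h0]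
    rw [e3]
    calc _ ≤ ∫ p : S × S, (1/2) * (‖U p.1‖ ^ 2 * ‖k p.1 p.2‖ + ‖U p.2‖ ^ 2 * ‖k p.1 p.2‖) ∂(lam.prod lam) := by
          refine norm_integral_le_of_norm_le ((ik.add ik').const_mul _) (Filter.Eventually.of_forall fun p => ?_)
          rw [norm_mul, norm_mul, RCLike.norm_conj]
          have := mul_nonneg (sq_nonneg (‖U p.1‖ - ‖U p.2‖)) (norm_nonneg (k p.1 p.2))
          nlinarith
      _ = _ := by rw [integral_const_mul, integral_add ik ik', v2]
      _ ≤ _ := by linarith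
  set Y := ∫ t, ‖U t‖ ^ 2 ∂lam with hY
  have hY0 : 0 ≤ Y := integral_nonneg fun _ => by positivity
  have e4 : Y = ‖∫ ξ, g ξ * H ξ ∂ν‖ := by
    rw [← s1, Complex.norm_real, Real.norm_of_nonneg hY0]
  have e5 : Y ≤ (1/2) * (A * ∫ ξ, ‖g ξ‖ ^ 2 ∂ν) + (1/2) * (A⁻¹ * ∫ ξ, ‖H ξ‖ ^ 2 ∂ν) := by
    rw [e4]
    calc _ ≤ ∫ ξ, ((1/2) * (A * ‖g ξ‖ ^ 2) + (1/2) * (A⁻¹ * ‖H ξ‖ ^ 2)) ∂ν := by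
          refine norm_integral_le_of_norm_le (((hg.const_mul _).const_mul _).add ((iH2.const_mul _).const_mul _))
            (Filter.Eventually.of_forall fun ξ => ?_)
          rw [norm_mul]
          have h1 : 0 ≤ (1/2) * A * (‖g ξ‖ - A⁻¹ * ‖H ξ‖) ^ 2 := by positivity
          have h2 : (1/2) * A * (‖g ξ‖ - A⁻¹ * ‖H ξ‖) ^ 2 =
            (1/2) * (A * ‖g ξ‖ ^ 2) + (1/2) * (A⁻¹ * ‖H ξ‖ ^ 2) - ‖g ξ‖ * ‖H ξ‖ := by field_simp; ring
          linarith
      _ = _ := by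
          rw [integral_add ((hg.const_mul _).const_mul _) ((iH2.const_mul _).const_mul _)]
          simp only [integral_const_mul]
  have e6 : A⁻¹ * ∫ ξ, ‖H ξ‖ ^ 2 ∂ν ≤ Y := by
    rw [inv_mul_le_iff₀ hA]; exact s2
  linarith

lemma le_geomm {a X Y γ : ℝ} (ha : 0 ≤ a) (hX : a ≤ X) (hY : a ≤ Y) (h0 : 0 ≤ γ) (h1 : γ ≤ 1) :
    a ≤ X ^ γ * Y ^ (1 - γ) := by
  rcases ha.eq_or_lt with rfl | h
  · positivity
  calc a = a ^ γ * a ^ (1 - γ) := by rw [← Real.rpow_add h]; simp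
    _ ≤ _ := by
      have : 0 ≤ 1 - γ := by linarith
      have := Real.rpow_nonneg (h.le.trans hX) γ
      gcongr

lemma abs_rpow_ii {γ : ℝ} (h0 : 0 < γ) (a b : ℝ) :
    IntervalIntegrable (fun x : ℝ => |x| ^ (γ - 1)) volume a b := by
  have pos : ∀ c, 0 ≤ c → IntervalIntegrable (fun x : ℝ => |x| ^ (γ - 1)) volume 0 c := by
    intro c hc
    refine (intervalIntegral.intervalIntegrable_rpow' (a := 0) (b := c) (r := γ - 1) (by linarith)).congr ?_
    intro x hx
    rw [Set.uIoc_of_le hc] at hx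
    simp only [abs_of_pos hx.1]
  have all : ∀ c, IntervalIntegrable (fun x : ℝ => |x| ^ (γ - 1)) volume 0 c := by
    intro c
    rcases le_total 0 c with h | h
    · exact pos c h
    · have := pos (-c) (by linarith)
      have h2 := (IntervalIntegrable.iff_comp_neg).1 this
      simpa using h2
  exact (all a).symm.trans (all b)

lemma abs_rpow_int {γ δ a b t : ℝ} (h0 : 0 < γ) (hab : b - a ≤ δ) (ht : t ∈ Set.Ioc a b) :
    ∫ t' in Set.Ioc a b, |t - t'| ^ (γ - 1) ≤ 2 * δ ^ γ / γ := by
  have hab' : a ≤ b := ht.1.le.trans ht.2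
  rw [← intervalIntegral.integral_of_le hab',
    intervalIntegral.integral_comp_sub_left (fun x => |x| ^ (γ - 1)),
    ← intervalIntegral.integral_add_adjacent_intervals (abs_rpow_ii h0 _ 0) (abs_rpow_ii h0 _ _)]
  have pos : ∀ c, 0 ≤ c → c ≤ δ → ∫ x in (0:ℝ)..c, |x| ^ (γ - 1) ≤ δ ^ γ / γ := by
    intro c hc hcδ
    have : ∫ x in (0:ℝ)..c, |x| ^ (γ - 1) = ∫ x in (0:ℝ)..c, x ^ (γ - 1) := by
      apply intervalIntegral.integral_congr
      intro x hx
      rw [Set.uIcc_of_le hc] at hx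
      simp only [abs_of_nonneg hx.1]
    rw [this, integral_rpow (Or.inl (by linarith))]
    simp only [sub_add_cancel, Real.zero_rpow h0.ne', sub_zero]
    gcongr
  have p1 := pos (t - a) (by linarith [ht.1]) (by linarith [ht.2])
  have p2 := pos (b - t) (by linarith [ht.2]) (by linarith [ht.1])
  have e : ∫ x in (t - b)..0, |x| ^ (γ - 1) = ∫ x in (0:ℝ)..(b - t), |x| ^ (γ - 1) := by
    have := intervalIntegral.integral_comp_neg (a := 0) (b := b - t) (fun x : ℝ => |x| ^ (γ - 1))
    simp only [abs_neg, neg_zero, neg_sub] at this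
    exact this.symm
  rw [e]
  calc _ ≤ δ ^ γ / γ + δ ^ γ / γ := add_le_add p2 p1
    _ = _ := by ring

lemma Ker_geom {μ N t γ : ℝ} (hμ : 0 < μ) (hμ1 : μ ≤ 1) (hN : 0 < N) (ht : t ≠ 0) (h0 : 0 < γ) (h1 : γ ≤ 1) (x : E2) :
    ‖Ker μ N t x‖ ≤ 3000 * (N ^ 2) ^ γ * Real.sqrt (1 + N) ^ 3 / Real.sqrt μ * Real.sqrt μ ^ γ * |t| ^ (γ - 1) := by
  have hs : 0 < Real.sqrt μ := Real.sqrt_pos.2 hμ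
  have hs1 : Real.sqrt μ ≤ 1 := Real.sqrt_le_one.2 hμ1
  have ht0 : 0 < |t| := abs_pos.2 ht
  have hP1 : 1 ≤ Real.sqrt (1 + N) := Real.one_le_sqrt.2 (by linarith)
  have a1 : ‖Ker μ N t x‖ ≤ 3000 * N ^ 2 := (Ker_triv hN x).trans (by nlinarith [sq_nonneg N])
  have a2 : ‖Ker μ N t x‖ ≤ 3000 * (Real.sqrt (1 + N) ^ 3 * (Real.sqrt μ * |t|)⁻¹) := by
    refine (Ker_bound hμ hN ht x).trans ?_
    rw [mul_div_assoc, div_eq_mul_inv]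
    gcongr
    nlinarith
  refine (le_geomm (norm_nonneg _) a1 a2 h0.le h1).trans ?_
  have h3 : (0:ℝ) < 3000 := by norm_num
  rw [Real.mul_rpow h3.le (by positivity), Real.mul_rpow h3.le (by positivity), Real.mul_rpow (by positivity) (by positivity)]
  have e1 : (3000:ℝ) ^ γ * 3000 ^ (1 - γ) = 3000 := by rw [← Real.rpow_add h3]; simp
  have e2 : (Real.sqrt (1 + N) ^ 3) ^ (1 - γ) ≤ Real.sqrt (1 + N) ^ 3 := by
    calc _ ≤ (Real.sqrt (1 + N) ^ 3) ^ (1:ℝ) := by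
          apply Real.rpow_le_rpow_of_exponent_le (one_le_pow₀ hP1); linarith
      _ = _ := Real.rpow_one _
  have e3 : ((Real.sqrt μ * |t|)⁻¹) ^ (1 - γ) = Real.sqrt μ ^ γ / Real.sqrt μ * |t| ^ (γ - 1) := by
    rw [Real.inv_rpow (by positivity), Real.mul_rpow hs.le ht0.le, mul_inv, ← Real.rpow_neg hs.le, ← Real.rpow_neg ht0.le]
    rw [show -(1 - γ) = γ - 1 by ring, Real.rpow_sub hs, Real.rpow_one]
  rw [e3]
  calc _ = (3000:ℝ) ^ γ * 3000 ^ (1 - γ) * (N ^ 2) ^ γ * (Real.sqrt (1 + N) ^ 3) ^ (1 - γ) * (Real.sqrt μ ^ γ / Real.sqrt μ * |t| ^ (γ - 1)) := by ring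
    _ ≤ 3000 * (N ^ 2) ^ γ * Real.sqrt (1 + N) ^ 3 * (Real.sqrt μ ^ γ / Real.sqrt μ * |t| ^ (γ - 1)) := by
        rw [e1]; gcongr
    _ = _ := by ring

lemma osc_mul_conj (μ t t' : ℝ) (x x' ξ : E2) :
    osc μ t x ξ * (starRingEnd ℂ) (osc μ t' x' ξ) = osc μ (t - t') (x - x') ξ := by
  unfold osc
  rw [← Complex.exp_conj, ← Complex.exp_add]
  congr 1
  simp only [map_mul, Complex.conj_I, Complex.conj_ofReal, inner_sub_left]
  push_cast; ring

lemma Ann_finite (N : ℝ) : volume (Ann N) < ⊤ := by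
  refine lt_of_le_of_lt (measure_mono (t := Metric.closedBall 0 (2 * N)) ?_) measure_closedBall_lt_top
  intro ξ h
  simpa using h.2

lemma osc_meas {α : Type*} [MeasurableSpace α] (μ : ℝ) {f : α → ℝ} {g h : α → E2} (hf : Measurable f)
    (hg : Measurable g) (hh : Measurable h) : Measurable (fun p => osc μ (f p) (g p) (h p)) := by
  unfold osc
  apply Complex.measurable_exp.comp
  apply measurable_const.mul
  apply Complex.measurable_ofReal.comp
  apply measurable_const.mul
  exact (hg.inner hh).sub (hf.mul ((omg_cont μ).measurable.comp hh.norm))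

/-- the Strichartz constant -/
def Astr (μ N γ δ : ℝ) : ℝ :=
  6000 / γ * (N ^ 2) ^ γ * Real.sqrt (1 + N) ^ 3 / Real.sqrt μ * (Real.sqrt μ * δ) ^ γ

lemma lin_str {μ N γ δ a b σ : ℝ} (hμ : 0 < μ) (hμ1 : μ ≤ 1) (hN : 0 < N) (h0 : 0 < γ) (h1 : γ ≤ 1)
    (hσ : |σ| = 1) (hδ : 0 < δ) (hab : b - a ≤ δ) {y : ℝ → E2} (hy : Measurable y) {g : E2 → ℂ}
    (hgm : Measurable g) (hg : IntegrableOn (fun ξ => ‖g ξ‖ ^ 2) (Ann N)) :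
    ∫ t in Set.Ioc a b, ‖∫ ξ in Ann N, osc μ (σ * t) (y t) ξ * g ξ‖ ^ 2 ≤
      Astr μ N γ δ * ∫ ξ in Ann N, ‖g ξ‖ ^ 2 := by
  have hs : 0 < Real.sqrt μ := Real.sqrt_pos.2 hμ
  have : IsFiniteMeasure (volume.restrict (Ann N)) := ⟨by rw [Measure.restrict_apply_univ]; exact Ann_finite N⟩
  have hP1 : 0 < Real.sqrt (1 + N) := Real.sqrt_pos.2 (by linarith)
  apply TTstar (e := fun t ξ => osc μ (σ * t) (y t) ξ)
  · exact osc_meas μ (measurable_const.mul measurable_fst) (hy.comp measurable_fst) measurable_snd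
  · intro t ξ; exact (osc_norm _ _ _ _).le
  · exact hgm
  · exact hg
  · unfold Astr; positivity
  · filter_upwards [ae_restrict_mem measurableSet_Ioc] with t ht
    have hk : ∀ t', ‖∫ ξ in Ann N, osc μ (σ * t) (y t) ξ * (starRingEnd ℂ) (osc μ (σ * t') (y t') ξ)‖ =
        ‖Ker μ N (σ * (t - t')) (y t - y t')‖ := by
      intro t'
      simp_rw [osc_mul_conj]
      rw [Ker, mul_sub]
    simp_rw [hk]
    set c := 3000 * (N ^ 2) ^ γ * Real.sqrt (1 + N) ^ 3 / Real.sqrt μ * Real.sqrt μ ^ γ with hc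
    have hc0 : 0 ≤ c := by positivity
    have hii : IntegrableOn (fun t' => |t - t'| ^ (γ - 1)) (Set.Ioc a b) := by
      have := (abs_rpow_ii h0 (t - a) (t - b)).comp_sub_left t
      simp only [sub_sub_cancel] at this
      rw [intervalIntegrable_iff_integrableOn_Ioc_of_le (ht.1.le.trans ht.2)] at this
      exact this
    have hne : ∀ᵐ t' ∂(volume.restrict (Set.Ioc a b)), t' ≠ t :=
      ae_restrict_of_ae (by simp [ae_iff])
    calc _ ≤ ∫ t' in Set.Ioc a b, c * |t - t'| ^ (γ - 1) := by
          apply integral_mono_of_nonneg (Filter.Eventually.of_forall fun _ => norm_nonneg _) (hii.const_mul c)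
          filter_upwards [hne] with t' ht'
          have hσ0 : σ ≠ 0 := by rintro rfl; simp at hσ
          have := Ker_geom hμ hμ1 hN (t := σ * (t - t')) (mul_ne_zero hσ0 (sub_ne_zero.2 ht'.symm)) h0 h1 (y t - y t')
          rwa [abs_mul, hσ, one_mul] at this
      _ ≤ c * (2 * δ ^ γ / γ) := by
          rw [integral_const_mul]
          exact mul_le_mul_of_nonneg_left (abs_rpow_int h0 hab ht) hc0
      _ = _ := by
          rw [hc, Astr, Real.mul_rpow hs.le hδ.le]; ring

/-- time phase -/
def phs (μ σ t : ℝ) (ξ : E2) : ℂ :=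
  Complex.exp (Complex.I * ((2 * Real.pi * (σ * t * omg μ ‖ξ‖) : ℝ) : ℂ))

lemma phs_norm (μ σ t : ℝ) (ξ : E2) : ‖phs μ σ t ξ‖ = 1 := by
  unfold phs; rw [mul_comm, Complex.norm_exp_ofReal_mul_I]

lemma phs_cont (μ σ : ℝ) : Continuous (fun p : ℝ × E2 => phs μ σ p.1 p.2) := by
  unfold phs
  have := omg_cont μ
  fun_prop

lemma phs_meas (μ σ : ℝ) : Measurable (fun p : ℝ × E2 => phs μ σ p.1 p.2) := (phs_cont μ σ).measurable

lemma osc_phs (μ σ t : ℝ) (x ξ : E2) : osc μ (σ * t) x ξ * phs μ σ t ξ = osc μ 0 x ξ := by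
  unfold osc phs
  rw [← Complex.exp_add]
  congr 1
  push_cast; ring

lemma cs_finite {S : Type*} [MeasurableSpace S] {lam : Measure S} [IsFiniteMeasure lam] {f : S → ℂ} {δ : ℝ}
    (hδ : 0 < δ) (hl : lam.real Set.univ ≤ δ)
    (hf : Integrable f lam) (hf2 : Integrable (fun s => ‖f s‖ ^ 2) lam) :
    ‖∫ s, f s ∂lam‖ ^ 2 ≤ δ * ∫ s, ‖f s‖ ^ 2 ∂lam := by
  set X := ∫ s, ‖f s‖ ∂lam with hX
  have hX0 : 0 ≤ X := integral_nonneg fun _ => norm_nonneg _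
  have h1 : ‖∫ s, f s ∂lam‖ ≤ X := norm_integral_le_integral_norm _
  set c := X / δ with hc
  have h2 : 0 ≤ ∫ s, (‖f s‖ ^ 2 - 2 * c * ‖f s‖ + c ^ 2) ∂lam := by
    apply integral_nonneg; intro s
    have := sq_nonneg (‖f s‖ - c)
    simp only [Pi.zero_apply]; nlinarith
  have i1 : Integrable (fun s => ‖f s‖ ^ 2 - 2 * c * ‖f s‖) lam := hf2.sub (hf.norm.const_mul _)
  rw [integral_add i1 (integrable_const _), integral_sub hf2 (hf.norm.const_mul _),
    integral_const_mul, integral_const, smul_eq_mul, ← hX] at h2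
  have h3 : lam.real Set.univ * c ^ 2 ≤ δ * c ^ 2 := by gcongr
  have h4 : X = c * δ := by rw [hc]; field_simp
  have h5 : ‖∫ s, f s ∂lam‖ ^ 2 ≤ X ^ 2 := pow_le_pow_left₀ (norm_nonneg _) h1 2
  rw [h4] at h2 h5
  nlinarith

lemma int_of_bdd {S : Type*} [MeasurableSpace S] {lam : Measure S} {A : Set S} (hA : MeasurableSet A)
    (hfin : lam A < ⊤) {E : Type*} [NormedAddCommGroup E] [MeasurableSpace E] [BorelSpace E] [SecondCountableTopology E]
    {f : S → E} (hf : Measurable f) {C : ℝ} (hC : ∀ s ∈ A, ‖f s‖ ≤ C) : IntegrableOn f A lam := by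
  refine Measure.integrableOn_of_bounded (M := C) hfin.ne hf.aestronglyMeasurable ?_
  filter_upwards [ae_restrict_mem hA] with s hs using hC s hs

set_option maxHeartbeats 1600000 in
lemma duhamel_interval {μ N γ δ a b σ Mb Wb Gb : ℝ} (hμ : 0 < μ) (hμ1 : μ ≤ 1) (hN : 0 < N) (h0 : 0 < γ)
    (h1 : γ ≤ 1) (hσ : |σ| = 1) (hδ : 0 < δ) (hab0 : a ≤ b) (hab : b - a ≤ δ) {y : ℝ → E2} (hy : Measurable y)
    {w G : ℝ → E2 → ℂ} (hw : Measurable (Function.uncurry w)) (hG : Measurable (Function.uncurry G))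
    (hwb : ∀ t ∈ Set.Icc a b, ∀ ξ ∈ Ann N, ‖w t ξ‖ ≤ Mb)
    (hGb : ∀ t ∈ Set.Icc a b, ∀ ξ ∈ Ann N, ‖G t ξ‖ ≤ Mb)
    (heq : ∀ t ∈ Set.Icc a b, ∀ ξ ∈ Ann N, phs μ σ t ξ * w t ξ = phs μ σ a ξ * w a ξ +
      ∫ s in a..t, phs μ σ s ξ * G s ξ)
    (hW : ∫ ξ in Ann N, ‖w a ξ‖ ^ 2 ≤ Wb) (hGG : ∀ s ∈ Set.Icc a b, ∫ ξ in Ann N, ‖G s ξ‖ ^ 2 ≤ Gb) :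
    ∫ t in Set.Ioc a b, ‖∫ ξ in Ann N, osc μ 0 (y t) ξ * w t ξ‖ ^ 2 ≤
      2 * Astr μ N γ δ * (Wb + δ ^ 2 * Gb) := by
  have hs : 0 < Real.sqrt μ := Real.sqrt_pos.2 hμ
  have hP1 : 0 < Real.sqrt (1 + N) := Real.sqrt_pos.2 (by linarith)
  have hA0 : 0 ≤ Astr μ N γ δ := by unfold Astr; positivity
  set A := Astr μ N γ δ with hAd
  have : IsFiniteMeasure (volume.restrict (Ann N)) := ⟨by rw [Measure.restrict_apply_univ]; exact Ann_finite N⟩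
  have hwt : ∀ t, Measurable (w t) := fun t => hw.comp measurable_prodMk_left
  have hGt : ∀ t, Measurable (G t) := fun t => hG.comp measurable_prodMk_left
  have hpt : ∀ t, Measurable (phs μ σ t) := fun t => (phs_meas μ σ).comp measurable_prodMk_left
  -- profile functions
  set ha : E2 → ℂ := fun ξ => phs μ σ a ξ * w a ξ with hha
  set g : ℝ → E2 → ℂ := fun s ξ => phs μ σ s ξ * G s ξ with hg
  have ham : Measurable ha := (hpt a).mul (hwt a)
  have hgm : Measurable (Function.uncurry g) := (phs_meas μ σ).mul hG
  have hgmt : ∀ t, Measurable (g t) := fun t => (hpt t).mul (hGt t)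
  have hgsw : Measurable (fun p : E2 × ℝ => g p.2 p.1) :=
    ((phs_meas μ σ).comp measurable_swap).mul (hG.comp measurable_swap)
  have hgn : ∀ s ξ, ‖g s ξ‖ = ‖G s ξ‖ := by
    intro s ξ; rw [hg]; beta_reduce; rw [norm_mul, phs_norm, one_mul]
  have han : ∀ ξ, ‖ha ξ‖ = ‖w a ξ‖ := by
    intro ξ; rw [hha]; beta_reduce; rw [norm_mul, phs_norm, one_mul]
  have haI : a ∈ Set.Icc a b := ⟨le_rfl, hab0⟩
  have hsub : Set.Ioc a b ⊆ Set.Icc a b := Set.Ioc_subset_Icc_self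
  have iha2 : IntegrableOn (fun ξ => ‖ha ξ‖ ^ 2) (Ann N) :=
    int_of_bdd (Ann_meas N) (Ann_finite N) (ham.norm.pow_const 2) (C := Mb ^ 2) fun ξ hξ => by
      rw [norm_pow, norm_norm, han]; exact pow_le_pow_left₀ (norm_nonneg _) (hwb a haI ξ hξ) 2
  have ig2 : ∀ s ∈ Set.Icc a b, IntegrableOn (fun ξ => ‖g s ξ‖ ^ 2) (Ann N) := fun s hs' =>
    int_of_bdd (Ann_meas N) (Ann_finite N) ((hgmt s).norm.pow_const 2) (C := Mb ^ 2) fun ξ hξ => by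
      rw [norm_pow, norm_norm, hgn]; exact pow_le_pow_left₀ (norm_nonneg _) (hGb s hs' ξ hξ) 2
  have t1 := lin_str hμ hμ1 hN h0 h1 hσ hδ hab hy ham iha2
  have t2 : ∀ s ∈ Set.Icc a b, ∫ t in Set.Ioc a b, ‖∫ ξ in Ann N, osc μ (σ * t) (y t) ξ * g s ξ‖ ^ 2 ≤ A * Gb := by
    intro s hs'
    refine (lin_str hμ hμ1 hN h0 h1 hσ hδ hab hy (hgmt s) (ig2 s hs')).trans ?_
    simp_rw [hgn]
    exact mul_le_mul_of_nonneg_left (hGG s hs') hA0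
  have t1' : ∫ t in Set.Ioc a b, ‖∫ ξ in Ann N, osc μ (σ * t) (y t) ξ * ha ξ‖ ^ 2 ≤ A * Wb := by
    refine t1.trans ?_
    simp_rw [han]
    exact mul_le_mul_of_nonneg_left hW hA0
  set U : ℝ → ℂ := fun t => ∫ ξ in Ann N, osc μ (σ * t) (y t) ξ * ha ξ with hU
  set V : ℝ → ℝ → ℂ := fun t s => ∫ ξ in Ann N, osc μ (σ * t) (y t) ξ * g s ξ with hV
  have hUm : Measurable U := by
    have : StronglyMeasurable (Function.uncurry fun t ξ => osc μ (σ * t) (y t) ξ * ha ξ) :=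
      ((osc_meas μ (measurable_const.mul measurable_fst) (hy.comp measurable_fst) measurable_snd).mul
        (ham.comp measurable_snd)).stronglyMeasurable
    exact this.integral_prod_right.measurable
  have hVm : Measurable (Function.uncurry V) := by
    have : StronglyMeasurable (Function.uncurry fun (p : ℝ × ℝ) ξ => osc μ (σ * p.1) (y p.1) ξ * g p.2 ξ) :=
      ((osc_meas μ (measurable_const.mul (measurable_fst.comp measurable_fst))
        (hy.comp (measurable_fst.comp measurable_fst)) measurable_snd).mul
        (hgm.comp ((measurable_snd.comp measurable_fst).prodMk measurable_snd))).stronglyMeasurable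
    exact this.integral_prod_right.measurable
  set L := Mb * (volume.restrict (Ann N)).real Set.univ with hL
  have hUb : ∀ t, ‖U t‖ ≤ L := fun t => by
    refine norm_integral_le_of_norm_le_const ?_
    filter_upwards [ae_restrict_mem (Ann_meas N)] with ξ hξ
    rw [norm_mul, osc_norm, one_mul, han]; exact hwb a haI ξ hξ
  have hVb : ∀ t, ∀ s ∈ Set.Icc a b, ‖V t s‖ ≤ L := fun t s hs' => by
    refine norm_integral_le_of_norm_le_const ?_
    filter_upwards [ae_restrict_mem (Ann_meas N)] with ξ hξ
    rw [norm_mul, osc_norm, one_mul, hgn]; exact hGb s hs' ξ hξ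
  have hVmt : ∀ t, Measurable (V t) := fun t => hVm.of_uncurry_left
  have hfinI : volume (Set.Ioc a b) < ⊤ := measure_Ioc_lt_top
  have iV2 : ∀ t, IntegrableOn (fun s => ‖V t s‖ ^ 2) (Set.Ioc a b) := fun t =>
    int_of_bdd measurableSet_Ioc hfinI ((hVmt t).norm.pow_const 2) (C := L ^ 2) fun s hs' => by
      rw [norm_pow, norm_norm]; exact pow_le_pow_left₀ (norm_nonneg _) (hVb t s (hsub hs')) 2
  have iV : ∀ t, IntegrableOn (V t) (Set.Ioc a b) := fun t =>
    int_of_bdd measurableSet_Ioc hfinI (hVmt t) (C := L) fun s hs' => hVb t s (hsub hs')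
  have iU2 : IntegrableOn (fun t => ‖U t‖ ^ 2) (Set.Ioc a b) :=
    int_of_bdd measurableSet_Ioc hfinI (hUm.norm.pow_const 2) (C := L ^ 2) fun s hs' => by
      rw [norm_pow, norm_norm]; exact pow_le_pow_left₀ (norm_nonneg _) (hUb s) 2
  have iVV : Integrable (fun p : ℝ × ℝ => ‖V p.1 p.2‖ ^ 2)
      ((volume.restrict (Set.Ioc a b)).prod (volume.restrict (Set.Ioc a b))) := by
    rw [Measure.prod_restrict]
    refine int_of_bdd (measurableSet_Ioc.prod measurableSet_Ioc) ?_ (hVm.norm.pow_const 2) (C := L ^ 2) fun s hs' => ?_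
    · rw [Measure.prod_prod]; exact ENNReal.mul_lt_top hfinI hfinI
    · rw [norm_pow, norm_norm]; exact pow_le_pow_left₀ (norm_nonneg _) (hVb _ _ (hsub hs'.2)) 2
  -- representation
  have hrep : ∀ t ∈ Set.Ioc a b, ‖∫ ξ in Ann N, osc μ 0 (y t) ξ * w t ξ‖ ^ 2 ≤
      2 * ‖U t‖ ^ 2 + 2 * (δ * ∫ s in Set.Ioc a b, ‖V t s‖ ^ 2) := by
    intro t ht
    have htI := hsub ht
    have hsubt : Set.Ioc a t ⊆ Set.Ioc a b := Set.Ioc_subset_Ioc_right ht.2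
    have r1 : ∫ ξ in Ann N, osc μ 0 (y t) ξ * w t ξ = U t + ∫ s in Set.Ioc a t, V t s := by
      have e1 : ∫ ξ in Ann N, osc μ 0 (y t) ξ * w t ξ = ∫ ξ in Ann N, (osc μ (σ * t) (y t) ξ * ha ξ +
          ∫ s in Set.Ioc a t, osc μ (σ * t) (y t) ξ * g s ξ) := by
        apply setIntegral_congr_fun (Ann_meas N)
        intro ξ hξ
        simp only
        rw [← osc_phs μ σ t, mul_assoc, heq t htI ξ hξ, mul_add, integral_const_mul,
          intervalIntegral.integral_of_le ht.1.le]
      have iosc : ∀ t, Measurable (osc μ (σ * t) (y t)) := fun t =>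
        osc_meas μ measurable_const measurable_const measurable_id
      have hfint : volume (Set.Ioc a t) < ⊤ := measure_Ioc_lt_top
      have ip : Integrable (Function.uncurry fun ξ s => osc μ (σ * t) (y t) ξ * g s ξ)
          ((volume.restrict (Ann N)).prod (volume.restrict (Set.Ioc a t))) := by
        rw [Measure.prod_restrict]
        refine int_of_bdd ((Ann_meas N).prod measurableSet_Ioc) ?_ ?_ (C := Mb) ?_
        · rw [Measure.prod_prod]; exact ENNReal.mul_lt_top (Ann_finite N) hfint
        · exact ((iosc t).comp measurable_fst).mul hgsw
        · rintro ⟨ξ, s⟩ ⟨hξ, hs'⟩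
          simp only [Function.uncurry]
          rw [norm_mul, osc_norm, one_mul, hgn]
          exact hGb s (hsub (hsubt hs')) ξ hξ
      rw [e1, integral_add, integral_integral_swap ip]
      · refine int_of_bdd (Ann_meas N) (Ann_finite N) ((iosc t).mul ham) (C := Mb) fun ξ hξ => ?_
        rw [norm_mul, osc_norm, one_mul, han]; exact hwb a haI ξ hξ
      · exact ip.integral_prod_left
    rw [r1]
    have c1 : ‖∫ s in Set.Ioc a t, V t s‖ ^ 2 ≤ δ * ∫ s in Set.Ioc a t, ‖V t s‖ ^ 2 := by
      refine cs_finite hδ ?_ ((iV t).mono_set hsubt) ((iV2 t).mono_set hsubt)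
      have : (volume.restrict (Set.Ioc a t)).real Set.univ = t - a := by
        simp [Measure.real, ht.1.le]
      rw [this]; linarith [ht.2]
    have c2 : ∫ s in Set.Ioc a t, ‖V t s‖ ^ 2 ≤ ∫ s in Set.Ioc a b, ‖V t s‖ ^ 2 :=
      setIntegral_mono_set (iV2 t) (Filter.Eventually.of_forall fun _ => by positivity) hsubt.eventuallyLE
    have c3 := norm_add_le (U t) (∫ s in Set.Ioc a t, V t s)
    have c4 : ‖U t + ∫ s in Set.Ioc a t, V t s‖ ^ 2 ≤ 2 * ‖U t‖ ^ 2 + 2 * ‖∫ s in Set.Ioc a t, V t s‖ ^ 2 := by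
      nlinarith [sq_nonneg (‖U t‖ - ‖∫ s in Set.Ioc a t, V t s‖), norm_nonneg (U t + ∫ s in Set.Ioc a t, V t s),
        norm_nonneg (U t), norm_nonneg (∫ s in Set.Ioc a t, V t s)]
    have c5 : δ * ∫ s in Set.Ioc a t, ‖V t s‖ ^ 2 ≤ δ * ∫ s in Set.Ioc a b, ‖V t s‖ ^ 2 := by gcongr
    linarith
  have iin : Integrable (fun t => ∫ s in Set.Ioc a b, ‖V t s‖ ^ 2) (volume.restrict (Set.Ioc a b)) :=
    iVV.integral_prod_left
  have fin1 : ∫ t in Set.Ioc a b, ∫ s in Set.Ioc a b, ‖V t s‖ ^ 2 ≤ δ * (A * Gb) := by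
    rw [integral_integral_swap iVV]
    have hGb0 : 0 ≤ A * Gb := mul_nonneg hA0 (le_trans (integral_nonneg fun _ => by positivity) (hGG a haI))
    calc _ ≤ ∫ s in Set.Ioc a b, A * Gb := by
          refine setIntegral_mono_on iVV.integral_prod_right (by exact integrable_const _) measurableSet_Ioc ?_
          intro s hs'
          exact t2 s (hsub hs')
      _ = (b - a) * (A * Gb) := by
          rw [setIntegral_const, smul_eq_mul]; simp [Measure.real, hab0]
      _ ≤ _ := by gcongr
  calc _ ≤ ∫ t in Set.Ioc a b, (2 * ‖U t‖ ^ 2 + 2 * (δ * ∫ s in Set.Ioc a b, ‖V t s‖ ^ 2)) := by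
        apply integral_mono_of_nonneg (Filter.Eventually.of_forall fun _ => by positivity)
        · exact (iU2.const_mul 2).add ((iin.const_mul δ).const_mul 2)
        · filter_upwards [ae_restrict_mem measurableSet_Ioc] with t ht using hrep t ht
    _ = 2 * (∫ t in Set.Ioc a b, ‖U t‖ ^ 2) + 2 * (δ * ∫ t in Set.Ioc a b, ∫ s in Set.Ioc a b, ‖V t s‖ ^ 2) := by
        rw [integral_add (iU2.const_mul 2) ((iin.const_mul δ).const_mul 2)]
        simp only [integral_const_mul]
    _ ≤ 2 * (A * Wb) + 2 * (δ * (δ * (A * Gb))) := by gcongr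
    _ = _ := by ring

lemma ZN_meas {μ N : ℝ} {y : ℝ → E2} (hy : Measurable y) {w : ℝ → E2 → ℂ} (hw : Measurable (Function.uncurry w)) :
    Measurable (fun t => ∫ ξ in Ann N, osc μ 0 (y t) ξ * w t ξ) := by
  have : StronglyMeasurable (Function.uncurry fun t ξ => osc μ 0 (y t) ξ * w t ξ) :=
      ((osc_meas μ measurable_const (hy.comp measurable_fst) measurable_snd).mul hw).stronglyMeasurable
  exact this.integral_prod_right.measurable

lemma ZN_bdd {μ N Mb : ℝ} {x : E2} {w : E2 → ℂ} (hwb : ∀ ξ ∈ Ann N, ‖w ξ‖ ≤ Mb) :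
    ‖∫ ξ in Ann N, osc μ 0 x ξ * w ξ‖ ≤ Mb * (volume.restrict (Ann N)).real Set.univ := by
  have : IsFiniteMeasure (volume.restrict (Ann N)) := ⟨by rw [Measure.restrict_apply_univ]; exact Ann_finite N⟩
  refine norm_integral_le_of_norm_le_const ?_
  filter_upwards [ae_restrict_mem (Ann_meas N)] with ξ hξ
  rw [norm_mul, osc_norm, one_mul]; exact hwb ξ hξ

lemma ZN_int {μ N Mb T : ℝ} {y : ℝ → E2} (hy : Measurable y) {w : ℝ → E2 → ℂ} (hw : Measurable (Function.uncurry w))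
    (hwb : ∀ t ∈ Set.Icc 0 T, ∀ ξ ∈ Ann N, ‖w t ξ‖ ≤ Mb) :
    IntegrableOn (fun t => ‖∫ ξ in Ann N, osc μ 0 (y t) ξ * w t ξ‖ ^ 2) (Set.Ioc 0 T) := by
  refine int_of_bdd measurableSet_Ioc measure_Ioc_lt_top ((ZN_meas hy hw).norm.pow_const 2)
    (C := (Mb * (volume.restrict (Ann N)).real Set.univ) ^ 2) fun t ht => ?_
  rw [norm_pow, norm_norm]
  exact pow_le_pow_left₀ (norm_nonneg _) (ZN_bdd (hwb t (Set.Ioc_subset_Icc_self ht))) 2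

lemma duhamel_total {μ N γ T σ Mb Wb Gb : ℝ} (hμ : 0 < μ) (hμ1 : μ ≤ 1) (hN : 0 < N) (h0 : 0 < γ)
    (h1 : γ ≤ 1) (hσ : |σ| = 1) (hT : 0 < T) {y : ℝ → E2} (hy : Measurable y)
    {w G : ℝ → E2 → ℂ} (hw : Measurable (Function.uncurry w)) (hG : Measurable (Function.uncurry G))
    (hwb : ∀ t ∈ Set.Icc 0 T, ∀ ξ ∈ Ann N, ‖w t ξ‖ ≤ Mb)
    (hGb : ∀ t ∈ Set.Icc 0 T, ∀ ξ ∈ Ann N, ‖G t ξ‖ ≤ Mb)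
    (heq : ∀ a ∈ Set.Icc 0 T, ∀ t ∈ Set.Icc 0 T, ∀ ξ ∈ Ann N, phs μ σ t ξ * w t ξ = phs μ σ a ξ * w a ξ +
      ∫ s in a..t, phs μ σ s ξ * G s ξ)
    (hW : ∀ t ∈ Set.Icc 0 T, ∫ ξ in Ann N, ‖w t ξ‖ ^ 2 ≤ Wb)
    (hGG : ∀ s ∈ Set.Icc 0 T, ∫ ξ in Ann N, ‖G s ξ‖ ^ 2 ≤ Gb) {M : ℕ} (hM : 0 < M) :
    ∫ t in Set.Ioc 0 T, ‖∫ ξ in Ann N, osc μ 0 (y t) ξ * w t ξ‖ ^ 2 ≤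
      M * (2 * Astr μ N γ (T / M) * (Wb + (T / M) ^ 2 * Gb)) := by
  have hMr : (0:ℝ) < M := by exact_mod_cast hM
  set p : ℕ → ℝ := fun k => k * (T / M) with hp
  have hp0 : p 0 = 0 := by simp [hp]
  have hpM : p M = T := by simp only [hp]; field_simp
  have hstep : ∀ k, p (k + 1) - p k = T / M := by intro k; simp only [hp]; push_cast; ring
  have hδ : 0 < T / M := by positivity
  have hmono : ∀ k, p k ≤ p (k + 1) := fun k => by linarith [hstep k]
  have hpmono : Monotone p := monotone_nat_of_le_succ hmono
  have hin : ∀ k ≤ M, p k ∈ Set.Icc 0 T := fun k hk =>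
    ⟨hp0 ▸ hpmono (Nat.zero_le k), hpM ▸ hpmono hk⟩
  have hsub : ∀ k < M, Set.Icc (p k) (p (k + 1)) ⊆ Set.Icc 0 T := fun k hk =>
    Set.Icc_subset_Icc (hin k hk.le).1 (hin (k + 1) hk).2
  have hIntg := ZN_int (μ := μ) hy hw hwb
  have hsum := intervalIntegral.sum_integral_adjacent_intervals (a := p) (n := M) (μ := volume)
    (f := fun t => ‖∫ ξ in Ann N, osc μ 0 (y t) ξ * w t ξ‖ ^ 2) (fun k hk => by
      rw [intervalIntegrable_iff_integrableOn_Ioc_of_le (hmono k)]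
      refine hIntg.mono_set (Set.Ioc_subset_Ioc (hin k hk.le).1 (hin (k + 1) hk).2))
  rw [hp0, hpM, intervalIntegral.integral_of_le hT.le] at hsum
  rw [← hsum]
  calc _ ≤ ∑ k ∈ Finset.range M, 2 * Astr μ N γ (T / M) * (Wb + (T / M) ^ 2 * Gb) := by
        apply Finset.sum_le_sum
        intro k hk
        rw [Finset.mem_range] at hk
        rw [intervalIntegral.integral_of_le (hmono k)]
        exact duhamel_interval hμ hμ1 hN h0 h1 hσ hδ (hmono k) (hstep k).le hy hw hG
          (fun t ht => hwb t (hsub k hk ht)) (fun t ht => hGb t (hsub k hk ht))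
          (fun t ht => heq _ (hin k hk.le) t (hsub k hk ht)) (hW _ (hin k hk.le)) (fun t ht => hGG t (hsub k hk ht))
    _ = _ := by rw [Finset.sum_const, Finset.card_range, nsmul_eq_mul]

lemma Ann_vol {N : ℝ} (hN : 0 < N) : (volume.restrict (Ann N)).real Set.univ ≤ 20 * N ^ 2 := by
  have := Ker_triv (μ := 1) (t := 0) hN (0 : E2)
  have e : Ker 1 N 0 0 = (((volume.restrict (Ann N)).real Set.univ : ℝ) : ℂ) := by
    simp [Ker, osc]
  rw [e, Complex.norm_real] at this
  exact (le_abs_self _).trans this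

lemma ZN_triv {μ N T Mb Wb : ℝ} (hN : 0 < N) (hT : 0 < T) {y : ℝ → E2} 
    {w : ℝ → E2 → ℂ} (hw : Measurable (Function.uncurry w)) 
    (hwb : ∀ t ∈ Set.Icc 0 T, ∀ ξ ∈ Ann N, ‖w t ξ‖ ≤ Mb)
    (hW : ∀ t ∈ Set.Icc 0 T, ∫ ξ in Ann N, ‖w t ξ‖ ^ 2 ≤ Wb) :
    ∫ t in Set.Ioc 0 T, ‖∫ ξ in Ann N, osc μ 0 (y t) ξ * w t ξ‖ ^ 2 ≤ T * (20 * N ^ 2 * Wb) := by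
  have : IsFiniteMeasure (volume.restrict (Ann N)) := ⟨by rw [Measure.restrict_apply_univ]; exact Ann_finite N⟩
  have hb : ∀ t ∈ Set.Ioc 0 T, ‖∫ ξ in Ann N, osc μ 0 (y t) ξ * w t ξ‖ ^ 2 ≤ 20 * N ^ 2 * Wb := by
    intro t ht
    have ht' := Set.Ioc_subset_Icc_self ht
    have hwt : Measurable (w t) := hw.of_uncurry_left
    have ho : Measurable (osc μ 0 (y t)) := osc_meas μ measurable_const measurable_const measurable_id
    have h2 := cs_finite (lam := volume.restrict (Ann N)) (f := fun ξ => osc μ 0 (y t) ξ * w t ξ)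
      (δ := 20 * N ^ 2) (by positivity) (Ann_vol hN)
      (int_of_bdd (Ann_meas N) (Ann_finite N) (ho.mul hwt) (C := Mb) fun ξ hξ => by
        rw [norm_mul, osc_norm, one_mul]; exact hwb t ht' ξ hξ)
      (int_of_bdd (Ann_meas N) (Ann_finite N) ((ho.mul hwt).norm.pow_const 2) (C := Mb ^ 2) fun ξ hξ => by
        rw [norm_pow, norm_norm, norm_mul, osc_norm, one_mul]
        exact pow_le_pow_left₀ (norm_nonneg _) (hwb t ht' ξ hξ) 2)
    refine h2.trans ?_
    simp_rw [norm_mul, osc_norm, one_mul]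
    exact mul_le_mul_of_nonneg_left (hW t ht') (by positivity)
  calc _ ≤ ∫ t in Set.Ioc 0 T, 20 * N ^ 2 * Wb := by
        apply integral_mono_of_nonneg (Filter.Eventually.of_forall fun _ => by positivity) (by exact integrable_const _)
        filter_upwards [ae_restrict_mem measurableSet_Ioc] with t ht using hb t ht
    _ = _ := by rw [setIntegral_const, smul_eq_mul]; simp [Measure.real, hT.le]

/-- dyadic weight -/
def cwt (r γ N : ℝ) : ℝ := N ^ 2 * (N ^ 2) ^ γ * (1 + N) ^ ((5:ℝ) / 2) * (1 + N ^ 2) ^ (-r)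

/-- right-hand side quantity -/
def Xrhs (μ θ T S B : ℝ) : ℝ :=
  T * (T * Real.sqrt μ) ^ (-(2:ℝ) / 3 + 5 * θ / 9) * S ^ 2 +
    T ^ 3 * (T * Real.sqrt μ) ^ (-(4:ℝ) / 3 + 4 * θ / 9) * B ^ 2

lemma dyadic_bound {μ N γ θ T σ Mb S B r : ℝ} (hμ : 0 < μ) (hμ1 : μ ≤ 1) (hN : 0 < N) (h0 : 0 < γ)
    (h1 : γ ≤ 1) (hγθ : γ ≤ 4 * θ / 9) (hθ0 : 0 < θ) (hθ : θ < 1)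
    (hσ : |σ| = 1) (hT : 0 < T) {y : ℝ → E2} (hy : Measurable y)
    {w G : ℝ → E2 → ℂ} (hw : Measurable (Function.uncurry w)) (hG : Measurable (Function.uncurry G))
    (hwb : ∀ t ∈ Set.Icc 0 T, ∀ ξ ∈ Ann N, ‖w t ξ‖ ≤ Mb)
    (hGb : ∀ t ∈ Set.Icc 0 T, ∀ ξ ∈ Ann N, ‖G t ξ‖ ≤ Mb)
    (heq : ∀ a ∈ Set.Icc 0 T, ∀ t ∈ Set.Icc 0 T, ∀ ξ ∈ Ann N, phs μ σ t ξ * w t ξ = phs μ σ a ξ * w a ξ +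
      ∫ s in a..t, phs μ σ s ξ * G s ξ)
    (hW : ∀ t ∈ Set.Icc 0 T, ∫ ξ in Ann N, ‖w t ξ‖ ^ 2 ≤ N ^ 2 * (1 + N ^ 2) ^ (-r) * S ^ 2)
    (hGG : ∀ s ∈ Set.Icc 0 T, ∫ ξ in Ann N, ‖G s ξ‖ ^ 2 ≤ N ^ 2 * (1 + N ^ 2) ^ (1 - r) * B ^ 2) :
    ∫ t in Set.Ioc 0 T, ‖∫ ξ in Ann N, osc μ 0 (y t) ξ * w t ξ‖ ^ 2 ≤
      24000 / γ * cwt r γ N * Xrhs μ θ T S B := by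
  have hs : 0 < Real.sqrt μ := Real.sqrt_pos.2 hμ
  set s := T * Real.sqrt μ with hsd
  have hs0 : 0 < s := by positivity
  have hN1 : 1 ≤ 1 + N := by linarith
  have hX : Xrhs μ θ T S B = T * s ^ (-(2:ℝ) / 3 + 5 * θ / 9) * S ^ 2 + T ^ 3 * s ^ (-(4:ℝ) / 3 + 4 * θ / 9) * B ^ 2 := rfl
  rcases le_total s 1 with h | h
  · refine (ZN_triv hN hT hw hwb hW).trans ?_
    have k1 : 1 ≤ s ^ (-(2:ℝ) / 3 + 5 * θ / 9) := Real.one_le_rpow_of_pos_of_le_one_of_nonpos hs0 h (by linarith)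
    have k2 : T * S ^ 2 ≤ Xrhs μ θ T S B := by
      rw [hX]
      have : 0 ≤ T ^ 3 * s ^ (-(4:ℝ) / 3 + 4 * θ / 9) * B ^ 2 := by positivity
      have : T * 1 * S ^ 2 ≤ T * s ^ (-(2:ℝ) / 3 + 5 * θ / 9) * S ^ 2 := by gcongr
      linarith
    have k3 : N ^ 2 ≤ (N ^ 2) ^ γ * (1 + N) ^ ((5:ℝ) / 2) := by
      have hN2 : 0 < N ^ 2 := by positivity
      calc N ^ 2 = (N ^ 2) ^ γ * (N ^ 2) ^ (1 - γ) := by rw [← Real.rpow_add hN2]; simp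
        _ ≤ (N ^ 2) ^ γ * ((1 + N) ^ 2) ^ (1 - γ) := by
            have : 0 ≤ 1 - γ := by linarith
            gcongr; linarith
        _ = (N ^ 2) ^ γ * (1 + N) ^ (2 * (1 - γ)) := by
            rw [Real.rpow_mul (by linarith)]; norm_num
        _ ≤ _ := by
            gcongr
            linarith
    have k4 : N ^ 2 * (N ^ 2 * (1 + N ^ 2) ^ (-r)) ≤ cwt r γ N := by
      unfold cwt
      calc _ = N ^ 2 * N ^ 2 * (1 + N ^ 2) ^ (-r) := by ring
        _ ≤ N ^ 2 * ((N ^ 2) ^ γ * (1 + N) ^ ((5:ℝ) / 2)) * (1 + N ^ 2) ^ (-r) := by gcongr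
        _ = _ := by ring
    have k5 : (20:ℝ) ≤ 24000 / γ := by rw [le_div_iff₀ h0]; linarith
    have hc0 : 0 ≤ cwt r γ N := by unfold cwt; positivity
    calc _ = 20 * (N ^ 2 * (N ^ 2 * (1 + N ^ 2) ^ (-r))) * (T * S ^ 2) := by ring
      _ ≤ 24000 / γ * cwt r γ N * Xrhs μ θ T S B := by
          have : 0 ≤ T * S ^ 2 := by positivity
          gcongr
  · set z := s ^ ((1:ℝ) / 3) * (1 + N) with hz
    have hs13 : 1 ≤ s ^ ((1:ℝ) / 3) := Real.one_le_rpow h (by norm_num)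
    have hz1 : 1 ≤ z := by nlinarith
    set M := ⌈z⌉₊ with hMd
    have hzM : z ≤ M := Nat.le_ceil z
    have hM1 : (1:ℝ) ≤ M := hz1.trans hzM
    have hM0 : 0 < M := by exact_mod_cast (by linarith : (0:ℝ) < M)
    have hM2 : (M:ℝ) ≤ 2 * z := by
      have := Nat.ceil_lt_add_one (by linarith : 0 ≤ z)
      linarith
    refine (duhamel_total hμ hμ1 hN h0 h1 hσ hT hy hw hG hwb hGb heq hW hGG hM0).trans ?_
    have a1 : Astr μ N γ (T / M) ≤ 6000 / γ * (N ^ 2) ^ γ * Real.sqrt (1 + N) ^ 3 / Real.sqrt μ * s ^ γ := by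
      unfold Astr
      have : Real.sqrt μ * (T / M) ≤ s := by
        rw [hsd, mul_comm]
        apply mul_le_mul_of_nonneg_right _ hs.le
        exact div_le_self hT.le hM1
      gcongr
    have a2 : (T / M) ^ 2 ≤ T ^ 2 * s ^ (-(2:ℝ) / 3) / (1 + N) ^ 2 := by
      have : T / M ≤ T / z := by gcongr
      calc (T / M) ^ 2 ≤ (T / z) ^ 2 := by gcongr
        _ = T ^ 2 * ((s ^ ((1:ℝ) / 3)) ^ 2)⁻¹ / (1 + N) ^ 2 := by rw [hz]; field_simp
        _ = _ := by
          have e : ((s ^ ((1:ℝ) / 3)) ^ 2)⁻¹ = s ^ (-(2:ℝ) / 3) := by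
            rw [← Real.rpow_natCast (s ^ ((1:ℝ) / 3)) 2, ← Real.rpow_mul hs0.le, ← Real.rpow_neg hs0.le]
            norm_num
          rw [e]
    have a3 : N ^ 2 * (1 + N ^ 2) ^ (-r) * S ^ 2 + (T / M) ^ 2 * (N ^ 2 * (1 + N ^ 2) ^ (1 - r) * B ^ 2) ≤
        N ^ 2 * (1 + N ^ 2) ^ (-r) * (S ^ 2 + T ^ 2 * s ^ (-(2:ℝ) / 3) * B ^ 2) := by
      have e1 : (1 + N ^ 2) ^ (1 - r) = (1 + N ^ 2) * (1 + N ^ 2) ^ (-r) := by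
        rw [sub_eq_add_neg, Real.rpow_add (by positivity), Real.rpow_one]
      rw [e1]
      have e2 : (T / M) ^ 2 * (1 + N ^ 2) ≤ T ^ 2 * s ^ (-(2:ℝ) / 3) := by
        calc _ ≤ T ^ 2 * s ^ (-(2:ℝ) / 3) / (1 + N) ^ 2 * (1 + N ^ 2) := by gcongr
          _ ≤ T ^ 2 * s ^ (-(2:ℝ) / 3) / (1 + N) ^ 2 * (1 + N) ^ 2 := by gcongr; nlinarith
          _ = _ := by field_simp
      calc _ = N ^ 2 * (1 + N ^ 2) ^ (-r) * (S ^ 2 + ((T / M) ^ 2 * (1 + N ^ 2)) * B ^ 2) := by ring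
        _ ≤ _ := by gcongr
    have hP1 : 0 < Real.sqrt (1 + N) := Real.sqrt_pos.2 (by linarith)
    have hA0 : 0 ≤ Astr μ N γ (T / M) := by unfold Astr; positivity
    have a4 : Real.sqrt (1 + N) ^ 3 * (1 + N) = (1 + N) ^ ((5:ℝ) / 2) := by
      rw [Real.sqrt_eq_rpow, ← Real.rpow_natCast, ← Real.rpow_mul (by linarith)]
      nth_rewrite 2 [← Real.rpow_one (1 + N)]
      rw [← Real.rpow_add (by linarith)]; norm_num
    have a5 : s ^ ((1:ℝ) / 3) * s ^ γ / Real.sqrt μ = T * s ^ (-(2:ℝ) / 3 + γ) := by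
      have : s ^ ((1:ℝ) / 3) * s ^ γ = s * s ^ (-(2:ℝ) / 3 + γ) := by
        nth_rewrite 3 [← Real.rpow_one s]
        rw [← Real.rpow_add hs0, ← Real.rpow_add hs0]; congr 1; ring
      rw [this, hsd]; field_simp
    have a6 : T * s ^ (-(2:ℝ) / 3 + γ) * (S ^ 2 + T ^ 2 * s ^ (-(2:ℝ) / 3) * B ^ 2) ≤ Xrhs μ θ T S B := by
      rw [hX]
      have b1 : s ^ (-(2:ℝ) / 3 + γ) ≤ s ^ (-(2:ℝ) / 3 + 5 * θ / 9) :=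
        Real.rpow_le_rpow_of_exponent_le h (by linarith)
      have b2 : s ^ (-(2:ℝ) / 3 + γ) * s ^ (-(2:ℝ) / 3) ≤ s ^ (-(4:ℝ) / 3 + 4 * θ / 9) := by
        rw [← Real.rpow_add hs0]
        exact Real.rpow_le_rpow_of_exponent_le h (by linarith)
      calc _ = T * s ^ (-(2:ℝ) / 3 + γ) * S ^ 2 + T ^ 3 * (s ^ (-(2:ℝ) / 3 + γ) * s ^ (-(2:ℝ) / 3)) * B ^ 2 := by ring
        _ ≤ _ := by gcongr
    calc _ ≤ (2 * z) * (2 * (6000 / γ * (N ^ 2) ^ γ * Real.sqrt (1 + N) ^ 3 / Real.sqrt μ * s ^ γ) *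
          (N ^ 2 * (1 + N ^ 2) ^ (-r) * (S ^ 2 + T ^ 2 * s ^ (-(2:ℝ) / 3) * B ^ 2))) := by gcongr
      _ = 24000 / γ * (N ^ 2 * (N ^ 2) ^ γ * (Real.sqrt (1 + N) ^ 3 * (1 + N)) * (1 + N ^ 2) ^ (-r)) *
          (s ^ ((1:ℝ) / 3) * s ^ γ / Real.sqrt μ * (S ^ 2 + T ^ 2 * s ^ (-(2:ℝ) / 3) * B ^ 2)) := by
          rw [hz]; ring
      _ ≤ _ := by
          rw [a4, a5]
          have hc0 : 0 ≤ cwt r γ N := by unfold cwt; positivity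
          change 24000 / γ * cwt r γ N * _ ≤ _
          gcongr

lemma lcs {α : Type*} [MeasurableSpace α] (m : Measure α) {f g : α → ℝ≥0∞} (hf : AEMeasurable f m)
    (hg : AEMeasurable g m) : (∫⁻ a, f a * g a ∂m) ^ 2 ≤ (∫⁻ a, f a ^ 2 ∂m) * (∫⁻ a, g a ^ 2 ∂m) := by
  have h := ENNReal.lintegral_mul_le_Lp_mul_Lq m (p := 2) (q := 2) ⟨by norm_num, by norm_num, by norm_num⟩ hf hg
  simp only [Pi.mul_apply, ENNReal.rpow_two] at h
  calc _ ≤ ((∫⁻ a, f a ^ 2 ∂m) ^ (1 / (2:ℝ)) * (∫⁻ a, g a ^ 2 ∂m) ^ (1 / (2:ℝ))) ^ 2 := by gcongr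
    _ = _ := by
      rw [mul_pow, ← ENNReal.rpow_natCast, ← ENNReal.rpow_natCast, ← ENNReal.rpow_mul, ← ENNReal.rpow_mul]
      norm_num

lemma tsum_cs (a : ℤ → ℝ≥0∞) (β : ℤ → ℝ) (hβ : ∀ j, 0 < β j) :
    (∑' j, a j) ^ 2 ≤ (∑' j, ENNReal.ofReal (β j)) * ∑' j, ENNReal.ofReal (β j)⁻¹ * a j ^ 2 := by
  have h := lcs (Measure.count : Measure ℤ) (f := fun j => ENNReal.ofReal (Real.sqrt (β j)))
    (g := fun j => ENNReal.ofReal (Real.sqrt (β j))⁻¹ * a j) (measurable_of_countable _).aemeasurable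
    (measurable_of_countable _).aemeasurable
  simp only [lintegral_count] at h
  have e1 : ∀ j, ENNReal.ofReal (Real.sqrt (β j)) * (ENNReal.ofReal (Real.sqrt (β j))⁻¹ * a j) = a j := by
    intro j
    have := Real.sqrt_pos.2 (hβ j)
    rw [← mul_assoc, ← ENNReal.ofReal_mul this.le, mul_inv_cancel₀ this.ne', ENNReal.ofReal_one, one_mul]
  have e2 : ∀ j, ENNReal.ofReal (Real.sqrt (β j)) ^ 2 = ENNReal.ofReal (β j) := by
    intro j
    rw [← ENNReal.ofReal_pow (Real.sqrt_nonneg _), Real.sq_sqrt (hβ j).le]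
  have e3 : ∀ j, (ENNReal.ofReal (Real.sqrt (β j))⁻¹ * a j) ^ 2 = ENNReal.ofReal (β j)⁻¹ * a j ^ 2 := by
    intro j
    rw [mul_pow, ← ENNReal.ofReal_pow (by positivity), inv_pow, Real.sq_sqrt (hβ j).le]
  simpa only [e1, e2, e3] using h

lemma cwt_pos {r γ N : ℝ} (hN : 0 < N) : 0 < cwt r γ N := by unfold cwt; positivity

lemma cwt_summable {r γ : ℝ} (hr : 0 < r) (h0 : 0 < γ) (h : 2 * γ < 2 * r - 9 / 2) :
    Summable (fun j : ℤ => Real.sqrt (cwt r γ ((2:ℝ) ^ j))) := by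
  have p8 : (2:ℝ) ^ ((5:ℝ) / 2) ≤ 9 := by
    calc (2:ℝ) ^ ((5:ℝ) / 2) ≤ (2:ℝ) ^ ((3:ℝ)) := Real.rpow_le_rpow_of_exponent_le (by norm_num) (by norm_num)
      _ ≤ 9 := by norm_num
  have hs9 : Real.sqrt 9 = 3 := by rw [show (9:ℝ) = 3 ^ 2 by norm_num]; exact Real.sqrt_sq (by norm_num)
  apply Summable.of_nat_of_neg
  · set q := (2:ℝ) ^ ((9 / 2 + 2 * γ - 2 * r) / 2) with hq
    have hq1 : q < 1 := Real.rpow_lt_one_of_one_lt_of_neg (by norm_num) (by linarith)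
    have hq0 : 0 < q := by positivity
    refine Summable.of_nonneg_of_le (fun n => Real.sqrt_nonneg _) (fun n => ?_)
      ((summable_geometric_of_lt_one hq0.le hq1).mul_left 3)
    set N : ℝ := (2:ℝ) ^ ((n:ℕ):ℤ) with hN
    have hN0 : 0 < N := by positivity
    have hN1 : 1 ≤ N := by rw [hN, zpow_natCast]; exact one_le_pow₀ (by norm_num)
    have hqn : (q ^ n) ^ 2 = N ^ (9 / 2 + 2 * γ - 2 * r) := by
      rw [hN, zpow_natCast, hq, ← Real.rpow_natCast, ← Real.rpow_natCast, ← Real.rpow_natCast, ← Real.rpow_mul (by positivity),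
        ← Real.rpow_mul (by positivity), ← Real.rpow_mul (by positivity)]
      congr 1; push_cast; ring
    have : cwt r γ N ≤ 9 * (q ^ n) ^ 2 := by
      rw [hqn]; unfold cwt
      have k1 : (1 + N) ^ ((5:ℝ) / 2) ≤ 9 * N ^ ((5:ℝ) / 2) := by
        calc _ ≤ (2 * N) ^ ((5:ℝ) / 2) := by gcongr; linarith
          _ = 2 ^ ((5:ℝ) / 2) * N ^ ((5:ℝ) / 2) := Real.mul_rpow (by norm_num) hN0.le
          _ ≤ _ := by gcongr
      have k2 : (1 + N ^ 2) ^ (-r) ≤ (N ^ 2) ^ (-r) :=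
        Real.rpow_le_rpow_of_nonpos (by positivity) (by linarith) (by linarith)
      calc _ ≤ N ^ 2 * (N ^ 2) ^ γ * (9 * N ^ ((5:ℝ) / 2)) * (N ^ 2) ^ (-r) := by gcongr
        _ = 9 * (N ^ (2:ℝ) * (N ^ (2:ℝ)) ^ γ * N ^ ((5:ℝ) / 2) * (N ^ (2:ℝ)) ^ (-r)) := by norm_num; ring
        _ = _ := by
          rw [← Real.rpow_mul hN0.le, ← Real.rpow_mul hN0.le, ← Real.rpow_add hN0, ← Real.rpow_add hN0,
            ← Real.rpow_add hN0]
          congr 2; ring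
    calc _ ≤ Real.sqrt (9 * (q ^ n) ^ 2) := Real.sqrt_le_sqrt this
      _ = 3 * q ^ n := by rw [Real.sqrt_mul (by norm_num), Real.sqrt_sq (by positivity), hs9]
  · refine Summable.of_nonneg_of_le (fun n => Real.sqrt_nonneg _) (fun n => ?_)
      ((summable_geometric_of_lt_one (r := 1 / 2) (by norm_num) (by norm_num)).mul_left 3)
    set N : ℝ := (2:ℝ) ^ (-(n:ℤ)) with hN
    have hN0 : 0 < N := by positivity
    have hNe : N = (1 / 2) ^ n := by rw [hN, zpow_neg, zpow_natCast]; simp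
    have hN1 : N ≤ 1 := by rw [hNe]; exact pow_le_one₀ (by norm_num) (by norm_num)
    have : cwt r γ N ≤ 9 * N ^ 2 := by
      unfold cwt
      have k1 : (1 + N) ^ ((5:ℝ) / 2) ≤ 9 := by
        calc _ ≤ (2:ℝ) ^ ((5:ℝ) / 2) := by gcongr; linarith
          _ ≤ _ := p8
      have k2 : (1 + N ^ 2) ^ (-r) ≤ 1 :=
        Real.rpow_le_one_of_one_le_of_nonpos (by nlinarith) (by linarith)
      have k3 : (N ^ 2) ^ γ ≤ 1 := Real.rpow_le_one (by positivity) (by nlinarith) h0.le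
      calc _ ≤ N ^ 2 * 1 * 9 * 1 := by gcongr
        _ = _ := by ring
    calc _ ≤ Real.sqrt (9 * N ^ 2) := Real.sqrt_le_sqrt this
      _ = 3 * (1 / 2) ^ n := by rw [Real.sqrt_mul (by norm_num), Real.sqrt_sq (by positivity), hs9, hNe]

lemma Ann_disj : Pairwise (Function.onFun Disjoint (fun j : ℤ => Ann ((2:ℝ) ^ j))) := by
  have key : ∀ i j : ℤ, i < j → Disjoint (Ann ((2:ℝ) ^ i)) (Ann ((2:ℝ) ^ j)) := by
    intro i j hij
    rw [Set.disjoint_left]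
    rintro ξ ⟨_, h2⟩ ⟨h3, _⟩
    have : (2:ℝ) * 2 ^ i ≤ 2 ^ j := by
      rw [← zpow_one_add₀ (by norm_num)]
      exact zpow_le_zpow_right₀ (by norm_num) (by omega)
    linarith
  intro i j hij
  rcases lt_or_gt_of_ne hij with h | h
  · exact key i j h
  · exact (key j i h).symm

lemma Ann_union : (⋃ j : ℤ, Ann ((2:ℝ) ^ j)) = {0}ᶜ := by
  ext ξ
  simp only [Set.mem_iUnion, Set.mem_compl_iff, Set.mem_singleton_iff]
  constructor
  · rintro ⟨j, h, _⟩ rfl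
    rw [norm_zero] at h
    have : (0:ℝ) < 2 ^ j := by positivity
    linarith
  · intro h
    obtain ⟨n, h1, h2⟩ := exists_mem_Ioc_zpow (norm_pos_iff.2 h) (one_lt_two (α := ℝ))
    exact ⟨n, h1, by rwa [zpow_add_one₀ (by norm_num), mul_comm] at h2⟩

lemma dyad_split (f : E2 → ℂ) : ‖∫ ξ, f ξ‖ₑ ≤ ∑' j : ℤ, ‖∫ ξ in Ann ((2:ℝ) ^ j), f ξ‖ₑ := by
  by_cases hf : Integrable f
  · have h := hasSum_integral_iUnion (μ := volume) (f := f) (fun j : ℤ => Ann_meas ((2:ℝ) ^ j)) Ann_disj hf.integrableOn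
    rw [Ann_union, setIntegral_congr_set (t := Set.univ) (by
      rw [MeasureTheory.ae_eq_univ, compl_compl]; exact measure_singleton 0), setIntegral_univ] at h
    rw [← h.tsum_eq]
    exact enorm_tsum_le_tsum_enorm
  · rw [integral_undef hf]; simp

lemma Ann_weight {N r Cm S : ℝ} (hN : 0 < N) (hr : 0 ≤ r) {m u : E2 → ℂ} (hu : Measurable u)
    (hmm : Measurable m) (hm : ∀ ξ, ‖m ξ‖ ≤ Cm * ‖ξ‖)
    (hS : ∫⁻ ξ, ENNReal.ofReal ((1 + ‖ξ‖ ^ 2) ^ r * ‖u ξ‖ ^ 2) ≤ ENNReal.ofReal (S ^ 2)) :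
    ∫ ξ in Ann N, ‖m ξ * u ξ‖ ^ 2 ≤ N ^ 2 * (1 + N ^ 2) ^ (-r) * (2 * Cm * S) ^ 2 := by
  rw [integral_eq_lintegral_of_nonneg_ae (Filter.Eventually.of_forall fun _ => by positivity)
    (((hmm.fun_mul hu).norm.pow_const 2).aestronglyMeasurable)]
  apply ENNReal.toReal_le_of_le_ofReal (by positivity)
  calc _ ≤ ∫⁻ ξ in Ann N, ENNReal.ofReal (N ^ 2 * (1 + N ^ 2) ^ (-r) * (2 * Cm) ^ 2) *
        ENNReal.ofReal ((1 + ‖ξ‖ ^ 2) ^ r * ‖u ξ‖ ^ 2) := by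
        apply setLIntegral_mono_ae' (Ann_meas N)
        filter_upwards with ξ hξ
        rw [← ENNReal.ofReal_mul (by positivity)]
        apply ENNReal.ofReal_le_ofReal
        have h1 := hξ.1
        have h2 := hξ.2
        have k1 : ‖m ξ‖ ^ 2 ≤ (2 * Cm) ^ 2 * N ^ 2 := by
          have hC : 0 ≤ Cm := by
            by_contra hc
            have := (norm_nonneg _).trans (hm ξ)
            nlinarith
          calc _ ≤ (Cm * (2 * N)) ^ 2 := by
                gcongr; exact (hm ξ).trans (by gcongr)
            _ = _ := by ring
        have k2 : 1 ≤ (1 + N ^ 2) ^ (-r) * (1 + ‖ξ‖ ^ 2) ^ r := by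
          rw [Real.rpow_neg (by positivity), ← div_eq_inv_mul, le_div_iff₀ (by positivity), one_mul]
          gcongr
        rw [norm_mul, mul_pow]
        calc _ ≤ ((2 * Cm) ^ 2 * N ^ 2) * ‖u ξ‖ ^ 2 * 1 := by rw [mul_one]; gcongr
          _ ≤ ((2 * Cm) ^ 2 * N ^ 2) * ‖u ξ‖ ^ 2 * ((1 + N ^ 2) ^ (-r) * (1 + ‖ξ‖ ^ 2) ^ r) := by gcongr
          _ = _ := by ring
    _ = ENNReal.ofReal (N ^ 2 * (1 + N ^ 2) ^ (-r) * (2 * Cm) ^ 2) *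
        ∫⁻ ξ in Ann N, ENNReal.ofReal ((1 + ‖ξ‖ ^ 2) ^ r * ‖u ξ‖ ^ 2) := by
        rw [lintegral_const_mul' _ _ ENNReal.ofReal_ne_top]
    _ ≤ ENNReal.ofReal (N ^ 2 * (1 + N ^ 2) ^ (-r) * (2 * Cm) ^ 2) * ENNReal.ofReal (S ^ 2) := by
        gcongr
        exact (setLIntegral_le_lintegral _ _).trans hS
    _ = _ := by
        rw [← ENNReal.ofReal_mul (by positivity)]; congr 1; ring

lemma core {r θ : ℝ} (hr : 9 / 4 < r) (hθ0 : 0 < θ) (hθ : θ < 1) : ∃ K : ℝ, 0 < K ∧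
    ∀ (μ T σ S B Cm : ℝ), 0 < μ → μ ≤ 1 → 0 < T → |σ| = 1 →
    ∀ (y : ℝ → E2), Measurable y →
    ∀ (m : E2 → ℂ), Measurable m → (∀ ξ, ‖m ξ‖ ≤ Cm * ‖ξ‖) →
    ∀ (u F : ℝ → E2 → ℂ), Measurable (Function.uncurry u) → Measurable (Function.uncurry F) →
    (∀ R : ℝ, ∃ Mb : ℝ, ∀ t ∈ Set.Icc 0 T, ∀ ξ, ‖ξ‖ ≤ R → ‖u t ξ‖ ≤ Mb ∧ ‖F t ξ‖ ≤ Mb) →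
    (∀ a ∈ Set.Icc 0 T, ∀ t ∈ Set.Icc 0 T, ∀ ξ, ξ ≠ 0 → phs μ σ t ξ * u t ξ = phs μ σ a ξ * u a ξ +
      ∫ s in a..t, phs μ σ s ξ * F s ξ) →
    (∀ t ∈ Set.Icc 0 T, ∫⁻ ξ, ENNReal.ofReal ((1 + ‖ξ‖ ^ 2) ^ r * ‖u t ξ‖ ^ 2) ≤ ENNReal.ofReal (S ^ 2)) →
    (∀ t ∈ Set.Icc 0 T, ∫⁻ ξ, ENNReal.ofReal ((1 + ‖ξ‖ ^ 2) ^ (r - 1) * ‖F t ξ‖ ^ 2) ≤ ENNReal.ofReal (B ^ 2)) →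
    ∫⁻ t in Set.Ioc 0 T, ‖∫ ξ, osc μ 0 (y t) ξ * (m ξ * u t ξ)‖ₑ ^ 2 ≤
      ENNReal.ofReal (K * Cm ^ 2 * Xrhs μ θ T S B) := by
  set γ := min (4 * θ / 9) (min ((r - 9 / 4) / 2) 1) with hγ
  have h0 : 0 < γ := by
    rw [hγ]; apply lt_min (by linarith); apply lt_min (by linarith) one_pos
  have h1 : γ ≤ 1 := (min_le_right _ _).trans (min_le_right _ _)
  have h2 : γ ≤ 4 * θ / 9 := min_le_left _ _
  have h3 : γ ≤ (r - 9 / 4) / 2 := (min_le_right _ _).trans (min_le_left _ _)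
  set β : ℤ → ℝ := fun j => Real.sqrt (24000 / γ * cwt r γ ((2:ℝ) ^ j)) with hβ
  have hβp : ∀ j, 0 < β j := fun j => by
    have := cwt_pos (r := r) (γ := γ) (N := (2:ℝ) ^ j) (by positivity)
    exact Real.sqrt_pos.2 (by positivity)
  have hβs : Summable β := by
    have := (cwt_summable (r := r) (γ := γ) (by linarith) h0 (by linarith)).mul_left (Real.sqrt (24000 / γ))
    refine this.congr fun j => ?_
    rw [hβ]; beta_reduce
    rw [Real.sqrt_mul (by positivity)]
  have hL : 0 < ∑' j, β j := hβs.tsum_pos (fun j => (hβp j).le) 0 (hβp 0)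
  refine ⟨4 * (∑' j, β j) ^ 2, by positivity, ?_⟩
  intro μ T σ S B Cm hμ hμ1 hT hσ y hy m hmm hm u F hu hF hbd heq hS hB
  have hw : Measurable (Function.uncurry fun t ξ => m ξ * u t ξ) := (hmm.comp measurable_snd).mul hu
  have hG : Measurable (Function.uncurry fun t ξ => m ξ * F t ξ) := (hmm.comp measurable_snd).mul hF
  have hX0 : 0 ≤ Xrhs μ θ T (2 * Cm * S) (2 * Cm * B) := by unfold Xrhs; positivity
  have hZ : ∀ j : ℤ, ∫⁻ t in Set.Ioc 0 T, ‖∫ ξ in Ann ((2:ℝ) ^ j), osc μ 0 (y t) ξ * (m ξ * u t ξ)‖ₑ ^ 2 ≤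
      ENNReal.ofReal (β j ^ 2 * Xrhs μ θ T (2 * Cm * S) (2 * Cm * B)) := by
    intro j
    have hN : (0:ℝ) < 2 ^ j := by positivity
    obtain ⟨Mb, hMb⟩ := hbd (2 * 2 ^ j)
    have hCm : ∀ ξ ∈ Ann ((2:ℝ) ^ j), ‖m ξ‖ ≤ |Cm| * (2 * 2 ^ j) := fun ξ hξ => by
      refine (hm ξ).trans ((mul_le_mul_of_nonneg_right (le_abs_self Cm) (norm_nonneg _)).trans ?_)
      exact mul_le_mul_of_nonneg_left hξ.2 (abs_nonneg _)
    have b1 : ∀ t ∈ Set.Icc 0 T, ∀ ξ ∈ Ann ((2:ℝ) ^ j), ‖m ξ * u t ξ‖ ≤ |Cm| * (2 * 2 ^ j) * Mb := fun t ht ξ hξ => by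
      rw [norm_mul]
      exact mul_le_mul (hCm ξ hξ) (hMb t ht ξ hξ.2).1 (norm_nonneg _) (by positivity)
    have b2 : ∀ t ∈ Set.Icc 0 T, ∀ ξ ∈ Ann ((2:ℝ) ^ j), ‖m ξ * F t ξ‖ ≤ |Cm| * (2 * 2 ^ j) * Mb := fun t ht ξ hξ => by
      rw [norm_mul]
      exact mul_le_mul (hCm ξ hξ) (hMb t ht ξ hξ.2).2 (norm_nonneg _) (by positivity)
    have key := dyadic_bound (r := r) (S := 2 * Cm * S) (B := 2 * Cm * B) hμ hμ1 hN h0 h1 h2 hθ0 hθ hσ hT hy hw hG b1 b2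
      (by
        intro a ha t ht ξ hξ
        have hξ0 : ξ ≠ 0 := by
          rintro rfl
          have := hξ.1
          rw [norm_zero] at this; linarith
        have e : ∀ s, phs μ σ s ξ * (m ξ * F s ξ) = m ξ * (phs μ σ s ξ * F s ξ) := fun s => by ring
        simp only [e]
        rw [intervalIntegral.integral_const_mul]
        linear_combination m ξ * heq a ha t ht ξ hξ0)
      (fun t ht => Ann_weight hN (by linarith) hu.of_uncurry_left hmm hm (hS t ht))
      (fun t ht => by
        have := Ann_weight hN (by linarith) hF.of_uncurry_left hmm hm (hB t ht)
        rwa [neg_sub] at this)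
    have hβ2 : β j ^ 2 = 24000 / γ * cwt r γ ((2:ℝ) ^ j) := by
      have := cwt_pos (r := r) (γ := γ) hN
      exact Real.sq_sqrt (by positivity)
    rw [hβ2]
    refine le_trans (le_of_eq ?_) (ENNReal.ofReal_le_ofReal key)
    rw [ofReal_integral_eq_lintegral_ofReal (ZN_int hy hw b1) (Filter.Eventually.of_forall fun _ => by positivity)]
    refine lintegral_congr fun t => ?_
    rw [ENNReal.ofReal_pow (norm_nonneg _), ofReal_norm]
  have hmeas : ∀ j : ℤ, Measurable fun t => ‖∫ ξ in Ann ((2:ℝ) ^ j), osc μ 0 (y t) ξ * (m ξ * u t ξ)‖ₑ :=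
    fun j => (ZN_meas hy hw).enorm
  calc _ ≤ ∫⁻ t in Set.Ioc 0 T, (∑' j, ENNReal.ofReal (β j)) * ∑' j : ℤ, ENNReal.ofReal (β j)⁻¹ *
        ‖∫ ξ in Ann ((2:ℝ) ^ j), osc μ 0 (y t) ξ * (m ξ * u t ξ)‖ₑ ^ 2 := by
        refine lintegral_mono fun t => ?_
        refine le_trans ?_ (tsum_cs _ β hβp)
        exact pow_le_pow_left₀ zero_le (dyad_split _) 2
    _ = (∑' j, ENNReal.ofReal (β j)) * ∑' j : ℤ, ENNReal.ofReal (β j)⁻¹ * ∫⁻ t in Set.Ioc 0 T,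
        ‖∫ ξ in Ann ((2:ℝ) ^ j), osc μ 0 (y t) ξ * (m ξ * u t ξ)‖ₑ ^ 2 := by
        rw [lintegral_const_mul _ (Measurable.ennreal_tsum fun j => ((hmeas j).pow_const 2).const_mul _), lintegral_tsum
          (fun j => (((hmeas j).pow_const 2).const_mul _).aemeasurable)]
        congr 2
        ext j
        rw [lintegral_const_mul _ ((hmeas j).pow_const 2)]
    _ ≤ (∑' j, ENNReal.ofReal (β j)) * ∑' j : ℤ, ENNReal.ofReal (β j)⁻¹ *
        ENNReal.ofReal (β j ^ 2 * Xrhs μ θ T (2 * Cm * S) (2 * Cm * B)) := by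
        gcongr with j
        exact hZ j
    _ = (∑' j, ENNReal.ofReal (β j)) * ∑' j : ℤ, 
        ENNReal.ofReal (Xrhs μ θ T (2 * Cm * S) (2 * Cm * B)) * ENNReal.ofReal (β j) := by
        congr 2
        ext j
        have := hβp j
        rw [← ENNReal.ofReal_mul (by positivity), ← ENNReal.ofReal_mul hX0]
        congr 1; field_simp
    _ = _ := by
        rw [ENNReal.tsum_mul_left, ← ENNReal.ofReal_tsum_of_nonneg (fun j => (hβp j).le) hβs,
          ← ENNReal.ofReal_mul hX0, ← ENNReal.ofReal_mul hL.le]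
        congr 1
        unfold Xrhs; ring

/-- measurable selection of the running maximiser -/
def selY (f : ℝ → E2 → ℝ≥0∞) (d : ℕ → E2) : ℕ → ℝ → E2
  | 0, _ => d 0
  | n + 1, t => open Classical in if f t (selY f d n t) < f t (d (n + 1)) then d (n + 1) else selY f d n t

lemma selY_meas {f : ℝ → E2 → ℝ≥0∞} (hf : Measurable (Function.uncurry f)) (d : ℕ → E2) (n : ℕ) :
    Measurable (selY f d n) := by
  induction n with
  | zero => exact measurable_const
  | succ n ih =>
    have h1 : Measurable fun t => f t (selY f d n t) := hf.comp (measurable_id.prodMk ih)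
    have h2 : Measurable fun t => f t (d (n + 1)) := hf.of_uncurry_right
    exact Measurable.ite (measurableSet_lt h1 h2) measurable_const ih

lemma selY_max (f : ℝ → E2 → ℝ≥0∞) (d : ℕ → E2) (n : ℕ) (t : ℝ) :
    f t (selY f d (n + 1) t) = max (f t (selY f d n t)) (f t (d (n + 1))) := by
  rw [selY]
  split_ifs with h
  · rw [max_eq_right h.le]
  · rw [max_eq_left (not_lt.1 h)]

lemma sup_select {f : ℝ → E2 → ℝ≥0∞} (hf : Measurable (Function.uncurry f)) (hc : ∀ t, Continuous (f t))
    {A : Set ℝ} {X : ℝ≥0∞} (h : ∀ y : ℝ → E2, Measurable y → ∫⁻ t in A, f t (y t) ^ 2 ≤ X) :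
    ∫⁻ t in A, (⨆ x, f t x) ^ 2 ≤ X := by
  set d := TopologicalSpace.denseSeq E2 with hd
  have hmono : ∀ t, Monotone fun n => f t (selY f d n t) := fun t =>
    monotone_nat_of_le_succ fun n => by rw [selY_max f d n t]; exact le_max_left _ _
  have hge : ∀ t n, f t (d n) ≤ f t (selY f d n t) := by
    intro t n
    cases n with
    | zero => exact le_rfl
    | succ n => rw [selY_max f d n t]; exact le_max_right _ _
  have hsup : ∀ t, (⨆ x, f t x) ≤ ⨆ n, f t (selY f d n t) := by
    intro t
    apply iSup_le
    intro x
    have hcl : IsClosed {x | f t x ≤ ⨆ n, f t (selY f d n t)} := isClosed_le (hc t) continuous_const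
    have hden : Dense (Set.range d) := TopologicalSpace.denseRange_denseSeq E2
    have : closure (Set.range d) ⊆ {x | f t x ≤ ⨆ n, f t (selY f d n t)} := by
      apply hcl.closure_subset_iff.2
      rintro _ ⟨n, rfl⟩
      exact (hge t n).trans (le_iSup (fun n => f t (selY f d n t)) n)
    exact this (hden x)
  calc _ ≤ ∫⁻ t in A, ⨆ n, f t (selY f d n t) ^ 2 := by
        refine lintegral_mono fun t => ?_
        calc _ ≤ (⨆ n, f t (selY f d n t)) ^ 2 := pow_le_pow_left₀ zero_le (hsup t) 2
          _ ≤ _ := by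
            rw [ENNReal.iSup_pow]
    _ = ⨆ n, ∫⁻ t in A, f t (selY f d n t) ^ 2 := by
        rw [lintegral_iSup]
        · intro n
          exact (hf.comp (measurable_id.prodMk (selY_meas hf d n))).pow_const 2
        · intro i j hij t
          exact pow_le_pow_left₀ zero_le (hmono t hij) 2
    _ ≤ X := iSup_le fun n => h _ (selY_meas hf d n)

lemma osc_zero (μ : ℝ) (x ξ : E2) : osc μ 0 x ξ = Complex.exp (Complex.I * ((2 * Real.pi * inner ℝ x ξ : ℝ) : ℂ)) := by
  unfold osc; rw [zero_mul, sub_zero]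

lemma osc_cx (μ : ℝ) (ξ : E2) : Continuous fun x => osc μ 0 x ξ := by
  simp only [osc_zero]; fun_prop

lemma osc_cxi (μ : ℝ) (x : E2) : Continuous fun ξ => osc μ 0 x ξ := by
  simp only [osc_zero]; fun_prop

lemma osc_ne (μ : ℝ) (x ξ : E2) : osc μ 0 x ξ ≠ 0 := by
  rw [osc_zero]; exact Complex.exp_ne_zero _

lemma osc_int_cont (μ : ℝ) (g : E2 → ℂ) : Continuous fun x => ∫ ξ, osc μ 0 x ξ * g ξ := by
  by_cases hg : Integrable g
  · refine continuous_of_dominated (bound := fun ξ => ‖g ξ‖) ?_ ?_ hg.norm ?_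
    · intro x
      exact (osc_cxi μ x).aestronglyMeasurable.mul hg.aestronglyMeasurable
    · intro x
      filter_upwards with ξ
      rw [norm_mul, osc_norm, one_mul]
    · filter_upwards with ξ
      exact (osc_cx μ ξ).mul continuous_const
  · have : ∀ x, ¬ Integrable fun ξ => osc μ 0 x ξ * g ξ := by
      intro x hx
      apply hg
      have c : Continuous fun ξ => (osc μ 0 x ξ)⁻¹ := 
        (osc_cxi μ x).inv₀ fun ξ => osc_ne μ x ξ
      have := hx.bdd_mul (c := 1) c.aestronglyMeasurable (Filter.Eventually.of_forall fun ξ => by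
        rw [norm_inv, osc_norm, inv_one])
      refine this.congr (Filter.Eventually.of_forall fun ξ => ?_)
      beta_reduce
      rw [inv_mul_cancel_left₀ (osc_ne μ x ξ)]
    have e : (fun x => ∫ ξ, osc μ 0 x ξ * g ξ) = fun _ => 0 := funext fun x => integral_undef (this x)
    rw [e]; exact continuous_const

lemma osc_sup {μ : ℝ} {w : ℝ → E2 → ℂ} (hw : Measurable (Function.uncurry w)) {A : Set ℝ} {X : ℝ≥0∞}
    (h : ∀ y : ℝ → E2, Measurable y → ∫⁻ t in A, ‖∫ ξ, osc μ 0 (y t) ξ * w t ξ‖ₑ ^ 2 ≤ X) :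
    ∫⁻ t in A, (⨆ x, ‖∫ ξ, osc μ 0 x ξ * w t ξ‖ₑ) ^ 2 ≤ X := by
  refine sup_select (f := fun t x => ‖∫ ξ, osc μ 0 x ξ * w t ξ‖ₑ) ?_ ?_ h
  · have : StronglyMeasurable (Function.uncurry fun (p : ℝ × E2) ξ => osc μ 0 p.2 ξ * w p.1 ξ) := by
      refine Measurable.stronglyMeasurable ?_
      refine (osc_meas μ measurable_const (measurable_snd.comp measurable_fst) measurable_snd).mul ?_
      exact hw.comp ((measurable_fst.comp measurable_fst).prodMk measurable_snd)
    exact this.integral_prod_right.measurable.enorm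
  · intro t
    exact (osc_int_cont μ _).enorm

/-- complexification of a real Schwartz function -/
def cS (φ : 𝓢(E2, ℝ)) : 𝓢(E2, ℂ) := SchwartzMap.postcompCLM Complex.ofRealCLM φ

lemma cS_coe (φ : 𝓢(E2, ℝ)) : (cS φ : E2 → ℂ) = cc2 φ := by
  ext x; rfl

lemma cS_cont : Continuous cS := (SchwartzMap.postcompCLM (𝕜 := ℝ) (E := E2) Complex.ofRealCLM).continuous

/-- Fourier transform of a real Schwartz function -/
def hat (φ : 𝓢(E2, ℝ)) : 𝓢(E2, ℂ) := 𝓕 (cS φ)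

lemma hat_coe (φ : 𝓢(E2, ℝ)) : (hat φ : E2 → ℂ) = 𝓕 (cc2 φ) := by
  rw [hat, fourier_coe, cS_coe]

lemma hat_cont : Continuous hat := (FourierTransform.fourierCLM ℂ 𝓢(E2, ℂ)).continuous.comp cS_cont

/-- product of real Schwartz functions -/
def prodS (φ ψ : 𝓢(E2, ℝ)) : 𝓢(E2, ℝ) := SchwartzMap.pairing (ContinuousLinearMap.mul ℝ ℝ) φ ψ

lemma prodS_apply (φ ψ : 𝓢(E2, ℝ)) (x : E2) : prodS φ ψ x = φ x * ψ x := rfl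

open LineDeriv in
lemma pd_lineDeriv (i : Fin 2) (φ : 𝓢(E2, ℝ)) :
    cc2 (pd i φ) = (∂_{(EuclideanSpace.single i 1 : E2)} (cS φ) : 𝓢(E2, ℂ)) := by
  ext x
  rw [lineDerivOp_apply_eq_fderiv, cS_coe]
  have h : HasFDerivAt (cc2 φ) (Complex.ofRealCLM.comp (fderiv ℝ φ x)) x :=
    Complex.ofRealCLM.hasFDerivAt.comp x φ.differentiableAt.hasFDerivAt
  rw [h.fderiv]; rfl

open LineDeriv in
lemma pd_hat (i : Fin 2) (φ : 𝓢(E2, ℝ)) (ξ : E2) :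
    𝓕 (cc2 (pd i φ)) ξ = 2 * Real.pi * Complex.I * (ξ i : ℂ) * hat φ ξ := by
  rw [pd_lineDeriv, ← fourier_coe, fourier_lineDerivOp_eq]
  have : (inner ℝ · (EuclideanSpace.single i 1 : E2)).HasTemperateGrowth :=
    ((innerSL ℝ).flip (EuclideanSpace.single i 1 : E2)).hasTemperateGrowth
  have e : inner ℝ ξ (EuclideanSpace.single i 1 : E2) = ξ i := by
    rw [EuclideanSpace.inner_single_right]; simp
  simp [this, hat, e]
  ring

open LineDeriv in
lemma pd_inv (i : Fin 2) (φ : 𝓢(E2, ℝ)) (x : E2) :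
    ((pd i φ x : ℝ) : ℂ) = 𝓕⁻ (fun ξ : E2 => 2 * Real.pi * Complex.I * (ξ i : ℂ) * hat φ ξ) x := by
  simp only [← pd_hat]
  change cc2 (pd i φ) x = 𝓕⁻ (𝓕 (cc2 (pd i φ))) x
  rw [pd_lineDeriv, ← fourier_coe, ← fourierInv_coe, FourierTransform.fourierInv_fourier_eq]

lemma hat_prod (φ ψ : 𝓢(E2, ℝ)) (ξ : E2) :
    hat (prodS φ ψ) ξ = ∫ ζ, hat φ ζ * hat ψ (ξ - ζ) := by
  have e : cS (prodS φ ψ) = SchwartzMap.pairing (ContinuousLinearMap.mul ℂ ℂ) (cS φ) (cS ψ) := by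
    ext x
    rw [cS_coe, pairing_apply_apply, cS_coe, cS_coe]
    simp [cc2, prodS_apply]
  have e2 : cS (prodS φ ψ) = 𝓕 (SchwartzMap.convolution (ContinuousLinearMap.mul ℂ ℂ) (𝓕⁻ (cS φ)) (𝓕⁻ (cS ψ))) := by
    rw [fourier_convolution, FourierTransform.fourier_fourierInv_eq, FourierTransform.fourier_fourierInv_eq, e]
  have inv_neg : ∀ (f : 𝓢(E2, ℂ)) (x : E2), 𝓕 f x = 𝓕⁻ f (-x) := by
    intro f x
    rw [fourier_coe, fourierInv_coe, Real.fourierInv_eq_fourier_neg, neg_neg]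
  rw [hat, inv_neg, e2, FourierTransform.fourierInv_fourier_eq, convolution_apply]
  unfold MeasureTheory.convolution
  rw [← integral_neg_eq_self]
  refine integral_congr_ae (Filter.Eventually.of_forall fun ζ => ?_)
  simp only [ContinuousLinearMap.mul_apply']
  rw [← inv_neg, show -ξ - -ζ = -(ξ - ζ) by abel, ← inv_neg]
  rfl

/-- jointly continuous, rapidly decaying, locally uniformly in time -/
def Nice (g : ℝ → E2 → ℂ) : Prop := Continuous (Function.uncurry g) ∧
  ∀ (R : ℝ) (k : ℕ), ∃ C : ℝ, 0 ≤ C ∧ ∀ t, |t| ≤ R → ∀ ξ, (1 + ‖ξ‖) ^ k * ‖g t ξ‖ ≤ C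

lemma int3 : Integrable (fun ξ : E2 => ((1 + ‖ξ‖) ^ 3)⁻¹) := by
  have := integrable_one_add_norm (E := E2) (μ := volume) (r := 3) (by simp; norm_num)
  refine this.congr (Filter.Eventually.of_forall fun ξ => ?_)
  beta_reduce
  rw [Real.rpow_neg (by positivity)]; norm_cast

lemma Nice.bd3 {g : ℝ → E2 → ℂ} (hg : Nice g) (R : ℝ) : ∃ C : ℝ, 0 ≤ C ∧ ∀ t, |t| ≤ R → ∀ ξ, 
    ‖g t ξ‖ ≤ C * ((1 + ‖ξ‖) ^ 3)⁻¹ := by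
  obtain ⟨C, hC, h⟩ := hg.2 R 3
  refine ⟨C, hC, fun t ht ξ => ?_⟩
  rw [← div_eq_mul_inv, le_div_iff₀ (by positivity), mul_comm]
  exact h t ht ξ

lemma Nice.bd0 {g : ℝ → E2 → ℂ} (hg : Nice g) (R : ℝ) : ∃ C : ℝ, 0 ≤ C ∧ ∀ t, |t| ≤ R → ∀ ξ, ‖g t ξ‖ ≤ C := by
  obtain ⟨C, hC, h⟩ := hg.2 R 0
  exact ⟨C, hC, fun t ht ξ => by simpa using h t ht ξ⟩

lemma Nice.cont {g : ℝ → E2 → ℂ} (hg : Nice g) (t : ℝ) : Continuous (g t) :=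
  hg.1.comp (by fun_prop : Continuous fun ξ : E2 => (t, ξ))

lemma Nice.contt {g : ℝ → E2 → ℂ} (hg : Nice g) (ξ : E2) : Continuous (fun t => g t ξ) :=
  hg.1.comp (by fun_prop : Continuous fun t : ℝ => (t, ξ))

lemma Nice.int {g : ℝ → E2 → ℂ} (hg : Nice g) (t : ℝ) : Integrable (g t) := by
  obtain ⟨C, hC, h⟩ := hg.bd3 |t|
  exact (int3.const_mul C).mono' (hg.cont t).aestronglyMeasurable (Filter.Eventually.of_forall fun ξ => h t le_rfl ξ)

lemma nice_hat {φ : ℝ → 𝓢(E2, ℝ)} (hφ : Continuous φ) : Nice (fun t => hat (φ t)) := by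
  have hc : Continuous fun t => hat (φ t) := hat_cont.comp hφ
  refine ⟨?_, fun R k => ?_⟩
  · have h1 : Continuous fun t => toBoundedContinuousFunctionCLM ℂ E2 ℂ (hat (φ t)) :=
      (toBoundedContinuousFunctionCLM ℂ E2 ℂ).continuous.comp hc
    have : Continuous fun p : ℝ × E2 => (toBoundedContinuousFunctionCLM ℂ E2 ℂ (hat (φ p.1))) p.2 :=
      (h1.comp continuous_fst).eval continuous_snd
    exact this
  · have hs : ∀ k : ℕ, Continuous fun t => SchwartzMap.seminorm ℂ k 0 (hat (φ t)) := fun k =>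
      ((schwartz_withSeminorms ℂ E2 ℂ).continuous_seminorm (k, 0)).comp hc
    obtain ⟨C0, h0⟩ := (isCompact_Icc (a := -R) (b := R)).exists_bound_of_continuousOn (hs 0).continuousOn
    obtain ⟨C1, h1⟩ := (isCompact_Icc (a := -R) (b := R)).exists_bound_of_continuousOn (hs k).continuousOn
    refine ⟨2 ^ (k - 1) * (|C0| + |C1|), by positivity, fun t ht ξ => ?_⟩
    have ht' := abs_le.1 ht
    have a0 := (norm_pow_mul_le_seminorm ℂ (hat (φ t)) 0 ξ).trans ((le_abs_self _).trans ((h0 t ht').trans (le_abs_self _)))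
    have a1 := (norm_pow_mul_le_seminorm ℂ (hat (φ t)) k ξ).trans ((le_abs_self _).trans ((h1 t ht').trans (le_abs_self _)))
    have := add_pow_le zero_le_one (norm_nonneg ξ) k
    rw [one_pow] at this
    rw [pow_zero] at a0
    calc _ ≤ (2 ^ (k - 1) * (1 + ‖ξ‖ ^ k)) * ‖hat (φ t) ξ‖ := by gcongr
      _ = 2 ^ (k - 1) * (1 * ‖hat (φ t) ξ‖ + ‖ξ‖ ^ k * ‖hat (φ t) ξ‖) := by ring
      _ ≤ _ := by gcongr

lemma Nice.add {f g : ℝ → E2 → ℂ} (hf : Nice f) (hg : Nice g) : Nice (fun t ξ => f t ξ + g t ξ) := by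
  refine ⟨hf.1.add hg.1, fun R k => ?_⟩
  obtain ⟨C, hC, h⟩ := hf.2 R k
  obtain ⟨D, hD, h'⟩ := hg.2 R k
  refine ⟨C + D, by positivity, fun t ht ξ => ?_⟩
  calc _ ≤ (1 + ‖ξ‖) ^ k * (‖f t ξ‖ + ‖g t ξ‖) := by gcongr; exact norm_add_le _ _
    _ = (1 + ‖ξ‖) ^ k * ‖f t ξ‖ + (1 + ‖ξ‖) ^ k * ‖g t ξ‖ := by ring
    _ ≤ _ := add_le_add (h t ht ξ) (h' t ht ξ)

lemma Nice.mulm {g : ℝ → E2 → ℂ} (hg : Nice g) {m : E2 → ℂ} (hm : Continuous m) {Cm : ℝ} 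
    (hb : ∀ ξ, ‖m ξ‖ ≤ Cm * (1 + ‖ξ‖)) : Nice (fun t ξ => m ξ * g t ξ) := by
  have hC : 0 ≤ Cm := by
    have := (norm_nonneg _).trans (hb 0)
    simpa using this
  refine ⟨(hm.comp continuous_snd).mul hg.1, fun R k => ?_⟩
  obtain ⟨C, hC', h⟩ := hg.2 R (k + 1)
  refine ⟨Cm * C, by positivity, fun t ht ξ => ?_⟩
  rw [norm_mul]
  calc _ ≤ (1 + ‖ξ‖) ^ k * ((Cm * (1 + ‖ξ‖)) * ‖g t ξ‖) := by gcongr; exact hb ξ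
    _ = Cm * ((1 + ‖ξ‖) ^ (k + 1) * ‖g t ξ‖) := by ring
    _ ≤ _ := by gcongr; exact h t ht ξ

lemma Nice.conv {f g : ℝ → E2 → ℂ} (hf : Nice f) (hg : Nice g) : Nice (fun t ξ => ∫ ζ, f t ζ * g t (ξ - ζ)) := by
  refine ⟨?_, fun R k => ?_⟩
  · rw [continuous_iff_continuousAt]
    rintro ⟨t₀, ξ₀⟩
    obtain ⟨C, hC, h⟩ := hf.bd3 (|t₀| + 1)
    obtain ⟨D, hD, h'⟩ := hg.bd0 (|t₀| + 1)
    have hev : ∀ᶠ p : ℝ × E2 in nhds (t₀, ξ₀), |p.1| ≤ |t₀| + 1 := by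
      have : Continuous fun p : ℝ × E2 => |p.1| := by fun_prop
      have := this.continuousAt (x := (t₀, ξ₀))
      exact (this.eventually_lt_const (by simp : |((t₀, ξ₀) : ℝ × E2).1| < |t₀| + 1)).mono fun _ h => h.le
    have hjc : ∀ p : ℝ × E2, Continuous fun ζ => f p.1 ζ * g p.1 (p.2 - ζ) := fun p =>
      (hf.cont p.1).mul ((hg.cont p.1).comp (by fun_prop))
    refine continuousAt_of_dominated (F := fun (p : ℝ × E2) ζ => f p.1 ζ * g p.1 (p.2 - ζ))
      (bound := fun ζ => C * ((1 + ‖ζ‖) ^ 3)⁻¹ * D) ?_ ?_ ((int3.const_mul C).mul_const D) ?_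
    · exact Filter.Eventually.of_forall fun p => (hjc p).aestronglyMeasurable
    · filter_upwards [hev] with p hp
      filter_upwards with ζ
      rw [norm_mul]
      exact mul_le_mul (h _ hp _) (h' _ hp _) (norm_nonneg _) (by positivity)
    · filter_upwards with ζ
      apply Continuous.continuousAt
      exact (hf.1.comp (by fun_prop : Continuous fun p : ℝ × E2 => (p.1, ζ))).mul
        (hg.1.comp (by fun_prop : Continuous fun p : ℝ × E2 => (p.1, p.2 - ζ)))
  · obtain ⟨C, hC, h⟩ := hf.2 R (k + 3)
    obtain ⟨D, hD, h'⟩ := hg.2 R k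
    refine ⟨∫ ζ : E2, C * ((1 + ‖ζ‖) ^ 3)⁻¹ * D, integral_nonneg fun ζ => by positivity, fun t ht ξ => ?_⟩
    have : (1 + ‖ξ‖) ^ k * ‖∫ ζ, f t ζ * g t (ξ - ζ)‖ = ‖∫ ζ, (((1 + ‖ξ‖) ^ k : ℝ) : ℂ) * (f t ζ * g t (ξ - ζ))‖ := by
      rw [integral_const_mul, norm_mul, Complex.norm_real, Real.norm_of_nonneg (by positivity)]
    rw [this]
    refine norm_integral_le_of_norm_le ((int3.const_mul C).mul_const D) (Filter.Eventually.of_forall fun ζ => ?_)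
    rw [norm_mul, norm_mul, Complex.norm_real, Real.norm_of_nonneg (by positivity)]
    have hle : 1 + ‖ξ‖ ≤ (1 + ‖ζ‖) * (1 + ‖ξ - ζ‖) := by
      have : ‖ξ‖ ≤ ‖ζ‖ + ‖ξ - ζ‖ := by
        calc ‖ξ‖ = ‖ζ + (ξ - ζ)‖ := by congr 1; abel
          _ ≤ _ := norm_add_le _ _
      nlinarith [norm_nonneg ζ, norm_nonneg (ξ - ζ), mul_nonneg (norm_nonneg ζ) (norm_nonneg (ξ - ζ))]
    have h3 : (1 + ‖ζ‖) ^ k * ‖f t ζ‖ ≤ C * ((1 + ‖ζ‖) ^ 3)⁻¹ := by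
      rw [← div_eq_mul_inv, le_div_iff₀ (by positivity)]
      calc _ = (1 + ‖ζ‖) ^ (k + 3) * ‖f t ζ‖ := by ring
        _ ≤ C := h t ht ζ
    calc _ ≤ ((1 + ‖ζ‖) * (1 + ‖ξ - ζ‖)) ^ k * (‖f t ζ‖ * ‖g t (ξ - ζ)‖) := by gcongr
      _ = ((1 + ‖ζ‖) ^ k * ‖f t ζ‖) * ((1 + ‖ξ - ζ‖) ^ k * ‖g t (ξ - ζ)‖) := by
          rw [mul_pow]; ring
      _ ≤ _ := mul_le_mul h3 (h' t ht _) (by positivity) (by positivity)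

lemma fourierInv_osc (μ : ℝ) (f : E2 → ℂ) (x : E2) : 𝓕⁻ f x = ∫ ξ, osc μ 0 x ξ * f ξ := by
  rw [Real.fourierInv_eq']
  refine integral_congr_ae (Filter.Eventually.of_forall fun ξ => ?_)
  simp only [osc_zero, smul_eq_mul]
  rw [real_inner_comm, mul_comm Complex.I]

lemma evol {w : ℝ → 𝓢(E2, ℝ)} {c : ℝ → E2 → ℂ} (hc : Nice c) {T : ℝ}
    (hd : ∀ t ∈ Set.Icc 0 T, ∀ x, HasDerivAt (fun τ => ((w τ x : ℝ) : ℂ)) (-(𝓕⁻ (c t) x)) t) :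
    ∀ a ∈ Set.Icc 0 T, ∀ t ∈ Set.Icc 0 T, ∀ ξ, hat (w t) ξ = hat (w a) ξ + ∫ s in a..t, -c s ξ := by
  intro a ha t ht
  set h : E2 → ℂ := fun ξ => ∫ s in a..t, -c s ξ with hh
  have hsub : Set.uIcc a t ⊆ Set.Icc 0 T := Set.uIcc_subset_Icc ha ht
  obtain ⟨C, hC, hb⟩ := hc.bd3 T
  have hbT : ∀ s ∈ Set.Icc 0 T, ∀ ξ, ‖c s ξ‖ ≤ C * ((1 + ‖ξ‖) ^ 3)⁻¹ := fun s hs ξ =>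
    hb s (by rw [abs_of_nonneg hs.1]; exact hs.2) ξ
  have hcont : Continuous h := by
    apply intervalIntegral.continuous_parametric_intervalIntegral_of_continuous'
    exact (hc.1.comp (by fun_prop : Continuous fun p : E2 × ℝ => (p.2, p.1))).neg
  have hbd : ∀ ξ, ‖h ξ‖ ≤ C * ((1 + ‖ξ‖) ^ 3)⁻¹ * |t - a| := by
    intro ξ
    refine intervalIntegral.norm_integral_le_of_norm_le_const fun s hs => ?_
    rw [norm_neg]
    exact hbT s (hsub (Set.uIoc_subset_uIcc hs)) ξ
  have hIntg : Integrable h :=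
    ((int3.const_mul C).mul_const _).mono' hcont.aestronglyMeasurable (Filter.Eventually.of_forall hbd)
  have hFub : ∀ x, Integrable (Function.uncurry fun s ξ => osc 1 0 x ξ * -c s ξ)
      ((volume.restrict (Set.uIoc a t)).prod volume) := by
    intro x
    have hfin : IsFiniteMeasure (volume.restrict (Set.uIoc a t)) := ⟨by
      rw [Measure.restrict_apply_univ, Set.uIoc]; exact measure_Ioc_lt_top⟩
    have hm := (int3.const_mul C).comp_snd (μ := volume.restrict (Set.uIoc a t))
    refine hm.mono' ?_ ?_
    · apply Continuous.aestronglyMeasurable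
      exact ((osc_cxi 1 x).comp continuous_snd).mul hc.1.neg
    · have : ∀ᵐ p ∂((volume.restrict (Set.uIoc a t)).prod (volume : Measure E2)), p.1 ∈ Set.uIoc a t := by
        apply Measure.quasiMeasurePreserving_fst.ae (p := fun s => s ∈ Set.uIoc a t)
        exact ae_restrict_mem measurableSet_uIoc
      filter_upwards [this] with p hp
      simp only [Function.uncurry]
      rw [norm_mul, osc_norm, one_mul, norm_neg]
      exact hbT p.1 (hsub (Set.uIoc_subset_uIcc hp)) p.2
  have key : ∀ x, 𝓕⁻ h x = ((w t x : ℝ) : ℂ) - ((w a x : ℝ) : ℂ) := by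
    intro x
    have e1 : ∀ s, -(𝓕⁻ (c s) x) = ∫ ξ, osc 1 0 x ξ * -c s ξ := by
      intro s
      rw [fourierInv_osc 1, ← integral_neg]
      simp only [mul_neg]
    have hii : IntervalIntegrable (fun s => -(𝓕⁻ (c s) x)) volume a t := by
      rw [intervalIntegrable_iff]
      simp only [e1]
      exact (hFub x).integral_prod_left
    rw [← intervalIntegral.integral_eq_sub_of_hasDerivAt (fun s hs => hd s (hsub hs) x) hii]
    simp only [e1]
    rw [intervalIntegral_integral_swap (hFub x), fourierInv_osc 1]
    refine integral_congr_ae (Filter.Eventually.of_forall fun ξ => ?_)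
    simp only [hh]
    rw [intervalIntegral.integral_const_mul]
  have key2 : 𝓕⁻ h = (cS (w t) - cS (w a) : 𝓢(E2, ℂ)) := by
    funext x
    rw [key x, sub_apply, cS_coe, cS_coe]; rfl
  have key3 : 𝓕 h = fun x => (cS (w t) - cS (w a) : 𝓢(E2, ℂ)) (-x) := by
    funext x
    rw [← key2, Real.fourierInv_eq_fourier_neg, neg_neg]
  have hF : Integrable (𝓕 h) := by
    rw [key3]
    exact (cS (w t) - cS (w a)).integrable.comp_neg
  have := hcont.fourier_fourierInv_eq hIntg hF
  rw [key2, ← fourier_coe] at this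
  intro ξ
  have h2 := congrFun this ξ
  have h3 : 𝓕 (cS (w t) - cS (w a)) = hat (w t) - hat (w a) :=
    map_sub (FourierTransform.fourierCLM ℂ 𝓢(E2, ℂ)) (cS (w t)) (cS (w a))
  rw [h3, sub_apply] at h2
  exact sub_eq_iff_eq_add'.1 h2

lemma Ts_facts {μ : ℝ} (hμ : 0 < μ) (ξ : E2) : 0 < Tsymb μ ‖ξ‖ ∧ Tsymb μ ‖ξ‖ ≤ 1 ∧
    1 ≤ Tsymb μ ‖ξ‖ * (1 + Real.sqrt μ * ‖ξ‖) := by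
  rw [Tsymb]
  split_ifs with h
  · rw [h]; norm_num
  · have hk : 0 < Real.sqrt μ * ‖ξ‖ := mul_pos (Real.sqrt_pos.2 hμ) (lt_of_le_of_ne (norm_nonneg _) (Ne.symm h))
    obtain ⟨h1, h2, h3, h4⟩ := tanh_facts hk
    set k := Real.sqrt μ * ‖ξ‖
    have h0 : 0 < Real.tanh k := lt_of_lt_of_le (by positivity) h1
    refine ⟨by positivity, by rw [div_le_one hk]; exact h3, ?_⟩
    rw [div_le_iff₀ (by positivity)] at h1
    rw [div_mul_eq_mul_div, le_div_iff₀ hk]; linarith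

lemma Ts_cont {μ : ℝ} (hμ : 0 < μ) : Continuous fun ξ : E2 => Tsymb μ ‖ξ‖ := by
  rw [continuous_iff_continuousAt]
  intro ξ
  by_cases h : ξ = 0
  · subst h
    have hc : Filter.Tendsto (fun ξ : E2 => (1 + Real.sqrt μ * ‖ξ‖)⁻¹) (nhds 0) (nhds 1) := by
      have : Continuous fun ξ : E2 => (1 + Real.sqrt μ * ‖ξ‖)⁻¹ := by
        apply Continuous.inv₀ (by fun_prop)
        intro x; positivity
      simpa using this.tendsto 0
    have e : Tsymb μ ‖(0 : E2)‖ = 1 := by simp [Tsymb]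
    rw [ContinuousAt, e]
    refine tendsto_of_tendsto_of_tendsto_of_le_of_le hc tendsto_const_nhds ?_ ?_
    · intro ξ
      have := (Ts_facts hμ ξ).2.2
      beta_reduce
      rw [inv_le_iff_one_le_mul₀ (by positivity)]; linarith
    · intro ξ; exact (Ts_facts hμ ξ).2.1
  · have hn : ‖ξ‖ ≠ 0 := norm_ne_zero_iff.2 h
    have hs := Real.sqrt_pos.2 hμ
    have : ContinuousAt (fun ξ : E2 => Real.tanh (Real.sqrt μ * ‖ξ‖) / (Real.sqrt μ * ‖ξ‖)) ξ := by
      apply ContinuousAt.div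
      · apply Continuous.continuousAt
        simp only [Real.tanh_eq_sinh_div_cosh]
        apply Continuous.div (by fun_prop) (by fun_prop)
        intro x; exact (Real.cosh_pos _).ne'
      · fun_prop
      · positivity
    refine this.congr ?_
    filter_upwards [isOpen_ne.mem_nhds h] with x hx
    rw [Tsymb, if_neg (norm_ne_zero_iff.2 hx)]

/-- square root of the symbol -/
def tau (μ : ℝ) (ξ : E2) : ℝ := Real.sqrt (Tsymb μ ‖ξ‖)

lemma tau_pos {μ : ℝ} (hμ : 0 < μ) (ξ : E2) : 0 < tau μ ξ := Real.sqrt_pos.2 (Ts_facts hμ ξ).1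

lemma tau_le {μ : ℝ} (hμ : 0 < μ) (ξ : E2) : tau μ ξ ≤ 1 := Real.sqrt_le_one.2 (Ts_facts hμ ξ).2.1

lemma tau_sq {μ : ℝ} (hμ : 0 < μ) (ξ : E2) : tau μ ξ ^ 2 = Tsymb μ ‖ξ‖ := Real.sq_sqrt (Ts_facts hμ ξ).1.le

lemma tau_cont {μ : ℝ} (hμ : 0 < μ) : Continuous (tau μ) := (Ts_cont hμ).sqrt

lemma tau_inv_cont {μ : ℝ} (hμ : 0 < μ) : Continuous fun ξ => (tau μ ξ)⁻¹ :=
  (tau_cont hμ).inv₀ fun ξ => (tau_pos hμ ξ).ne'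

lemma tau_inv_sq {μ : ℝ} (hμ : 0 < μ) (ξ : E2) : (tau μ ξ)⁻¹ ^ 2 ≤ 1 + Real.sqrt μ * ‖ξ‖ := by
  rw [inv_pow, tau_sq hμ]
  have := Ts_facts hμ ξ
  rw [inv_le_iff_one_le_mul₀ this.1]; linarith [this.2.2]

lemma tau_inv_le {μ : ℝ} (hμ : 0 < μ) (hμ1 : μ ≤ 1) (ξ : E2) : (tau μ ξ)⁻¹ ≤ 1 + ‖ξ‖ := by
  have h := tau_inv_sq hμ ξ
  have h1 : Real.sqrt μ ≤ 1 := Real.sqrt_le_one.2 hμ1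
  refine le_of_sq_le_sq (h.trans ?_) (by positivity)
  nlinarith [norm_nonneg ξ, mul_le_mul_of_nonneg_right h1 (norm_nonneg ξ)]

lemma Ts_rpow {μ : ℝ} (hμ : 0 < μ) (ξ : E2) : Tsymb μ ‖ξ‖ ^ (-(1 : ℝ) / 2) = (tau μ ξ)⁻¹ := by
  rw [tau, Real.sqrt_eq_rpow, ← Real.rpow_neg (Ts_facts hμ ξ).1.le]; norm_num

lemma omg_eq {μ : ℝ} (hμ : 0 < μ) (ξ : E2) : omg μ ‖ξ‖ = ‖ξ‖ * tau μ ξ := by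
  by_cases h : ‖ξ‖ = 0
  · rw [h]; simp [omg, wth]
  have hs := Real.sqrt_pos.2 hμ
  have hp : 0 < ‖ξ‖ := lt_of_le_of_ne (norm_nonneg _) (Ne.symm h)
  rw [omg, div_eq_iff hs.ne', wth]
  have := tau_pos hμ ξ
  have h2 := (tanh_facts (mul_pos hs hp)).1
  have h0 : 0 ≤ Real.tanh (Real.sqrt μ * ‖ξ‖) := le_trans (by positivity) h2
  rw [Real.sqrt_eq_iff_eq_sq (by positivity) (by positivity)]
  rw [mul_pow, mul_pow, tau_sq hμ, Tsymb, if_neg h]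
  field_simp

lemma ode_duh {U F : ℝ → ℂ} {lam : ℝ} (hU : Continuous U) (hF : Continuous F) {T : ℝ}
    (h : ∀ a ∈ Set.Icc 0 T, ∀ t ∈ Set.Icc 0 T, U t = U a + ∫ s in a..t, (-(Complex.I * lam) * U s + F s)) :
    ∀ a ∈ Set.Icc 0 T, ∀ t ∈ Set.Icc 0 T, Complex.exp (Complex.I * ((lam * t : ℝ) : ℂ)) * U t =
      Complex.exp (Complex.I * ((lam * a : ℝ) : ℂ)) * U a + ∫ s in a..t, Complex.exp (Complex.I * ((lam * s : ℝ) : ℂ)) * F s := by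
  intro a ha t ht
  have hsub : Set.uIcc a t ⊆ Set.Icc 0 T := Set.uIcc_subset_Icc ha ht
  set G : ℝ → ℂ := fun t => U a + ∫ s in a..t, (-(Complex.I * lam) * U s + F s) with hG
  have hGU : ∀ t ∈ Set.Icc 0 T, G t = U t := fun t ht => (h a ha t ht).symm
  have hcont : Continuous fun s => -(Complex.I * lam) * U s + F s := by fun_prop
  have hGd : ∀ s, HasDerivAt G (-(Complex.I * lam) * U s + F s) s := fun s =>
    (intervalIntegral.integral_hasDerivAt_right (hcont.intervalIntegrable _ _)
      hcont.stronglyMeasurable.stronglyMeasurableAtFilter hcont.continuousAt).const_add _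
  have hE : ∀ s : ℝ, HasDerivAt (fun s : ℝ => Complex.exp (Complex.I * ((lam * s : ℝ) : ℂ)))
      (Complex.exp (Complex.I * ((lam * s : ℝ) : ℂ)) * (Complex.I * lam)) s := by
    intro s
    have h1 : HasDerivAt (fun s : ℝ => Complex.I * ((lam * s : ℝ) : ℂ)) (Complex.I * lam) s := by
      have := ((hasDerivAt_id s).const_mul lam).ofReal_comp.const_mul Complex.I
      simpa using this
    exact h1.cexp
  have hd : ∀ s ∈ Set.uIcc a t, HasDerivAt (fun s : ℝ => Complex.exp (Complex.I * ((lam * s : ℝ) : ℂ)) * G s)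
      (Complex.exp (Complex.I * ((lam * s : ℝ) : ℂ)) * F s) s := by
    intro s hs
    refine ((hE s).mul (hGd s)).congr_deriv ?_
    rw [hGU s (hsub hs)]; ring
  have := intervalIntegral.integral_eq_sub_of_hasDerivAt hd
    (Continuous.intervalIntegrable (by fun_prop) _ _)
  rw [this, hGU t ht, hGU a ha]; ring

/-- Sobolev weight -/
def wgt (r a : ℝ) (ξ : E2) : ℝ := (1 + ‖ξ‖ ^ 2) ^ r * (1 + a * ‖ξ‖)

/-- squared weighted norm -/
def NN (r a : ℝ) (f : E2 → ℂ) : ℝ≥0∞ := ∫⁻ ξ, ENNReal.ofReal (wgt r a ξ * ‖f ξ‖ ^ 2)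

lemma wgt_pos {r a : ℝ} (ha : 0 ≤ a) (ξ : E2) : 0 < wgt r a ξ := by unfold wgt; positivity

lemma wgt_cont (r a : ℝ) : Continuous (wgt r a) := by
  unfold wgt
  refine Continuous.mul (Continuous.rpow_const (by fun_prop) fun ξ => Or.inl (by positivity)) (by fun_prop)

lemma wgt_sub {r a : ℝ} (hr : 0 ≤ r) (ha : 0 ≤ a) (ξ ζ : E2) :
    wgt r a ξ ≤ 4 ^ r * 2 * (wgt r a ζ + wgt r a (ξ - ζ)) := by
  have h : ‖ξ‖ ≤ ‖ζ‖ + ‖ξ - ζ‖ := by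
    calc ‖ξ‖ = ‖ζ + (ξ - ζ)‖ := by congr 1; abel
      _ ≤ _ := norm_add_le _ _
  have aux : ∀ z : E2, ‖ξ‖ ≤ 2 * ‖z‖ → wgt r a ξ ≤ 4 ^ r * 2 * wgt r a z := by
    intro z hz
    unfold wgt
    have h1 : (1 + ‖ξ‖ ^ 2) ^ r ≤ 4 ^ r * (1 + ‖z‖ ^ 2) ^ r := by
      rw [← Real.mul_rpow (by norm_num) (by positivity)]
      apply Real.rpow_le_rpow (by positivity) _ hr
      nlinarith [norm_nonneg ξ, norm_nonneg z]
    have h2 : 1 + a * ‖ξ‖ ≤ 2 * (1 + a * ‖z‖) := by nlinarith [mul_le_mul_of_nonneg_left hz ha]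
    calc _ ≤ (4 ^ r * (1 + ‖z‖ ^ 2) ^ r) * (2 * (1 + a * ‖z‖)) := by gcongr
      _ = _ := by ring
  have p1 := wgt_pos (r := r) ha ζ
  have p2 := wgt_pos (r := r) ha (ξ - ζ)
  have p3 : (0:ℝ) < 4 ^ r * 2 := by positivity
  rcases le_total ‖ζ‖ ‖ξ - ζ‖ with h1 | h1
  · refine (aux (ξ - ζ) (by linarith)).trans ?_
    gcongr; linarith
  · refine (aux ζ (by linarith)).trans ?_
    gcongr; linarith

lemma NN_eq {r a : ℝ} (ha : 0 ≤ a) (f : E2 → ℂ) : NN r a f = ∫⁻ ξ, ENNReal.ofReal (wgt r a ξ) * ‖f ξ‖ₑ ^ 2 := by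
  unfold NN
  congr 1; funext ξ
  rw [ENNReal.ofReal_mul (wgt_pos ha ξ).le, ENNReal.ofReal_pow (norm_nonneg _), ofReal_norm]

lemma bilin {r : ℝ} (hr : 1 < r) : ∃ K : ℝ, 0 < K ∧ ∀ a, 0 ≤ a → ∀ f g : E2 → ℂ, Measurable f → Measurable g →
    NN r a (fun ξ => ∫ ζ, f ζ * g (ξ - ζ)) ≤ ENNReal.ofReal K * (NN r a f * NN r a g) := by
  have hIntg : Integrable (fun ζ : E2 => (1 + ‖ζ‖ ^ 2) ^ (-r)) := by
    have := integrable_rpow_neg_one_add_norm_sq (E := E2) (μ := volume) (r := 2 * r) (by simp; linarith)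
    convert this using 3; ring
  set J0 := ∫ ζ : E2, (1 + ‖ζ‖ ^ 2) ^ (-r) with hJ0
  have hJ0n : 0 ≤ J0 := integral_nonneg fun ζ => by positivity
  have hJ : ∫⁻ ζ : E2, ENNReal.ofReal ((1 + ‖ζ‖ ^ 2) ^ (-r)) = ENNReal.ofReal J0 :=
    (ofReal_integral_eq_lintegral_ofReal hIntg (Filter.Eventually.of_forall fun ζ => by positivity)).symm
  have hJm : Measurable fun ζ : E2 => ENNReal.ofReal ((1 + ‖ζ‖ ^ 2) ^ (-r)) := by fun_prop
  refine ⟨4 ^ r * 2 * (J0 + J0) + 1, by positivity, fun a ha f g hf hg => ?_⟩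
  have hwm : Measurable (wgt r a) := (wgt_cont r a).measurable
  have key : ∀ ξ : E2, ENNReal.ofReal (wgt r a ξ) * ‖∫ ζ, f ζ * g (ξ - ζ)‖ₑ ^ 2 ≤
      ENNReal.ofReal (4 ^ r * 2 * (J0 + J0) + 1) *
        ∫⁻ ζ, (ENNReal.ofReal (wgt r a ζ) * ‖f ζ‖ₑ ^ 2) * (ENNReal.ofReal (wgt r a (ξ - ζ)) * ‖g (ξ - ζ)‖ₑ ^ 2) := by
    intro ξ
    set p : E2 → ℝ := fun ζ => wgt r a ζ * wgt r a (ξ - ζ) with hp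
    have hpp : ∀ ζ, 0 < p ζ := fun ζ => mul_pos (wgt_pos ha _) (wgt_pos ha _)
    have hpm : Measurable p := hwm.mul (hwm.comp (by fun_prop))
    have hgm : Measurable fun ζ => g (ξ - ζ) := hg.comp (by fun_prop)
    have e1 : ‖∫ ζ, f ζ * g (ξ - ζ)‖ₑ ≤ ∫⁻ ζ, (ENNReal.ofReal (Real.sqrt (p ζ)) * (‖f ζ‖ₑ * ‖g (ξ - ζ)‖ₑ)) *
        ENNReal.ofReal ((Real.sqrt (p ζ))⁻¹) := by
      refine (enorm_integral_le_lintegral_enorm _).trans (le_of_eq ?_)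
      congr 1; funext ζ
      rw [enorm_mul, mul_right_comm, ← ENNReal.ofReal_mul (Real.sqrt_nonneg _),
        mul_inv_cancel₀ (Real.sqrt_pos.2 (hpp ζ)).ne', ENNReal.ofReal_one, one_mul]
    have e2 := lcs (volume : Measure E2) (f := fun ζ => ENNReal.ofReal (Real.sqrt (p ζ)) * (‖f ζ‖ₑ * ‖g (ξ - ζ)‖ₑ))
      (g := fun ζ => ENNReal.ofReal ((Real.sqrt (p ζ))⁻¹))
      (by
        have h1 : Measurable fun ζ => ENNReal.ofReal (Real.sqrt (p ζ)) := hpm.sqrt.ennreal_ofReal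
        exact (h1.mul (hf.enorm.mul hgm.enorm)).aemeasurable)
      (hpm.sqrt.inv.ennreal_ofReal).aemeasurable
    have e3 : ENNReal.ofReal (wgt r a ξ) * ∫⁻ ζ, ENNReal.ofReal ((Real.sqrt (p ζ))⁻¹) ^ 2 ≤
        ENNReal.ofReal (4 ^ r * 2 * (J0 + J0) + 1) := by
      have hq : Measurable fun ζ => ENNReal.ofReal ((Real.sqrt (p ζ))⁻¹) ^ 2 := hpm.sqrt.inv.ennreal_ofReal.pow_const 2
      rw [← lintegral_const_mul _ hq]
      have : ∀ ζ, ENNReal.ofReal (wgt r a ξ) * ENNReal.ofReal ((Real.sqrt (p ζ))⁻¹) ^ 2 ≤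
          ENNReal.ofReal (4 ^ r * 2) * (ENNReal.ofReal ((1 + ‖ξ - ζ‖ ^ 2) ^ (-r)) + ENNReal.ofReal ((1 + ‖ζ‖ ^ 2) ^ (-r))) := by
        intro ζ
        rw [← ENNReal.ofReal_pow (by positivity), inv_pow, Real.sq_sqrt (hpp ζ).le,
          ← ENNReal.ofReal_mul (wgt_pos ha _).le, ← ENNReal.ofReal_add (by positivity) (by positivity),
          ← ENNReal.ofReal_mul (by positivity)]
        apply ENNReal.ofReal_le_ofReal
        have w1 := wgt_pos (r := r) ha ζ
        have w2 := wgt_pos (r := r) ha (ξ - ζ)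
        have hinv : ∀ z : E2, (wgt r a z)⁻¹ ≤ (1 + ‖z‖ ^ 2) ^ (-r) := by
          intro z
          rw [Real.rpow_neg (by positivity)]
          apply inv_anti₀ (by positivity)
          unfold wgt
          apply le_mul_of_one_le_right (by positivity)
          have := mul_nonneg ha (norm_nonneg z); linarith
        calc wgt r a ξ * (p ζ)⁻¹ ≤ (4 ^ r * 2 * (wgt r a ζ + wgt r a (ξ - ζ))) * (p ζ)⁻¹ := by
              have := hpp ζ
              gcongr; exact wgt_sub (by linarith) ha ξ ζ
          _ = 4 ^ r * 2 * ((wgt r a (ξ - ζ))⁻¹ + (wgt r a ζ)⁻¹) := by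
              rw [hp]; field_simp
          _ ≤ _ := by gcongr <;> exact hinv _
      refine (lintegral_mono this).trans ?_
      have hJm2 : Measurable fun ζ : E2 => ENNReal.ofReal ((1 + ‖ξ - ζ‖ ^ 2) ^ (-r)) := by fun_prop
      rw [lintegral_const_mul _ (hJm2.fun_add hJm), lintegral_add_left hJm2,
        lintegral_sub_left_eq_self (fun ζ : E2 => ENNReal.ofReal ((1 + ‖ζ‖ ^ 2) ^ (-r))) ξ, hJ,
        ← ENNReal.ofReal_add hJ0n hJ0n, ← ENNReal.ofReal_mul (by positivity)]
      apply ENNReal.ofReal_le_ofReal; linarith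
    have e4 : ∀ ζ, (ENNReal.ofReal (Real.sqrt (p ζ)) * (‖f ζ‖ₑ * ‖g (ξ - ζ)‖ₑ)) ^ 2 =
        (ENNReal.ofReal (wgt r a ζ) * ‖f ζ‖ₑ ^ 2) * (ENNReal.ofReal (wgt r a (ξ - ζ)) * ‖g (ξ - ζ)‖ₑ ^ 2) := by
      intro ζ
      rw [mul_pow, ← ENNReal.ofReal_pow (by positivity), Real.sq_sqrt (hpp ζ).le]
      rw [hp]; beta_reduce
      rw [ENNReal.ofReal_mul (wgt_pos ha _).le]; ring
    simp only [e4] at e2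
    calc _ ≤ ENNReal.ofReal (wgt r a ξ) * _ := mul_le_mul_right ((pow_le_pow_left' e1 2).trans e2) _
      _ = (ENNReal.ofReal (wgt r a ξ) * ∫⁻ ζ, ENNReal.ofReal ((Real.sqrt (p ζ))⁻¹) ^ 2) * _ := by
        rw [mul_left_comm, mul_comm]
      _ ≤ _ := mul_le_mul_left e3 _
  rw [NN_eq ha, NN_eq ha, NN_eq ha]
  refine (lintegral_mono key).trans ?_
  have hfm : Measurable fun ζ => ENNReal.ofReal (wgt r a ζ) * ‖f ζ‖ₑ ^ 2 :=
    hwm.ennreal_ofReal.mul (hf.enorm.pow_const 2)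
  have hgm : Measurable fun ζ => ENNReal.ofReal (wgt r a ζ) * ‖g ζ‖ₑ ^ 2 :=
    hwm.ennreal_ofReal.mul (hg.enorm.pow_const 2)
  have hjm : Measurable (Function.uncurry fun ξ ζ : E2 => (ENNReal.ofReal (wgt r a ζ) * ‖f ζ‖ₑ ^ 2) *
      (ENNReal.ofReal (wgt r a (ξ - ζ)) * ‖g (ξ - ζ)‖ₑ ^ 2)) :=
    (hfm.comp measurable_snd).mul (hgm.comp (measurable_fst.sub measurable_snd))
  rw [lintegral_const_mul _ hjm.lintegral_prod_right]
  rw [lintegral_lintegral_swap hjm.aemeasurable]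
  apply mul_le_mul_right
  apply le_of_eq
  rw [← lintegral_mul_const _ hfm]
  congr 1; funext ζ
  have hg2 : Measurable fun ξ : E2 => ENNReal.ofReal (wgt r a (ξ - ζ)) * ‖g (ξ - ζ)‖ₑ ^ 2 :=
    hgm.comp (by fun_prop)
  rw [lintegral_const_mul _ hg2,
    lintegral_sub_right_eq_self (fun ξ : E2 => ENNReal.ofReal (wgt r a ξ) * ‖g ξ‖ₑ ^ 2) ζ]

lemma coord_le (ξ : E2) (i : Fin 2) : |ξ i| ≤ ‖ξ‖ := by
  have := PiLp.norm_apply_le ξ i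
  simpa using this

lemma eLp_two_sq (f : E2 → ℝ) : eLpNorm f 2 volume ^ 2 = ∫⁻ ξ, ENNReal.ofReal (f ξ ^ 2) := by
  have h := eLpNorm_nnreal_pow_eq_lintegral (f := f) (μ := volume) (p := 2) (by norm_num)
  have h2 : eLpNorm f 2 volume ^ 2 = eLpNorm f ((2 : NNReal) : ℝ≥0∞) volume ^ ((2 : NNReal) : ℝ) := by
    norm_num
  rw [h2, h]
  congr 1; funext ξ
  rw [Real.enorm_eq_ofReal_abs, ← sq_abs, ENNReal.ofReal_pow (abs_nonneg _)]
  norm_num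

lemma jap_sq (x r : ℝ) : (jap x ^ r) ^ 2 = (1 + x ^ 2) ^ r := by
  rw [jap, ← Real.rpow_natCast, ← Real.rpow_mul (by positivity), ← Real.rpow_mul (by positivity)]
  congr 1; push_cast; ring

lemma wgt_meas (r a : ℝ) {f : E2 → ℂ} (hf : Measurable f) :
    Measurable fun ξ => ENNReal.ofReal (wgt r a ξ * ‖f ξ‖ ^ 2) :=
  ((wgt_cont r a).measurable.mul (hf.norm.pow_const 2)).ennreal_ofReal

lemma HsN2_sq (r : ℝ) (φ : 𝓢(E2, ℝ)) : HsN2 r (cc2 φ) ^ 2 = NN r 0 (hat φ) := by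
  rw [HsN2, eLp_two_sq, NN]
  congr 1; funext ξ
  rw [mul_pow, jap_sq, ← hat_coe, wgt]; congr 1; ring

lemma Hs_sq {μ : ℝ} (r : ℝ) (φ : 𝓢(E2, ℝ)) :
    HsN2 r (cc2 φ) ^ 2 + ENNReal.ofReal (Real.sqrt μ) * HsDN2 r (cc2 φ) ^ 2 = NN r (Real.sqrt μ) (hat φ) := by
  have hm : Measurable (hat φ) := (hat φ).continuous.measurable
  rw [HsN2_sq, HsDN2, eLp_two_sq, NN, NN, ← lintegral_const_mul' _ _ ENNReal.ofReal_ne_top,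
    ← lintegral_add_left (wgt_meas r 0 hm)]
  congr 1; funext ξ
  rw [← ENNReal.ofReal_mul (Real.sqrt_nonneg _), ← ENNReal.ofReal_add
    (mul_nonneg (wgt_pos le_rfl _).le (by positivity)) (by positivity)]
  congr 1
  rw [mul_pow, mul_pow, jap_sq, ← hat_coe, wgt, wgt, ← Real.rpow_natCast (‖ξ‖ ^ ((1:ℝ) / 2)), ← Real.rpow_mul (norm_nonneg _)]
  norm_num
  ring

lemma Vnorm_sq (μ r : ℝ) (η v₁ v₂ : 𝓢(E2, ℝ)) :
    Vnorm μ r η v₁ v₂ ^ 2 = NN r 0 (hat η) + NN r (Real.sqrt μ) (hat v₁) + NN r (Real.sqrt μ) (hat v₂) := by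
  rw [Vnorm, ← ENNReal.rpow_natCast, ← ENNReal.rpow_mul, ← Hs_sq, ← Hs_sq, ← HsN2_sq]
  norm_num
  ring

lemma NN_mono {r a b : ℝ} (hab : a ≤ b) (f : E2 → ℂ) : NN r a f ≤ NN r b f := by
  refine lintegral_mono fun ξ => ENNReal.ofReal_le_ofReal ?_
  unfold wgt; gcongr

lemma NN_add {r a : ℝ} (ha : 0 ≤ a) {f g : E2 → ℂ} (hf : Measurable f) :
    NN r a (fun ξ => f ξ + g ξ) ≤ 2 * (NN r a f + NN r a g) := by
  rw [NN, NN, NN, ← lintegral_add_left (wgt_meas r a hf), ← lintegral_const_mul' _ _ (by norm_num)]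
  refine lintegral_mono fun ξ => ?_
  have hw := wgt_pos (r := r) ha ξ
  rw [← ENNReal.ofReal_add (by positivity) (by positivity),
    show (2 : ℝ≥0∞) = ENNReal.ofReal 2 by norm_num, ← ENNReal.ofReal_mul (by norm_num)]
  apply ENNReal.ofReal_le_ofReal
  have h := norm_add_le (f ξ) (g ξ)
  have h2 : ‖f ξ + g ξ‖ ^ 2 ≤ 2 * (‖f ξ‖ ^ 2 + ‖g ξ‖ ^ 2) := by
    nlinarith [norm_nonneg (f ξ + g ξ), sq_nonneg (‖f ξ‖ - ‖g ξ‖), norm_nonneg (f ξ), norm_nonneg (g ξ)]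
  nlinarith [mul_le_mul_of_nonneg_left h2 hw.le]

/-- scalar potential part of the velocity -/
def dd (e₁ e₂ : ℂ) (ξ : E2) : ℂ := ((ξ 0 : ℂ) * e₁ + (ξ 1 : ℂ) * e₂) / (‖ξ‖ : ℂ)

/-- diagonal variable -/
def uu (μ σ : ℝ) (h e₁ e₂ : ℂ) (ξ : E2) : ℂ := h + (σ : ℂ) * ((tau μ ξ)⁻¹ : ℝ) * dd e₁ e₂ ξ

/-- nonlinear forcing -/
def FF (μ σ ε : ℝ) (q₁ q₂ R : ℂ) (ξ : E2) : ℂ :=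
  -(2 * Real.pi * Complex.I * ε) * (((ξ 0 : ℂ) * q₁ + (ξ 1 : ℂ) * q₂) + (σ / 2 : ℂ) * ((tau μ ξ)⁻¹ : ℝ) * ‖ξ‖ * R)

lemma div_norm_le (e₁ e₂ : ℂ) (ξ : E2) : ‖(ξ 0 : ℂ) * e₁ + (ξ 1 : ℂ) * e₂‖ ≤ ‖ξ‖ * (‖e₁‖ + ‖e₂‖) := by
  refine (norm_add_le _ _).trans ?_
  rw [norm_mul, norm_mul, Complex.norm_real, Complex.norm_real, mul_add]
  gcongr <;> exact coord_le ξ _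

lemma dd_norm_le (e₁ e₂ : ℂ) (ξ : E2) : ‖dd e₁ e₂ ξ‖ ≤ ‖e₁‖ + ‖e₂‖ := by
  rw [dd, norm_div, Complex.norm_real, norm_norm]
  exact div_le_of_le_mul₀ (norm_nonneg _) (by positivity) (by rw [mul_comm _ ‖ξ‖]; exact div_norm_le _ _ _)

lemma uu_norm_le {μ σ : ℝ} (hμ : 0 < μ) (hσ : |σ| = 1) (h e₁ e₂ : ℂ) (ξ : E2) :
    ‖uu μ σ h e₁ e₂ ξ‖ ≤ ‖h‖ + (tau μ ξ)⁻¹ * (‖e₁‖ + ‖e₂‖) := by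
  have ht := tau_pos hμ ξ
  refine (norm_add_le _ _).trans ?_
  rw [norm_mul, norm_mul, Complex.norm_real, Complex.norm_real, Real.norm_eq_abs σ, hσ, one_mul,
    Real.norm_of_nonneg (by positivity)]
  gcongr; exact dd_norm_le _ _ _

lemma FF_norm_le {μ σ ε : ℝ} (hμ : 0 < μ) (hε : 0 < ε) (hσ : |σ| = 1) (q₁ q₂ R : ℂ) (ξ : E2) :
    ‖FF μ σ ε q₁ q₂ R ξ‖ ≤ 2 * Real.pi * ε * ‖ξ‖ * (‖q₁‖ + ‖q₂‖ + (tau μ ξ)⁻¹ * ‖R‖) := by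
  have ht := tau_pos hμ ξ
  have hp := Real.pi_pos
  have e1 : ‖-(2 * Real.pi * Complex.I * ε : ℂ)‖ = 2 * Real.pi * ε := by
    rw [norm_neg, norm_mul, norm_mul, norm_mul, Complex.norm_real, Complex.norm_real, Complex.norm_I,
      Real.norm_of_nonneg hp.le, Real.norm_of_nonneg hε.le]
    norm_num
  have e2 : ‖(σ / 2 : ℂ) * ((tau μ ξ)⁻¹ : ℝ) * ‖ξ‖ * R‖ ≤ ‖ξ‖ * ((tau μ ξ)⁻¹ * ‖R‖) := by
    rw [norm_mul, norm_mul, norm_mul, norm_div, Complex.norm_real, Complex.norm_real, Complex.norm_real, norm_norm,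
      Real.norm_eq_abs σ, hσ, Real.norm_of_nonneg (by positivity : 0 ≤ (tau μ ξ)⁻¹)]
    have : 0 ≤ ‖ξ‖ * ((tau μ ξ)⁻¹ * ‖R‖) := by positivity
    norm_num
    nlinarith
  rw [FF, norm_mul, e1, mul_assoc (2 * Real.pi * ε)]
  gcongr
  refine (norm_add_le _ _).trans ?_
  have := div_norm_le q₁ q₂ ξ
  rw [mul_add ‖ξ‖]; linarith

lemma uu_int {μ σ r : ℝ} (hμ : 0 < μ) (hσ : |σ| = 1) {h e₁ e₂ : E2 → ℂ} (hh : Measurable h) (h1 : Measurable e₁) :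
    ∫⁻ ξ, ENNReal.ofReal ((1 + ‖ξ‖ ^ 2) ^ r * ‖uu μ σ (h ξ) (e₁ ξ) (e₂ ξ) ξ‖ ^ 2) ≤
      4 * (NN r 0 h + NN r (Real.sqrt μ) e₁ + NN r (Real.sqrt μ) e₂) := by
  rw [NN, NN, NN, ← lintegral_add_left (wgt_meas r _ hh),
    ← lintegral_add_left ((wgt_meas r _ hh).fun_add (wgt_meas r _ h1)), ← lintegral_const_mul' _ _ (by norm_num)]
  refine lintegral_mono fun ξ => ?_
  have hw0 := wgt_pos (r := r) le_rfl ξ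
  have hw := wgt_pos (r := r) (Real.sqrt_nonneg μ) ξ
  rw [← ENNReal.ofReal_add (by positivity) (by positivity), ← ENNReal.ofReal_add (by positivity) (by positivity),
    show (4 : ℝ≥0∞) = ENNReal.ofReal 4 by norm_num, ← ENNReal.ofReal_mul (by norm_num)]
  apply ENNReal.ofReal_le_ofReal
  have hu := uu_norm_le hμ hσ (h ξ) (e₁ ξ) (e₂ ξ) ξ
  have ht := tau_inv_sq hμ ξ
  set τ := (tau μ ξ)⁻¹
  set x := ‖h ξ‖
  set y := ‖e₁ ξ‖
  set z := ‖e₂ ξ‖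
  have h2 : ‖uu μ σ (h ξ) (e₁ ξ) (e₂ ξ) ξ‖ ^ 2 ≤ 4 * (x ^ 2 + (1 + Real.sqrt μ * ‖ξ‖) * y ^ 2 + (1 + Real.sqrt μ * ‖ξ‖) * z ^ 2) := by
    calc _ ≤ (x + τ * (y + z)) ^ 2 := by gcongr
      _ ≤ 2 * x ^ 2 + τ ^ 2 * (4 * y ^ 2 + 4 * z ^ 2) := by
        nlinarith [sq_nonneg (x - τ * (y + z)), mul_nonneg (sq_nonneg τ) (sq_nonneg (y - z))]
      _ ≤ 2 * x ^ 2 + (1 + Real.sqrt μ * ‖ξ‖) * (4 * y ^ 2 + 4 * z ^ 2) := by gcongr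
      _ ≤ _ := by nlinarith [sq_nonneg x]
  unfold wgt
  calc _ ≤ (1 + ‖ξ‖ ^ 2) ^ r * _ := mul_le_mul_of_nonneg_left h2 (by positivity)
    _ = _ := by ring

lemma FF_int {μ σ ε r : ℝ} (hμ : 0 < μ) (hε : 0 < ε) (hσ : |σ| = 1) {q₁ q₂ R : E2 → ℂ} (hh : Measurable q₁) (h1 : Measurable q₂) :
    ∫⁻ ξ, ENNReal.ofReal ((1 + ‖ξ‖ ^ 2) ^ (r - 1) * ‖FF μ σ ε (q₁ ξ) (q₂ ξ) (R ξ) ξ‖ ^ 2) ≤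
      ENNReal.ofReal (12 * Real.pi ^ 2 * ε ^ 2) * (NN r 0 q₁ + NN r 0 q₂ + NN r (Real.sqrt μ) R) := by
  rw [NN, NN, NN, ← lintegral_add_left (wgt_meas r _ hh),
    ← lintegral_add_left ((wgt_meas r _ hh).fun_add (wgt_meas r _ h1)), ← lintegral_const_mul' _ _ ENNReal.ofReal_ne_top]
  refine lintegral_mono fun ξ => ?_
  have hw0 := wgt_pos (r := r) le_rfl ξ
  have hw := wgt_pos (r := r) (Real.sqrt_nonneg μ) ξ
  rw [← ENNReal.ofReal_add (by positivity) (by positivity), ← ENNReal.ofReal_add (by positivity) (by positivity),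
    ← ENNReal.ofReal_mul (by positivity)]
  apply ENNReal.ofReal_le_ofReal
  have hu := FF_norm_le hμ hε hσ (q₁ ξ) (q₂ ξ) (R ξ) ξ
  have ht := tau_inv_sq hμ ξ
  have htp := tau_pos hμ ξ
  have hp := Real.pi_pos
  set τ := (tau μ ξ)⁻¹
  set x := ‖q₁ ξ‖
  set y := ‖q₂ ξ‖
  set z := ‖R ξ‖
  have h2 : ‖FF μ σ ε (q₁ ξ) (q₂ ξ) (R ξ) ξ‖ ^ 2 ≤ 12 * Real.pi ^ 2 * ε ^ 2 * ‖ξ‖ ^ 2 * (x ^ 2 + y ^ 2 + (1 + Real.sqrt μ * ‖ξ‖) * z ^ 2) := by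
    calc _ ≤ (2 * Real.pi * ε * ‖ξ‖ * (x + y + τ * z)) ^ 2 := by gcongr
      _ = 4 * Real.pi ^ 2 * ε ^ 2 * ‖ξ‖ ^ 2 * (x + y + τ * z) ^ 2 := by ring
      _ ≤ 4 * Real.pi ^ 2 * ε ^ 2 * ‖ξ‖ ^ 2 * (3 * (x ^ 2 + y ^ 2 + (τ * z) ^ 2)) := by
        gcongr
        nlinarith [sq_nonneg (x - y), sq_nonneg (x - τ * z), sq_nonneg (y - τ * z)]
      _ = 12 * Real.pi ^ 2 * ε ^ 2 * ‖ξ‖ ^ 2 * (x ^ 2 + y ^ 2 + τ ^ 2 * z ^ 2) := by ring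
      _ ≤ _ := by gcongr
  have h3 : (1 + ‖ξ‖ ^ 2) ^ (r - 1) * ‖ξ‖ ^ 2 ≤ (1 + ‖ξ‖ ^ 2) ^ r := by
    have : (1 + ‖ξ‖ ^ 2) ^ r = (1 + ‖ξ‖ ^ 2) ^ (r - 1) * (1 + ‖ξ‖ ^ 2) := by
      rw [Real.rpow_sub_one (by positivity)]; field_simp
    rw [this]; gcongr; linarith
  unfold wgt
  calc _ ≤ (1 + ‖ξ‖ ^ 2) ^ (r - 1) * _ := mul_le_mul_of_nonneg_left h2 (by positivity)
    _ = 12 * Real.pi ^ 2 * ε ^ 2 * ((1 + ‖ξ‖ ^ 2) ^ (r - 1) * ‖ξ‖ ^ 2) * (x ^ 2 + y ^ 2 + (1 + Real.sqrt μ * ‖ξ‖) * z ^ 2) := by ring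
    _ ≤ 12 * Real.pi ^ 2 * ε ^ 2 * ((1 + ‖ξ‖ ^ 2) ^ r) * (x ^ 2 + y ^ 2 + (1 + Real.sqrt μ * ‖ξ‖) * z ^ 2) := by gcongr
    _ = _ := by ring

lemma hat_add (φ ψ : 𝓢(E2, ℝ)) : hat (φ + ψ) = hat φ + hat ψ := by
  have e : cS (φ + ψ) = cS φ + cS ψ := map_add (SchwartzMap.postcompCLM (𝕜 := ℝ) (E := E2) Complex.ofRealCLM) φ ψ
  rw [hat, e]
  exact map_add (FourierTransform.fourierCLM ℂ 𝓢(E2, ℂ)) (cS φ) (cS ψ)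

lemma nice_prod {φ ψ : ℝ → 𝓢(E2, ℝ)} (hφ : Continuous φ) (hψ : Continuous ψ) :
    Nice (fun t => hat (prodS (φ t) (ψ t))) := by
  have := (nice_hat hφ).conv (nice_hat hψ)
  have e : (fun t => (hat (prodS (φ t) (ψ t)) : E2 → ℂ)) = fun t ξ => ∫ ζ, hat (φ t) ζ * hat (ψ t) (ξ - ζ) := by
    funext t ξ; exact hat_prod _ _ _
  rw [e]; exact this

lemma fInv_add {f g : E2 → ℂ} (hf : Integrable f) (hg : Integrable g) (x : E2) :
    𝓕⁻ (fun ξ => f ξ + g ξ) x = 𝓕⁻ f x + 𝓕⁻ g x := by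
  rw [fourierInv_osc 1, fourierInv_osc 1, fourierInv_osc 1]
  have i1 : ∀ {f : E2 → ℂ}, Integrable f → Integrable fun ξ => osc 1 0 x ξ * f ξ := fun {f} hf =>
    hf.bdd_mul (c := 1) (osc_cxi 1 x).aestronglyMeasurable (Filter.Eventually.of_forall fun ξ => (osc_norm 1 0 x ξ).le)
  simp only [mul_add]
  exact integral_add (i1 hf) (i1 hg)

lemma fInv_mul (c : ℂ) (f : E2 → ℂ) (x : E2) : 𝓕⁻ (fun ξ => c * f ξ) x = c * 𝓕⁻ f x := by
  rw [fourierInv_osc 1, fourierInv_osc 1, ← integral_const_mul]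
  simp only [mul_left_comm]

/-- derivative symbol -/
def mi (i : Fin 2) (ξ : E2) : ℂ := 2 * Real.pi * Complex.I * (ξ i : ℂ)

lemma mi_cont (i : Fin 2) : Continuous (mi i) := by unfold mi; fun_prop

lemma mi_norm (i : Fin 2) (ξ : E2) : ‖mi i ξ‖ ≤ 2 * Real.pi * ‖ξ‖ := by
  rw [mi, norm_mul, norm_mul, norm_mul, Complex.norm_real, Complex.norm_real, Complex.norm_I,
    Real.norm_of_nonneg Real.pi_pos.le]
  have := coord_le ξ i
  have hp := Real.pi_pos
  norm_num
  gcongr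

lemma mi_norm' (i : Fin 2) (ξ : E2) : ‖mi i ξ‖ ≤ 2 * Real.pi * (1 + ‖ξ‖) := by
  refine (mi_norm i ξ).trans ?_
  have hp := Real.pi_pos
  gcongr; linarith

lemma Nice.mi {g : ℝ → E2 → ℂ} (hg : Nice g) (i : Fin 2) : Nice fun t ξ => _root_.mi i ξ * g t ξ :=
  hg.mulm (mi_cont i) (mi_norm' i)

lemma Nice.const {g : ℝ → E2 → ℂ} (hg : Nice g) (c : ℂ) : Nice fun t ξ => c * g t ξ :=
  hg.mulm continuous_const (Cm := ‖c‖) fun ξ => by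
    have := mul_nonneg (norm_nonneg c) (norm_nonneg ξ); linarith

lemma Nice.Ts {g : ℝ → E2 → ℂ} (hg : Nice g) {μ : ℝ} (hμ : 0 < μ) : Nice fun t ξ => ((Tsymb μ ‖ξ‖ : ℝ) : ℂ) * g t ξ :=
  hg.mulm (Complex.continuous_ofReal.comp (Ts_cont hμ)) (Cm := 1) fun ξ => by
    rw [Complex.norm_real, Real.norm_of_nonneg (Ts_facts hμ ξ).1.le]
    have := (Ts_facts hμ ξ).2.1
    linarith [norm_nonneg ξ]

lemma pd_inv' (i : Fin 2) (φ : 𝓢(E2, ℝ)) (x : E2) : ((pd i φ x : ℝ) : ℂ) = 𝓕⁻ (fun ξ : E2 => mi i ξ * hat φ ξ) x :=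
  pd_inv i φ x

lemma evol_eta {η v₁ v₂ : ℝ → 𝓢(E2, ℝ)} {ε T : ℝ} (hη : Continuous η) (h1 : Continuous v₁) (h2 : Continuous v₂)
    (hd : ∀ t ∈ Set.Icc (0 : ℝ) T, ∀ x : E2, HasDerivAt (fun τ => η τ x)
      (-(pd 0 (⇑(v₁ t)) x + pd 1 (⇑(v₂ t)) x + ε * (pd 0 (fun y => η t y * v₁ t y) x +
        pd 1 (fun y => η t y * v₂ t y) x))) t) :
    ∀ a ∈ Set.Icc 0 T, ∀ t ∈ Set.Icc 0 T, ∀ ξ, hat (η t) ξ = hat (η a) ξ + ∫ s in a..t,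
      -((mi 0 ξ * hat (v₁ s) ξ + mi 1 ξ * hat (v₂ s) ξ) + (ε : ℂ) * (mi 0 ξ * hat (prodS (η s) (v₁ s)) ξ +
        mi 1 ξ * hat (prodS (η s) (v₂ s)) ξ)) := by
  have n1 := (nice_hat h1).mi 0
  have n2 := (nice_hat h2).mi 1
  have n3 := (nice_prod hη h1).mi 0
  have n4 := (nice_prod hη h2).mi 1
  refine evol (c := fun s ξ => (mi 0 ξ * hat (v₁ s) ξ + mi 1 ξ * hat (v₂ s) ξ) + (ε : ℂ) * (mi 0 ξ * hat (prodS (η s) (v₁ s)) ξ +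
        mi 1 ξ * hat (prodS (η s) (v₂ s)) ξ)) ((n1.add n2).add ((n3.add n4).const ε)) fun t ht x => ?_
  have := (hd t ht x).ofReal_comp
  refine this.congr_deriv ?_
  rw [fInv_add ((n1.add n2).int t) (((n3.add n4).const ε).int t), fInv_add (n1.int t) (n2.int t), fInv_mul,
    fInv_add (n3.int t) (n4.int t), ← pd_inv', ← pd_inv', ← pd_inv', ← pd_inv']
  push_cast
  rfl

lemma evol_v {η v₁ v₂ w : ℝ → 𝓢(E2, ℝ)} {ε μ T : ℝ} (hμ : 0 < μ) (hη : Continuous η) (h1 : Continuous v₁) (h2 : Continuous v₂)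
    (i : Fin 2)
    (hd : ∀ t ∈ Set.Icc (0 : ℝ) T, ∀ x : E2, HasDerivAt (fun τ => ((w τ x : ℝ) : ℂ))
      (-(Tmul2 μ (cc2 (pd i (⇑(η t)))) x + (ε / 2 : ℂ) *
        ((pd i (fun y => (v₁ t y) ^ 2 + (v₂ t y) ^ 2) x : ℝ) : ℂ))) t) :
    ∀ a ∈ Set.Icc 0 T, ∀ t ∈ Set.Icc 0 T, ∀ ξ, hat (w t) ξ = hat (w a) ξ + ∫ s in a..t,
      -(((Tsymb μ ‖ξ‖ : ℝ) : ℂ) * (mi i ξ * hat (η s) ξ) + (ε / 2 : ℂ) * (mi i ξ * (hat (prodS (v₁ s) (v₁ s)) ξ +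
        hat (prodS (v₂ s) (v₂ s)) ξ))) := by
  have n1 := ((nice_hat hη).mi i).Ts hμ
  have n2 := ((nice_prod h1 h1).add (nice_prod h2 h2)).mi i
  refine evol (c := fun s ξ => ((Tsymb μ ‖ξ‖ : ℝ) : ℂ) * (mi i ξ * hat (η s) ξ) + (ε / 2 : ℂ) * (mi i ξ * (hat (prodS (v₁ s) (v₁ s)) ξ +
        hat (prodS (v₂ s) (v₂ s)) ξ))) (n1.add (n2.const _)) fun t ht x => ?_
  refine (hd t ht x).congr_deriv ?_
  rw [fInv_add (n1.int t) ((n2.const _).int t), fInv_mul]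
  have e1 : Tmul2 μ (cc2 (pd i (⇑(η t)))) x = 𝓕⁻ (fun ξ => ((Tsymb μ ‖ξ‖ : ℝ) : ℂ) * (mi i ξ * hat (η t) ξ)) x := by
    rw [Tmul2, fmul2]; simp only [pd_hat]; rfl
  have e2 : (fun y => (v₁ t y) ^ 2 + (v₂ t y) ^ 2) = ⇑(prodS (v₁ t) (v₁ t) + prodS (v₂ t) (v₂ t)) := by
    funext y; rw [add_apply, prodS_apply, prodS_apply, sq, sq]
  rw [e1, e2, pd_inv', hat_add]
  rfl

lemma curl_free {v₁ v₂ : 𝓢(E2, ℝ)} (h : ∀ x, pd 1 v₁ x = pd 0 v₂ x) (ξ : E2) :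
    (ξ 1 : ℂ) * hat v₁ ξ = (ξ 0 : ℂ) * hat v₂ ξ := by
  have e : cc2 (pd 1 v₁) = cc2 (pd 0 v₂) := by funext x; rw [cc2, cc2, h x]
  have h2 := pd_hat 1 v₁ ξ
  rw [e, pd_hat 0 v₂ ξ] at h2
  have hp : (2 * Real.pi * Complex.I : ℂ) ≠ 0 := by simp [Real.pi_ne_zero]
  apply mul_left_cancel₀ hp
  linear_combination -h2

lemma norm_sq_E2 (ξ : E2) : ((ξ 0 : ℂ)) ^ 2 + (ξ 1 : ℂ) ^ 2 = (‖ξ‖ : ℂ) ^ 2 := by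
  have := EuclideanSpace.real_norm_sq_eq ξ
  rw [Fin.sum_univ_two] at this
  exact_mod_cast this.symm

lemma v_eq {v₁ v₂ : 𝓢(E2, ℝ)} (h : ∀ x, pd 1 v₁ x = pd 0 v₂ x) {ξ : E2} (hξ : ξ ≠ 0) :
    hat v₁ ξ = (ξ 0 : ℂ) / (‖ξ‖ : ℂ) * dd (hat v₁ ξ) (hat v₂ ξ) ξ ∧
    hat v₂ ξ = (ξ 1 : ℂ) / (‖ξ‖ : ℂ) * dd (hat v₁ ξ) (hat v₂ ξ) ξ := by
  have hn : (‖ξ‖ : ℂ) ≠ 0 := by exact_mod_cast norm_ne_zero_iff.2 hξ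
  have hc := curl_free h ξ
  have hs := norm_sq_E2 ξ
  unfold dd
  constructor
  · field_simp
    linear_combination (-hat v₁ ξ) * hs + (ξ 1 : ℂ) * hc
  · field_simp
    linear_combination (-hat v₂ ξ) * hs - (ξ 0 : ℂ) * hc

lemma duh_u {η v₁ v₂ : ℝ → 𝓢(E2, ℝ)} {ε μ T σ : ℝ} (hμ : 0 < μ) (hσ : |σ| = 1) (hη : Continuous η) (h1 : Continuous v₁) (h2 : Continuous v₂)
    (hd : ∀ t ∈ Set.Icc (0 : ℝ) T, ∀ x : E2, HasDerivAt (fun τ => η τ x)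
      (-(pd 0 (⇑(v₁ t)) x + pd 1 (⇑(v₂ t)) x + ε * (pd 0 (fun y => η t y * v₁ t y) x +
        pd 1 (fun y => η t y * v₂ t y) x))) t)
    (hd1 : ∀ t ∈ Set.Icc (0 : ℝ) T, ∀ x : E2, HasDerivAt (fun τ => ((v₁ τ x : ℝ) : ℂ))
      (-(Tmul2 μ (cc2 (pd 0 (⇑(η t)))) x + (ε / 2 : ℂ) *
        ((pd 0 (fun y => (v₁ t y) ^ 2 + (v₂ t y) ^ 2) x : ℝ) : ℂ))) t)
    (hd2 : ∀ t ∈ Set.Icc (0 : ℝ) T, ∀ x : E2, HasDerivAt (fun τ => ((v₂ τ x : ℝ) : ℂ))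
      (-(Tmul2 μ (cc2 (pd 1 (⇑(η t)))) x + (ε / 2 : ℂ) *
        ((pd 1 (fun y => (v₁ t y) ^ 2 + (v₂ t y) ^ 2) x : ℝ) : ℂ))) t) :
    ∀ a ∈ Set.Icc 0 T, ∀ t ∈ Set.Icc 0 T, ∀ ξ, ξ ≠ 0 →
      phs μ σ t ξ * uu μ σ (hat (η t) ξ) (hat (v₁ t) ξ) (hat (v₂ t) ξ) ξ =
      phs μ σ a ξ * uu μ σ (hat (η a) ξ) (hat (v₁ a) ξ) (hat (v₂ a) ξ) ξ +
      ∫ s in a..t, phs μ σ s ξ * FF μ σ ε (hat (prodS (η s) (v₁ s)) ξ) (hat (prodS (η s) (v₂ s)) ξ)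
        (hat (prodS (v₁ s) (v₁ s)) ξ + hat (prodS (v₂ s) (v₂ s)) ξ) ξ := by
  intro a ha t ht ξ hξ
  have ce := (nice_hat hη).contt ξ
  have c1 := (nice_hat h1).contt ξ
  have c2 := (nice_hat h2).contt ξ
  have cq1 := (nice_prod hη h1).contt ξ
  have cq2 := (nice_prod hη h2).contt ξ
  have cr1 := (nice_prod h1 h1).contt ξ
  have cr2 := (nice_prod h2 h2).contt ξ
  have hn : (‖ξ‖ : ℂ) ≠ 0 := by exact_mod_cast norm_ne_zero_iff.2 hξ
  have ht0 : (tau μ ξ : ℂ) ≠ 0 := by exact_mod_cast (tau_pos hμ ξ).ne'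
  have hT : ((Tsymb μ ‖ξ‖ : ℝ) : ℂ) = (tau μ ξ : ℂ) ^ 2 := by exact_mod_cast (tau_sq hμ ξ).symm
  have hs := norm_sq_E2 ξ
  have hs2 : (σ : ℂ) ^ 2 = 1 := by
    have : σ ^ 2 = 1 := by rw [← sq_abs, hσ, one_pow]
    exact_mod_cast this
  have cU : Continuous fun s => uu μ σ (hat (η s) ξ) (hat (v₁ s) ξ) (hat (v₂ s) ξ) ξ := by
    unfold uu dd; fun_prop
  have cF : Continuous fun s => FF μ σ ε (hat (prodS (η s) (v₁ s)) ξ) (hat (prodS (η s) (v₂ s)) ξ)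
        (hat (prodS (v₁ s) (v₁ s)) ξ + hat (prodS (v₂ s) (v₂ s)) ξ) ξ := by
    unfold FF; fun_prop
  have key := ode_duh (T := T) (lam := 2 * Real.pi * (σ * omg μ ‖ξ‖)) cU cF (by
    intro a ha t ht
    have E0 := evol_eta hη h1 h2 hd a ha t ht ξ
    have E1 := evol_v hμ hη h1 h2 0 hd1 a ha t ht ξ
    have E2' := evol_v hμ hη h1 h2 1 hd2 a ha t ht ξ
    have i0 : Continuous fun s => -((mi 0 ξ * hat (v₁ s) ξ + mi 1 ξ * hat (v₂ s) ξ) + (ε : ℂ) * (mi 0 ξ * hat (prodS (η s) (v₁ s)) ξ +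
        mi 1 ξ * hat (prodS (η s) (v₂ s)) ξ)) := by fun_prop
    have ii : ∀ i, Continuous fun s => -(((Tsymb μ ‖ξ‖ : ℝ) : ℂ) * (mi i ξ * hat (η s) ξ) + (ε / 2 : ℂ) * (mi i ξ * (hat (prodS (v₁ s) (v₁ s)) ξ +
        hat (prodS (v₂ s) (v₂ s)) ξ))) := fun i => by fun_prop
    set k : ℂ := (σ : ℂ) * ((tau μ ξ)⁻¹ : ℝ) / (‖ξ‖ : ℂ) with hk
    have hu : ∀ s, uu μ σ (hat (η s) ξ) (hat (v₁ s) ξ) (hat (v₂ s) ξ) ξ =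
        hat (η s) ξ + k * ξ 0 * hat (v₁ s) ξ + k * ξ 1 * hat (v₂ s) ξ := by
      intro s; unfold uu dd; rw [hk]; ring
    have hIntg : ∫ s in a..t, (-(Complex.I * ((2 * Real.pi * (σ * omg μ ‖ξ‖) : ℝ) : ℂ)) * uu μ σ (hat (η s) ξ) (hat (v₁ s) ξ) (hat (v₂ s) ξ) ξ +
        FF μ σ ε (hat (prodS (η s) (v₁ s)) ξ) (hat (prodS (η s) (v₂ s)) ξ)
        (hat (prodS (v₁ s) (v₁ s)) ξ + hat (prodS (v₂ s) (v₂ s)) ξ) ξ) =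
        (∫ s in a..t, -((mi 0 ξ * hat (v₁ s) ξ + mi 1 ξ * hat (v₂ s) ξ) + (ε : ℂ) * (mi 0 ξ * hat (prodS (η s) (v₁ s)) ξ +
        mi 1 ξ * hat (prodS (η s) (v₂ s)) ξ))) + k * ξ 0 * (∫ s in a..t, -(((Tsymb μ ‖ξ‖ : ℝ) : ℂ) * (mi 0 ξ * hat (η s) ξ) + (ε / 2 : ℂ) * (mi 0 ξ * (hat (prodS (v₁ s) (v₁ s)) ξ +
        hat (prodS (v₂ s) (v₂ s)) ξ)))) + k * ξ 1 * (∫ s in a..t, -(((Tsymb μ ‖ξ‖ : ℝ) : ℂ) * (mi 1 ξ * hat (η s) ξ) + (ε / 2 : ℂ) * (mi 1 ξ * (hat (prodS (v₁ s) (v₁ s)) ξ +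
        hat (prodS (v₂ s) (v₂ s)) ξ)))) := by
      rw [← intervalIntegral.integral_const_mul, ← intervalIntegral.integral_const_mul,
        ← intervalIntegral.integral_add (i0.intervalIntegrable _ _) (((ii 0).const_mul _).intervalIntegrable _ _),
        ← intervalIntegral.integral_add ((i0.fun_add ((ii 0).const_mul _)).intervalIntegrable _ _) (((ii 1).const_mul _).intervalIntegrable _ _)]
      congr 1; funext s
      rw [hT, omg_eq hμ]
      unfold uu dd FF mi
      rw [hk]
      push_cast
      linear_combination (norm := skip) (-(2 * Real.pi * Complex.I) * (ξ 0 * hat (v₁ s) ξ + ξ 1 * hat (v₂ s) ξ)) * hs2 +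
        ((2 * Real.pi * Complex.I) * σ * tau μ ξ * hat (η s) ξ / ‖ξ‖ + (2 * Real.pi * Complex.I) * ε * σ *
          (hat (prodS (v₁ s) (v₁ s)) ξ + hat (prodS (v₂ s) (v₂ s)) ξ) / (2 * tau μ ξ * ‖ξ‖)) * hs
      field_simp
      ring
    rw [hu t, hu a, hIntg, E0, E1, E2']
    ring) a ha t ht
  have hph : ∀ s, phs μ σ s ξ = Complex.exp (Complex.I * ((2 * Real.pi * (σ * omg μ ‖ξ‖) * s : ℝ) : ℂ)) := by
    intro s; rw [phs]; congr 3; ring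
  simp only [hph]
  exact key

lemma enn_sq_add (a b : ℝ≥0∞) : (a + b) ^ 2 ≤ 4 * a ^ 2 + 4 * b ^ 2 := by
  rcases le_total a b with h | h
  · calc (a + b) ^ 2 ≤ (b + b) ^ 2 := by gcongr
      _ = 4 * b ^ 2 := by ring
      _ ≤ _ := le_add_self
  · calc (a + b) ^ 2 ≤ (a + a) ^ 2 := by gcongr
      _ = 4 * a ^ 2 := by ring
      _ ≤ _ := le_self_add

lemma oscint_meas (μ : ℝ) {y : ℝ → E2} (hy : Measurable y) {w : ℝ → E2 → ℂ} (hw : Measurable (Function.uncurry w)) :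
    Measurable fun t => ∫ ξ, osc μ 0 (y t) ξ * w t ξ := by
  have : StronglyMeasurable (Function.uncurry fun t ξ => osc μ 0 (y t) ξ * w t ξ) :=
    ((osc_meas μ measurable_const (hy.comp measurable_fst) measurable_snd).mul hw).stronglyMeasurable
  exact this.integral_prod_right.measurable

lemma Nice.finv_cont {W : ℝ → E2 → ℂ} (hW : Nice W) (x : E2) : Continuous fun t => 𝓕⁻ (W t) x := by
  simp only [fourierInv_osc 1]
  rw [continuous_iff_continuousAt]
  intro t₀
  obtain ⟨C, hC, h⟩ := hW.bd3 (|t₀| + 1)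
  have hev : ∀ᶠ t : ℝ in nhds t₀, |t| ≤ |t₀| + 1 := by
    have := continuous_abs.continuousAt (x := t₀)
    exact (this.eventually_lt_const (by simp : |t₀| < |t₀| + 1)).mono fun _ h => h.le
  refine continuousAt_of_dominated (bound := fun ξ => C * ((1 + ‖ξ‖) ^ 3)⁻¹) ?_ ?_ (int3.const_mul C) ?_
  · exact Filter.Eventually.of_forall fun t => ((osc_cxi 1 x).mul (hW.cont t)).aestronglyMeasurable
  · filter_upwards [hev] with t ht
    filter_upwards with ξ
    rw [norm_mul, osc_norm, one_mul]
    exact h t ht ξ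
  · filter_upwards with ξ
    exact ((hW.contt ξ).const_mul _).continuousAt

lemma Nice.sup_meas {W : ℝ → E2 → ℂ} (hW : Nice W) : Measurable fun t => ⨆ x, ‖𝓕⁻ (W t) x‖ₑ := by
  apply LowerSemicontinuous.measurable
  apply lowerSemicontinuous_iSup
  intro x
  exact (hW.finv_cont x).enorm.lowerSemicontinuous

lemma comp_bound {μ T : ℝ} {X : ℝ≥0∞} {U : ℝ → ℝ → E2 → ℂ} (hU : ∀ σ, Measurable (Function.uncurry (U σ)))
    (hcore : ∀ σ, |σ| = 1 → ∀ y : ℝ → E2, Measurable y → ∀ m : E2 → ℂ, Measurable m → (∀ ξ, ‖m ξ‖ ≤ 4 * ‖ξ‖) →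
      ∫⁻ t in Set.Ioc 0 T, ‖∫ ξ, osc μ 0 (y t) ξ * (m ξ * U σ t ξ)‖ₑ ^ 2 ≤ X)
    (hIntg : ∀ σ, |σ| = 1 → ∀ t, ∀ m : E2 → ℂ, Measurable m → (∀ ξ, ‖m ξ‖ ≤ 4 * ‖ξ‖) → Integrable fun ξ => m ξ * U σ t ξ)
    {W : ℝ → E2 → ℂ} (hW : Nice W) {mp mm : E2 → ℂ} (hmp : Measurable mp) (hmm : Measurable mm)
    (hbp : ∀ ξ, ‖mp ξ‖ ≤ 4 * ‖ξ‖) (hbm : ∀ ξ, ‖mm ξ‖ ≤ 4 * ‖ξ‖)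
    (hWe : ∀ t ∈ Set.Icc 0 T, ∀ ξ, ξ ≠ 0 → W t ξ = mp ξ * U 1 t ξ + mm ξ * U (-1) t ξ) :
    ∫⁻ t in Set.Ioc 0 T, (⨆ x, ‖𝓕⁻ (W t) x‖ₑ) ^ 2 ≤ 8 * X := by
  simp only [fourierInv_osc μ]
  refine osc_sup hW.1.measurable fun y hy => ?_
  have s1 : |(1 : ℝ)| = 1 := by norm_num
  have s2 : |(-1 : ℝ)| = 1 := by norm_num
  have mU : ∀ σ, ∀ m : E2 → ℂ, Measurable m → Measurable (Function.uncurry fun t ξ => m ξ * U σ t ξ) :=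
    fun σ m hm => (hm.comp measurable_snd).mul (hU σ)
  have mI : ∀ σ, ∀ m : E2 → ℂ, Measurable m → Measurable fun t => ‖∫ ξ, osc μ 0 (y t) ξ * (m ξ * U σ t ξ)‖ₑ ^ 2 :=
    fun σ m hm => (oscint_meas μ hy (mU σ m hm)).enorm.pow_const 2
  have hle : ∀ t ∈ Set.Ioc 0 T, ‖∫ ξ, osc μ 0 (y t) ξ * W t ξ‖ₑ ^ 2 ≤
      4 * ‖∫ ξ, osc μ 0 (y t) ξ * (mp ξ * U 1 t ξ)‖ₑ ^ 2 + 4 * ‖∫ ξ, osc μ 0 (y t) ξ * (mm ξ * U (-1) t ξ)‖ₑ ^ 2 := by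
    intro t ht
    have i1 : ∀ {f : E2 → ℂ}, Integrable f → Integrable fun ξ => osc μ 0 (y t) ξ * f ξ := fun {f} hf =>
      hf.bdd_mul (c := 1) (osc_cxi μ (y t)).aestronglyMeasurable (Filter.Eventually.of_forall fun ξ => (osc_norm μ 0 (y t) ξ).le)
    have e : ∫ ξ, osc μ 0 (y t) ξ * W t ξ = (∫ ξ, osc μ 0 (y t) ξ * (mp ξ * U 1 t ξ)) +
        ∫ ξ, osc μ 0 (y t) ξ * (mm ξ * U (-1) t ξ) := by
      rw [← integral_add (i1 (hIntg 1 s1 t mp hmp hbp)) (i1 (hIntg (-1) s2 t mm hmm hbm))]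
      apply integral_congr_ae
      filter_upwards [Measure.ae_ne volume (0 : E2)] with ξ hξ
      rw [hWe t (Set.Ioc_subset_Icc_self ht) ξ hξ]; ring
    rw [e]
    exact (pow_le_pow_left' (enorm_add_le _ _) 2).trans (enn_sq_add _ _)
  refine (setLIntegral_mono' measurableSet_Ioc hle).trans ?_
  rw [lintegral_add_left ((mI 1 mp hmp).const_mul 4), lintegral_const_mul _ (mI 1 mp hmp), lintegral_const_mul _ (mI (-1) mm hmm)]
  calc _ ≤ 4 * X + 4 * X := by gcongr <;> [exact hcore 1 s1 y hy mp hmp hbp; exact hcore (-1) s2 y hy mm hmm hbm]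
    _ = 8 * X := by ring

lemma fderiv_le (φ : E2 → ℝ) (x : E2) : ‖fderiv ℝ φ x‖ₑ ≤ ‖((pd 0 φ x : ℝ) : ℂ)‖ₑ + ‖((pd 1 φ x : ℝ) : ℂ)‖ₑ := by
  have h : ‖fderiv ℝ φ x‖ ≤ ‖pd 0 φ x‖ + ‖pd 1 φ x‖ := by
    refine ContinuousLinearMap.opNorm_le_bound _ (by positivity) fun v => ?_
    have e : v = v 0 • (EuclideanSpace.single 0 1 : E2) + v 1 • (EuclideanSpace.single 1 1 : E2) := by
      ext i; fin_cases i <;> simp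
    have e2 : fderiv ℝ φ x v = v 0 * pd 0 φ x + v 1 * pd 1 φ x := by
      conv_lhs => rw [e]
      rw [map_add, map_smul, map_smul]; rfl
    rw [e2]
    refine (norm_add_le _ _).trans ?_
    rw [norm_mul, norm_mul, add_mul, mul_comm, mul_comm (‖v 1‖)]
    gcongr <;> exact coord_le v _
  rw [← ofReal_norm, ← ofReal_norm, ← ofReal_norm, Complex.norm_real, Complex.norm_real,
    ← ENNReal.ofReal_add (norm_nonneg _) (norm_nonneg _)]
  exact ENNReal.ofReal_le_ofReal h

/-- sup norm of a Fourier integral -/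
def Msup (f : E2 → ℂ) : ℝ≥0∞ := ⨆ x, ‖𝓕⁻ f x‖ₑ

lemma fderiv_sup (φ : 𝓢(E2, ℝ)) (x : E2) : ‖fderiv ℝ φ x‖ₑ ≤ Msup (fun ξ => mi 0 ξ * hat φ ξ) + Msup (fun ξ => mi 1 ξ * hat φ ξ) := by
  refine (fderiv_le φ x).trans ?_
  rw [pd_inv', pd_inv']
  exact add_le_add (le_iSup (fun x => ‖𝓕⁻ (fun ξ => mi 0 ξ * hat φ ξ) x‖ₑ) x) (le_iSup (fun x => ‖𝓕⁻ (fun ξ => mi 1 ξ * hat φ ξ) x‖ₑ) x)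

lemma Tinv_sup {μ : ℝ} (hμ : 0 < μ) (i : Fin 2) (φ : 𝓢(E2, ℝ)) (x : E2) : ‖Tinvhalf2 μ (cc2 (pd i φ)) x‖ₑ ≤
    Msup (fun ξ => (((tau μ ξ)⁻¹ : ℝ) : ℂ) * (mi i ξ * hat φ ξ)) := by
  have e : Tinvhalf2 μ (cc2 (pd i φ)) x = 𝓕⁻ (fun ξ => (((tau μ ξ)⁻¹ : ℝ) : ℂ) * (mi i ξ * hat φ ξ)) x := by
    rw [Tinvhalf2, fmul2]; simp only [pd_hat, Ts_rpow hμ]; rfl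
  rw [e]
  exact le_iSup (fun x => ‖𝓕⁻ (fun ξ => (((tau μ ξ)⁻¹ : ℝ) : ℂ) * (mi i ξ * hat φ ξ)) x‖ₑ) x

lemma Pfun_le {μ : ℝ} (hμ : 0 < μ) (η v₁ v₂ : 𝓢(E2, ℝ)) : ENNReal.ofReal (Pfun μ η v₁ v₂) ≤
    (∑ i : Fin 2, Msup (fun ξ => mi i ξ * hat η ξ)) +
    ((∑ i : Fin 2, Msup (fun ξ => mi i ξ * hat v₁ ξ)) + (∑ i : Fin 2, Msup (fun ξ => mi i ξ * hat v₂ ξ))) +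
    ((∑ i : Fin 2, Msup (fun ξ => (((tau μ ξ)⁻¹ : ℝ) : ℂ) * (mi i ξ * hat v₁ ξ))) +
     (∑ i : Fin 2, Msup (fun ξ => (((tau μ ξ)⁻¹ : ℝ) : ℂ) * (mi i ξ * hat v₂ ξ)))) := by
  simp only [Fin.sum_univ_two]
  rw [Pfun]
  refine (ENNReal.ofReal_add_le.trans (add_le_add (ENNReal.ofReal_add_le.trans (add_le_add ENNReal.ofReal_toReal_le
    ENNReal.ofReal_toReal_le)) ENNReal.ofReal_toReal_le)).trans ?_
  simp only [eLpNorm_exponent_top]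
  refine add_le_add (add_le_add ?_ ?_) ?_
  · refine eLpNormEssSup_le_of_ae_enorm_bound (Filter.Eventually.of_forall fun x => ?_)
    rw [enorm_norm]
    exact fderiv_sup η x
  · refine eLpNormEssSup_le_of_ae_enorm_bound (Filter.Eventually.of_forall fun x => ?_)
    refine (enorm_add_le _ _).trans ?_
    rw [enorm_norm, enorm_norm]
    exact add_le_add (fderiv_sup v₁ x) (fderiv_sup v₂ x)
  · refine eLpNormEssSup_le_of_ae_enorm_bound (Filter.Eventually.of_forall fun x => ?_)
    refine (enorm_add_le _ _).trans ((add_le_add_left ((enorm_add_le _ _).trans (add_le_add_left (enorm_add_le _ _) _)) _).trans ?_)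
    rw [enorm_norm, enorm_norm, enorm_norm, enorm_norm, add_assoc]
    exact add_le_add (add_le_add (Tinv_sup hμ 0 v₁ x) (Tinv_sup hμ 1 v₁ x)) (add_le_add (Tinv_sup hμ 0 v₂ x) (Tinv_sup hμ 1 v₂ x))

lemma abs_le_of_Icc {t T : ℝ} (ht : t ∈ Set.Icc 0 T) : |t| ≤ T := by
  rw [abs_of_nonneg ht.1]; exact ht.2

lemma dd_meas {f g : ℝ → E2 → ℂ} (hf : Measurable (Function.uncurry f)) (hg : Measurable (Function.uncurry g)) :
    Measurable fun p : ℝ × E2 => dd (f p.1 p.2) (g p.1 p.2) p.2 := by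
  unfold dd
  have c0 : Measurable fun p : ℝ × E2 => ((p.2 0 : ℝ) : ℂ) := by
    have : Continuous fun p : ℝ × E2 => ((p.2 0 : ℝ) : ℂ) := by fun_prop
    exact this.measurable
  have c1 : Measurable fun p : ℝ × E2 => ((p.2 1 : ℝ) : ℂ) := by
    have : Continuous fun p : ℝ × E2 => ((p.2 1 : ℝ) : ℂ) := by fun_prop
    exact this.measurable
  have c2 : Measurable fun p : ℝ × E2 => ((‖p.2‖ : ℝ) : ℂ) := by
    have : Continuous fun p : ℝ × E2 => ((‖p.2‖ : ℝ) : ℂ) := by fun_prop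
    exact this.measurable
  exact ((c0.mul hf).add (c1.mul hg)).div c2

lemma tauinv_meas {μ : ℝ} (hμ : 0 < μ) : Measurable fun p : ℝ × E2 => (((tau μ p.2)⁻¹ : ℝ) : ℂ) :=
  Complex.measurable_ofReal.comp ((tau_inv_cont hμ).measurable.comp measurable_snd)

lemma uu_meas {μ : ℝ} (hμ : 0 < μ) (σ : ℝ) {e f g : ℝ → E2 → ℂ} (he : Nice e) (hf : Nice f) (hg : Nice g) :
    Measurable (Function.uncurry fun t ξ => uu μ σ (e t ξ) (f t ξ) (g t ξ) ξ) := by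
  have := he.1.measurable.add (((measurable_const (a := (σ : ℂ))).mul (tauinv_meas hμ)).mul (dd_meas hf.1.measurable hg.1.measurable))
  exact this

lemma FF_meas {μ : ℝ} (hμ : 0 < μ) (σ ε : ℝ) {e f g : ℝ → E2 → ℂ} (he : Nice e) (hf : Nice f) (hg : Nice g) :
    Measurable (Function.uncurry fun t ξ => FF μ σ ε (e t ξ) (f t ξ) (g t ξ) ξ) := by
  have c0 : Measurable fun p : ℝ × E2 => ((p.2 0 : ℝ) : ℂ) := by
    have : Continuous fun p : ℝ × E2 => ((p.2 0 : ℝ) : ℂ) := by fun_prop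
    exact this.measurable
  have c1 : Measurable fun p : ℝ × E2 => ((p.2 1 : ℝ) : ℂ) := by
    have : Continuous fun p : ℝ × E2 => ((p.2 1 : ℝ) : ℂ) := by fun_prop
    exact this.measurable
  have c2 : Measurable fun p : ℝ × E2 => ((‖p.2‖ : ℝ) : ℂ) := by
    have : Continuous fun p : ℝ × E2 => ((‖p.2‖ : ℝ) : ℂ) := by fun_prop
    exact this.measurable
  have := (measurable_const (a := -(2 * Real.pi * Complex.I * ε : ℂ))).mul
    (((c0.mul he.1.measurable).add (c1.mul hf.1.measurable)).add
    ((((measurable_const (a := (σ / 2 : ℂ))).mul (tauinv_meas hμ)).mul c2).mul hg.1.measurable))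
  exact this

lemma uuFF_bdd {μ σ ε T : ℝ} (hμ : 0 < μ) (hμ1 : μ ≤ 1) (hσ : |σ| = 1) (hε : 0 < ε) {e f g q₁ q₂ R : ℝ → E2 → ℂ}
    (he : Nice e) (hf : Nice f) (hg : Nice g) (h1 : Nice q₁) (h2 : Nice q₂) (h3 : Nice R) (ρ : ℝ) :
    ∃ Mb : ℝ, ∀ t ∈ Set.Icc 0 T, ∀ ξ : E2, ‖ξ‖ ≤ ρ → ‖uu μ σ (e t ξ) (f t ξ) (g t ξ) ξ‖ ≤ Mb ∧
      ‖FF μ σ ε (q₁ t ξ) (q₂ t ξ) (R t ξ) ξ‖ ≤ Mb := by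
  obtain ⟨Ce, he0, he⟩ := he.bd0 T
  obtain ⟨Cf, hf0, hf⟩ := hf.bd0 T
  obtain ⟨Cg, hg0, hg⟩ := hg.bd0 T
  obtain ⟨C1, h10, h1⟩ := h1.bd0 T
  obtain ⟨C2, h20, h2⟩ := h2.bd0 T
  obtain ⟨C3, h30, h3⟩ := h3.bd0 T
  refine ⟨max (Ce + (1 + ρ) * (Cf + Cg)) (2 * Real.pi * ε * ρ * (C1 + C2 + (1 + ρ) * C3)), fun t ht ξ hξ => ?_⟩
  have ht' := abs_le_of_Icc ht
  have hρ : 0 ≤ ρ := (norm_nonneg _).trans hξ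
  have hp := Real.pi_pos
  have hti : (tau μ ξ)⁻¹ ≤ 1 + ρ := (tau_inv_le hμ hμ1 ξ).trans (by linarith)
  have htp := tau_pos hμ ξ
  constructor
  · refine (uu_norm_le hμ hσ _ _ _ ξ).trans (le_max_of_le_left ?_)
    exact add_le_add (he t ht' ξ) (mul_le_mul hti (add_le_add (hf t ht' ξ) (hg t ht' ξ)) (by positivity) (by positivity))
  · refine (FF_norm_le hμ hε hσ _ _ _ ξ).trans (le_max_of_le_right ?_)
    refine mul_le_mul (mul_le_mul_of_nonneg_left hξ (by positivity)) ?_ (by positivity) (by positivity)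
    exact add_le_add (add_le_add (h1 t ht' ξ) (h2 t ht' ξ)) (mul_le_mul hti (h3 t ht' ξ) (by positivity) (by positivity))

lemma Nice.lin {g : ℝ → E2 → ℂ} (hg : Nice g) : Nice fun t ξ => ((1 + ‖ξ‖ : ℝ) : ℂ) * g t ξ :=
  hg.mulm (by fun_prop) (Cm := 1) fun ξ => by
    rw [Complex.norm_real, Real.norm_of_nonneg (by positivity)]; linarith

lemma uu_integrable {μ σ : ℝ} (hμ : 0 < μ) (hμ1 : μ ≤ 1) (hσ : |σ| = 1) {e f g : ℝ → E2 → ℂ} (he : Nice e) (hf : Nice f) (hg : Nice g)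
    (t : ℝ) {m : E2 → ℂ} (hm : Measurable m) (hb : ∀ ξ, ‖m ξ‖ ≤ 4 * ‖ξ‖) :
    Integrable fun ξ => m ξ * uu μ σ (e t ξ) (f t ξ) (g t ξ) ξ := by
  have i1 := (he.lin.int t).norm
  have i2 := (hf.lin.lin.int t).norm
  have i3 := (hg.lin.lin.int t).norm
  refine (((i1.add i2).add i3).const_mul 4).mono' ?_ (Filter.Eventually.of_forall fun ξ => ?_)
  · have := (uu_meas hμ σ he hf hg).comp (measurable_prodMk_left (x := t))
    exact (hm.mul this).aestronglyMeasurable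
  · simp only [Pi.add_apply, norm_mul, Complex.norm_real]
    rw [Real.norm_of_nonneg (by positivity : 0 ≤ 1 + ‖ξ‖)]
    have h1 := uu_norm_le hμ hσ (e t ξ) (f t ξ) (g t ξ) ξ
    have h2 := tau_inv_le hμ hμ1 ξ
    have htp := tau_pos hμ ξ
    have h3 : ‖uu μ σ (e t ξ) (f t ξ) (g t ξ) ξ‖ ≤ ‖e t ξ‖ + (1 + ‖ξ‖) * (‖f t ξ‖ + ‖g t ξ‖) :=
      h1.trans (by gcongr)
    have h4 : ‖m ξ‖ ≤ 4 * (1 + ‖ξ‖) := (hb ξ).trans (by linarith)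
    calc _ ≤ (4 * (1 + ‖ξ‖)) * (‖e t ξ‖ + (1 + ‖ξ‖) * (‖f t ξ‖ + ‖g t ξ‖)) :=
          mul_le_mul h4 h3 (norm_nonneg _) (by positivity)
      _ = _ := by ring

lemma Nice.tauinv {g : ℝ → E2 → ℂ} (hg : Nice g) {μ : ℝ} (hμ : 0 < μ) (hμ1 : μ ≤ 1) :
    Nice fun t ξ => (((tau μ ξ)⁻¹ : ℝ) : ℂ) * g t ξ :=
  hg.mulm (Complex.continuous_ofReal.comp (tau_inv_cont hμ)) (Cm := 1) fun ξ => by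
    have := tau_pos hμ ξ
    rw [Complex.norm_real, Real.norm_of_nonneg (by positivity), one_mul]
    exact tau_inv_le hμ hμ1 ξ

lemma uu_sum (μ : ℝ) (h e₁ e₂ : ℂ) (ξ : E2) : h = 1 / 2 * uu μ 1 h e₁ e₂ ξ + 1 / 2 * uu μ (-1) h e₁ e₂ ξ := by
  unfold uu; push_cast; ring

lemma uu_diff {μ : ℝ} (hμ : 0 < μ) (h e₁ e₂ : ℂ) (ξ : E2) : (((tau μ ξ)⁻¹ : ℝ) : ℂ) * dd e₁ e₂ ξ =
    1 / 2 * uu μ 1 h e₁ e₂ ξ + -(1 / 2) * uu μ (-1) h e₁ e₂ ξ := by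
  unfold uu; push_cast; ring

lemma half_mi (i : Fin 2) (ξ : E2) : ‖mi i ξ‖ ≤ 8 * ‖ξ‖ :=
  (mi_norm i ξ).trans (by have := Real.pi_lt_four; gcongr; linarith)

/-- unit direction component -/
def dirc (j : Fin 2) (ξ : E2) : ℂ := (ξ j : ℂ) / (‖ξ‖ : ℂ)

lemma dirc_norm (j : Fin 2) (ξ : E2) : ‖dirc j ξ‖ ≤ 1 := by
  rw [dirc, norm_div, Complex.norm_real, Complex.norm_real, norm_norm]
  exact div_le_one_of_le₀ (coord_le ξ j) (norm_nonneg _)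

lemma dirc_meas (j : Fin 2) : Measurable (dirc j) := by
  have c1 : Continuous fun p : E2 => ((p j : ℝ) : ℂ) := by fun_prop
  have c2 : Continuous fun p : E2 => ((‖p‖ : ℝ) : ℂ) := by fun_prop
  exact c1.measurable.div c2.measurable

lemma tauC_norm {μ : ℝ} (hμ : 0 < μ) (ξ : E2) : ‖((tau μ ξ : ℝ) : ℂ)‖ ≤ 1 := by
  rw [Complex.norm_real, Real.norm_of_nonneg (tau_pos hμ ξ).le]; exact tau_le hμ ξ

lemma tauC_meas {μ : ℝ} (hμ : 0 < μ) : Measurable fun ξ => ((tau μ ξ : ℝ) : ℂ) :=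
  Complex.measurable_ofReal.comp (tau_cont hμ).measurable

lemma prod_bd {a b c : ℂ} {x : ℝ} (ha : ‖a‖ ≤ 8 * x) (hx : 0 ≤ x) (hb : ‖b‖ ≤ 1) (hc : ‖c‖ = 1 / 2) : ‖c * (a * b)‖ ≤ 4 * x := by
  rw [norm_mul, norm_mul, hc]
  have := mul_le_mul ha hb (norm_nonneg _) (by positivity)
  linarith

lemma sq_add_int {T : ℝ} {f g : ℝ → ℝ≥0∞} {A B : ℝ≥0∞} (hf : Measurable f)
    (h1 : ∫⁻ t in Set.Ioc 0 T, f t ^ 2 ≤ A) (h2 : ∫⁻ t in Set.Ioc 0 T, g t ^ 2 ≤ B) :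
    ∫⁻ t in Set.Ioc 0 T, (f t + g t) ^ 2 ≤ 4 * A + 4 * B := by
  refine (lintegral_mono fun t => enn_sq_add (f t) (g t)).trans ?_
  have hm : Measurable fun t => 4 * f t ^ 2 := (hf.pow_const 2).const_mul 4
  rw [lintegral_add_left hm, lintegral_const_mul' _ _ (by norm_num), lintegral_const_mul' _ _ (by norm_num)]
  gcongr

lemma P_bound {μ T : ℝ} (hμ : 0 < μ) (hμ1 : μ ≤ 1) {X : ℝ≥0∞} {η v₁ v₂ : ℝ → 𝓢(E2, ℝ)} (hη : Continuous η)
    (h1 : Continuous v₁) (h2 : Continuous v₂)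
    (hcurl : ∀ t ∈ Set.Icc (0 : ℝ) T, ∀ x : E2, pd 1 (⇑(v₁ t)) x = pd 0 (⇑(v₂ t)) x)
    (hcore : ∀ σ : ℝ, |σ| = 1 → ∀ y : ℝ → E2, Measurable y → ∀ m : E2 → ℂ, Measurable m → (∀ ξ, ‖m ξ‖ ≤ 4 * ‖ξ‖) →
      ∫⁻ t in Set.Ioc 0 T, ‖∫ ξ, osc μ 0 (y t) ξ * (m ξ * uu μ σ (hat (η t) ξ) (hat (v₁ t) ξ) (hat (v₂ t) ξ) ξ)‖ₑ ^ 2 ≤ X) :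
    ∫⁻ t in Set.Ioc 0 T, ENNReal.ofReal (Pfun μ (η t) (v₁ t) (v₂ t)) ^ 2 ≤ 11264 * X := by
  have ne := nice_hat hη
  have n1 := nice_hat h1
  have n2 := nice_hat h2
  have hU := fun σ => uu_meas hμ σ ne n1 n2
  have hIntg := fun σ hσ t m hm hb => uu_integrable hμ hμ1 (σ := σ) hσ ne n1 n2 t (m := m) hm hb
  have nh : ‖(1 / 2 : ℂ)‖ = 1 / 2 := by norm_num
  have nh' : ‖(-(1 / 2) : ℂ)‖ = 1 / 2 := by rw [norm_neg]; norm_num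
  have one1 : ‖(1 : ℂ)‖ ≤ 1 := by norm_num
  have be : ∀ i : Fin 2, ∫⁻ t in Set.Ioc 0 T, Msup (fun ξ => mi i ξ * hat (η t) ξ) ^ 2 ≤ 8 * X := by
    intro i
    refine comp_bound (mp := fun ξ => 1 / 2 * (mi i ξ * 1)) (mm := fun ξ => 1 / 2 * (mi i ξ * 1)) hU hcore hIntg (ne.mi i) ?_ ?_ ?_ ?_ ?_
    · exact ((mi_cont i).measurable.mul_const 1).const_mul _
    · exact ((mi_cont i).measurable.mul_const 1).const_mul _
    · exact fun ξ => prod_bd (half_mi i ξ) (norm_nonneg _) one1 nh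
    · exact fun ξ => prod_bd (half_mi i ξ) (norm_nonneg _) one1 nh
    · intro t _ ξ _
      linear_combination mi i ξ * uu_sum μ (hat (η t) ξ) (hat (v₁ t) ξ) (hat (v₂ t) ξ) ξ
  have bT : ∀ (j i : Fin 2) (w : ℝ → 𝓢(E2, ℝ)) (_ : Continuous w) (_ : ∀ t ∈ Set.Icc 0 T, ∀ ξ, ξ ≠ 0 →
      hat (w t) ξ = dirc j ξ * dd (hat (v₁ t) ξ) (hat (v₂ t) ξ) ξ),
      ∫⁻ t in Set.Ioc 0 T, Msup (fun ξ => (((tau μ ξ)⁻¹ : ℝ) : ℂ) * (mi i ξ * hat (w t) ξ)) ^ 2 ≤ 8 * X := by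
    intro j i w hw hwe
    refine comp_bound (mp := fun ξ => 1 / 2 * (mi i ξ * dirc j ξ)) (mm := fun ξ => -(1 / 2) * (mi i ξ * dirc j ξ))
      hU hcore hIntg (((nice_hat hw).mi i).tauinv hμ hμ1) ?_ ?_ ?_ ?_ ?_
    · exact ((mi_cont i).measurable.mul (dirc_meas j)).const_mul _
    · exact ((mi_cont i).measurable.mul (dirc_meas j)).const_mul _
    · exact fun ξ => prod_bd (half_mi i ξ) (norm_nonneg _) (dirc_norm j ξ) nh
    · exact fun ξ => prod_bd (half_mi i ξ) (norm_nonneg _) (dirc_norm j ξ) nh'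
    · intro t ht ξ hξ
      rw [hwe t ht ξ hξ]
      linear_combination mi i ξ * dirc j ξ * uu_diff hμ (hat (η t) ξ) (hat (v₁ t) ξ) (hat (v₂ t) ξ) ξ
  have bv : ∀ (j i : Fin 2) (w : ℝ → 𝓢(E2, ℝ)) (_ : Continuous w) (_ : ∀ t ∈ Set.Icc 0 T, ∀ ξ, ξ ≠ 0 →
      hat (w t) ξ = dirc j ξ * dd (hat (v₁ t) ξ) (hat (v₂ t) ξ) ξ),
      ∫⁻ t in Set.Ioc 0 T, Msup (fun ξ => mi i ξ * hat (w t) ξ) ^ 2 ≤ 8 * X := by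
    intro j i w hw hwe
    have hb : ∀ ξ, ‖dirc j ξ * ((tau μ ξ : ℝ) : ℂ)‖ ≤ 1 := fun ξ => by
      rw [norm_mul]; exact mul_le_one₀ (dirc_norm j ξ) (norm_nonneg _) (tauC_norm hμ ξ)
    refine comp_bound (mp := fun ξ => 1 / 2 * (mi i ξ * (dirc j ξ * ((tau μ ξ : ℝ) : ℂ))))
      (mm := fun ξ => -(1 / 2) * (mi i ξ * (dirc j ξ * ((tau μ ξ : ℝ) : ℂ))))
      hU hcore hIntg ((nice_hat hw).mi i) ?_ ?_ ?_ ?_ ?_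
    · exact ((mi_cont i).measurable.mul ((dirc_meas j).mul (tauC_meas hμ))).const_mul _
    · exact ((mi_cont i).measurable.mul ((dirc_meas j).mul (tauC_meas hμ))).const_mul _
    · exact fun ξ => prod_bd (half_mi i ξ) (norm_nonneg _) (hb ξ) nh
    · exact fun ξ => prod_bd (half_mi i ξ) (norm_nonneg _) (hb ξ) nh'
    · intro t ht ξ hξ
      rw [hwe t ht ξ hξ]
      have e : ((tau μ ξ : ℝ) : ℂ) * (((tau μ ξ)⁻¹ : ℝ) : ℂ) = 1 := by
        rw [← Complex.ofReal_mul, mul_inv_cancel₀ (tau_pos hμ ξ).ne', Complex.ofReal_one]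
      linear_combination mi i ξ * dirc j ξ * ((tau μ ξ : ℝ) : ℂ) * uu_diff hμ (hat (η t) ξ) (hat (v₁ t) ξ) (hat (v₂ t) ξ) ξ
        - mi i ξ * dirc j ξ * dd (hat (v₁ t) ξ) (hat (v₂ t) ξ) ξ * e
  have hv1 : ∀ t ∈ Set.Icc 0 T, ∀ ξ, ξ ≠ 0 → hat (v₁ t) ξ = dirc 0 ξ * dd (hat (v₁ t) ξ) (hat (v₂ t) ξ) ξ :=
    fun t ht ξ hξ => (v_eq (hcurl t ht) hξ).1
  have hv2 : ∀ t ∈ Set.Icc 0 T, ∀ ξ, ξ ≠ 0 → hat (v₂ t) ξ = dirc 1 ξ * dd (hat (v₁ t) ξ) (hat (v₂ t) ξ) ξ :=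
    fun t ht ξ hξ => (v_eq (hcurl t ht) hξ).2
  have mM : ∀ {W : ℝ → E2 → ℂ}, Nice W → Measurable fun t => Msup (W t) := fun hW => hW.sup_meas
  have mS : ∀ {W : Fin 2 → ℝ → E2 → ℂ}, (∀ i, Nice (W i)) → Measurable fun t => ∑ i, Msup (W i t) := fun {W} hW =>
    Finset.measurable_fun_sum _ fun i _ => mM (hW i)
  have bS : ∀ {W : Fin 2 → ℝ → E2 → ℂ}, (∀ i, Nice (W i)) → (∀ i, ∫⁻ t in Set.Ioc 0 T, Msup (W i t) ^ 2 ≤ 8 * X) →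
      ∫⁻ t in Set.Ioc 0 T, (∑ i, Msup (W i t)) ^ 2 ≤ 64 * X := fun {W} hW hb => by
    simp only [Fin.sum_univ_two]
    refine (sq_add_int (mM (hW 0)) (hb 0) (hb 1)).trans (le_of_eq (by ring))
  have Se := bS (fun i => ne.mi i) be
  have S1 := bS (fun i => n1.mi i) (fun i => bv 0 i v₁ h1 hv1)
  have S2 := bS (fun i => n2.mi i) (fun i => bv 1 i v₂ h2 hv2)
  have R1 := bS (fun i => (n1.mi i).tauinv hμ hμ1) (fun i => bT 0 i v₁ h1 hv1)
  have R2 := bS (fun i => (n2.mi i).tauinv hμ hμ1) (fun i => bT 1 i v₂ h2 hv2)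
  have me := mS (fun i => ne.mi i)
  have m1 := mS (fun i => n1.mi i)
  have m2 := mS (fun i => n2.mi i)
  have k1 := mS (fun i => (n1.mi i).tauinv hμ hμ1)
  have A1 := sq_add_int m1 S1 S2
  have A2 := sq_add_int me Se A1
  have A3 := sq_add_int k1 R1 R2
  have A4 := sq_add_int (me.add (m1.add m2)) A2 A3
  refine (lintegral_mono fun t => pow_le_pow_left' (Pfun_le hμ (η t) (v₁ t) (v₂ t)) 2).trans (A4.trans (le_of_eq ?_))
  ring

lemma Fbound {r K : ℝ} (hK : ∀ a : ℝ, 0 ≤ a → ∀ f g : E2 → ℂ, Measurable f → Measurable g →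
      NN r a (fun ξ => ∫ ζ, f ζ * g (ξ - ζ)) ≤ ENNReal.ofReal K * (NN r a f * NN r a g)) (hK0 : 0 < K)
    {μ σ ε A : ℝ} (hμ : 0 < μ) (hε : 0 < ε) (hσ : |σ| = 1) (η v₁ v₂ : 𝓢(E2, ℝ)) (hA : Vnorm μ r η v₁ v₂ ^ 2 ≤ ENNReal.ofReal (A ^ 2)) :
    ∫⁻ ξ, ENNReal.ofReal ((1 + ‖ξ‖ ^ 2) ^ (r - 1) * ‖FF μ σ ε (hat (prodS η v₁) ξ) (hat (prodS η v₂) ξ)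
        (hat (prodS v₁ v₁) ξ + hat (prodS v₂ v₂) ξ) ξ‖ ^ 2) ≤ ENNReal.ofReal ((Real.sqrt (72 * Real.pi ^ 2 * K) * (ε * A ^ 2)) ^ 2) := by
  rw [Vnorm_sq] at hA
  have e0 : NN r 0 (hat η) ≤ ENNReal.ofReal (A ^ 2) := (le_self_add.trans le_self_add).trans hA
  have e1 : NN r (Real.sqrt μ) (hat v₁) ≤ ENNReal.ofReal (A ^ 2) := (le_add_self.trans le_self_add).trans hA
  have e2 : NN r (Real.sqrt μ) (hat v₂) ≤ ENNReal.ofReal (A ^ 2) := le_add_self.trans hA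
  have f1 := (NN_mono (Real.sqrt_nonneg μ) (hat v₁)).trans e1
  have f2 := (NN_mono (Real.sqrt_nonneg μ) (hat v₂)).trans e2
  have hm : ∀ φ : 𝓢(E2, ℝ), Measurable (hat φ) := fun φ => (hat φ).continuous.measurable
  have pr : ∀ (a : ℝ), 0 ≤ a → ∀ φ ψ : 𝓢(E2, ℝ), NN r a (hat φ) ≤ ENNReal.ofReal (A ^ 2) → NN r a (hat ψ) ≤ ENNReal.ofReal (A ^ 2) →
      NN r a (hat (prodS φ ψ)) ≤ ENNReal.ofReal (K * A ^ 4) := by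
    intro a ha φ ψ h1 h2
    have e : (hat (prodS φ ψ) : E2 → ℂ) = fun ξ => ∫ ζ, hat φ ζ * hat ψ (ξ - ζ) := by funext ξ; exact hat_prod _ _ _
    rw [e]
    refine (hK a ha _ _ (hm φ) (hm ψ)).trans ?_
    rw [show K * A ^ 4 = K * (A ^ 2 * A ^ 2) by ring, ENNReal.ofReal_mul hK0.le, ENNReal.ofReal_mul (by positivity)]
    gcongr
  refine (FF_int hμ hε hσ (hm _) (hm _)).trans ?_
  have g3 : NN r (Real.sqrt μ) (fun ξ => hat (prodS v₁ v₁) ξ + hat (prodS v₂ v₂) ξ) ≤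
      2 * (ENNReal.ofReal (K * A ^ 4) + ENNReal.ofReal (K * A ^ 4)) :=
    (NN_add (Real.sqrt_nonneg μ) (hm _)).trans (by
      gcongr
      · exact pr _ (Real.sqrt_nonneg μ) _ _ e1 e1
      · exact pr _ (Real.sqrt_nonneg μ) _ _ e2 e2)
  have g1 := pr 0 le_rfl _ _ e0 f1
  have g2 := pr 0 le_rfl _ _ e0 f2
  refine (mul_le_mul_right (add_le_add (add_le_add g1 g2) g3) _).trans (le_of_eq ?_)
  have hA4 : 0 ≤ K * A ^ 4 := by positivity
  have e6 : ENNReal.ofReal (K * A ^ 4) + ENNReal.ofReal (K * A ^ 4) + 2 * (ENNReal.ofReal (K * A ^ 4) + ENNReal.ofReal (K * A ^ 4)) =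
      ENNReal.ofReal 6 * ENNReal.ofReal (K * A ^ 4) := by
    rw [show ENNReal.ofReal 6 = 6 by norm_num]; ring
  rw [e6, ← ENNReal.ofReal_mul (by norm_num), ← ENNReal.ofReal_mul (by positivity)]
  congr 1
  rw [mul_pow, Real.sq_sqrt (by positivity)]
  ring

lemma Xrhs_eq {μ θ T : ℝ} (hμ : 0 < μ) (hT : 0 < T) (S B : ℝ) : Xrhs μ θ T S B =
    (μ ^ (-(1 : ℝ) / 6 + 5 * θ / 36) * T ^ ((1 : ℝ) / 6 + 5 * θ / 18)) ^ 2 * S ^ 2 +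
    (μ ^ (-(1 : ℝ) / 3 + θ / 9) * T ^ ((5 : ℝ) / 6 + 2 * θ / 9)) ^ 2 * B ^ 2 := by
  have sq : ∀ (x e : ℝ), 0 < x → (x ^ e) ^ 2 = x ^ (2 * e) := fun x e hx => by
    rw [← Real.rpow_natCast, ← Real.rpow_mul hx.le]; congr 1; push_cast; ring
  have hs : ∀ e : ℝ, (T * Real.sqrt μ) ^ e = T ^ e * μ ^ (e / 2) := fun e => by
    rw [Real.mul_rpow hT.le (Real.sqrt_nonneg _), Real.sqrt_eq_rpow, ← Real.rpow_mul hμ.le]; congr 2; ring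
  have e1 : T * T ^ (-(2 : ℝ) / 3 + 5 * θ / 9) = T ^ (2 * ((1 : ℝ) / 6 + 5 * θ / 18)) := by
    nth_rewrite 1 [← Real.rpow_one T]
    rw [← Real.rpow_add hT]; congr 1; ring
  have e2 : T ^ 3 * T ^ (-(4 : ℝ) / 3 + 4 * θ / 9) = T ^ (2 * ((5 : ℝ) / 6 + 2 * θ / 9)) := by
    rw [← Real.rpow_natCast T 3, ← Real.rpow_add hT]; congr 1; push_cast; ring
  rw [Xrhs, hs, hs, mul_pow, mul_pow, sq _ _ hμ, sq _ _ hT, sq _ _ hμ, sq _ _ hT, ← e1, ← e2,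
    show (-(2 : ℝ) / 3 + 5 * θ / 9) / 2 = 2 * (-(1 : ℝ) / 6 + 5 * θ / 36) by ring,
    show (-(4 : ℝ) / 3 + 4 * θ / 9) / 2 = 2 * (-(1 : ℝ) / 3 + θ / 9) by ring]
  ring

/-- Refined Strichartz estimate for the two-dimensional
Whitham–Boussinesq system (Proposition 6.9): for `r > 9/4` and all small `θ > 0` there is
`C = C(r,θ)` such that any Schwartz-valued `C¹`-in-time, curl-free solution of
`∂_t η + ∇·v + ε∇·(ηv) = 0`, `∂_t v + T_μ(D)∇η + (ε/2)∇(|v|²) = 0` on `[0,T]` satisfies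
`‖𝒫‖_{L²(0,T)} ≤ C[ μ^{−1/6+5θ/36} T^{1/6+5θ/18} sup_t ‖(η,v)‖_{V^r_μ}
+ ε μ^{−1/3+θ/9} T^{5/6+2θ/9} (sup_t ‖(η,v)‖_{V^r_μ})² ]`. -/
theorem WB_refined_strichartz (r : ℝ) (hr : 9 / 4 < r) :
    ∃ θ₀ : ℝ, 0 < θ₀ ∧
      ∀ θ : ℝ, 0 < θ → θ < θ₀ →
        ∃ C : ℝ, 0 < C ∧
          ∀ ε μ : ℝ, 0 < ε → ε ≤ 1 → 0 < μ → μ ≤ 1 →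
            ∀ T : ℝ, 0 < T →
              ∀ η v₁ v₂ : ℝ → 𝓢(E2, ℝ),
                Continuous η → Continuous v₁ → Continuous v₂ →
                -- first equation: `∂_t η = −(∇·v + ε∇·(ηv))`
                (∀ t ∈ Set.Icc (0 : ℝ) T, ∀ x : E2,
                  HasDerivAt (fun τ => η τ x)
                    (-(pd 0 (⇑(v₁ t)) x + pd 1 (⇑(v₂ t)) x +
                        ε * (pd 0 (fun y => η t y * v₁ t y) x +
                          pd 1 (fun y => η t y * v₂ t y) x))) t) →
                -- second equation, first component
                (∀ t ∈ Set.Icc (0 : ℝ) T, ∀ x : E2,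
                  HasDerivAt (fun τ => ((v₁ τ x : ℝ) : ℂ))
                    (-(Tmul2 μ (cc2 (pd 0 (⇑(η t)))) x +
                        (ε / 2 : ℂ) *
                          ((pd 0 (fun y => (v₁ t y) ^ 2 + (v₂ t y) ^ 2) x : ℝ) : ℂ))) t) →
                -- second equation, second component
                (∀ t ∈ Set.Icc (0 : ℝ) T, ∀ x : E2,
                  HasDerivAt (fun τ => ((v₂ τ x : ℝ) : ℂ))
                    (-(Tmul2 μ (cc2 (pd 1 (⇑(η t)))) x +
                        (ε / 2 : ℂ) *
                          ((pd 1 (fun y => (v₁ t y) ^ 2 + (v₂ t y) ^ 2) x : ℝ) : ℂ))) t) →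
                -- curl-free condition
                (∀ t ∈ Set.Icc (0 : ℝ) T, ∀ x : E2,
                  pd 1 (⇑(v₁ t)) x = pd 0 (⇑(v₂ t)) x) →
                (∫⁻ t in Set.Ioc (0 : ℝ) T,
                    ENNReal.ofReal (Pfun μ (⇑(η t)) (⇑(v₁ t)) (⇑(v₂ t))) ^ 2) ^ ((1 : ℝ) / 2)
                  ≤ ENNReal.ofReal C *
                    (ENNReal.ofReal
                        (μ ^ (-(1 : ℝ) / 6 + 5 * θ / 36) * T ^ ((1 : ℝ) / 6 + 5 * θ / 18)) *
                      (⨆ t ∈ Set.Icc (0 : ℝ) T, Vnorm μ r (⇑(η t)) (⇑(v₁ t)) (⇑(v₂ t))) +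
                    ENNReal.ofReal
                        (ε * μ ^ (-(1 : ℝ) / 3 + θ / 9) * T ^ ((5 : ℝ) / 6 + 2 * θ / 9)) *
                      (⨆ t ∈ Set.Icc (0 : ℝ) T,
                        Vnorm μ r (⇑(η t)) (⇑(v₁ t)) (⇑(v₂ t))) ^ 2) := by
  obtain ⟨Kb, hKb0, hKb⟩ := bilin (r := r) (by linarith)
  refine ⟨1, one_pos, fun θ hθ0 hθ => ?_⟩
  obtain ⟨K, hK0, hK⟩ := core hr hθ0 hθ
  have hp := Real.pi_pos
  obtain ⟨c, hc⟩ : ∃ c, c = Real.sqrt (72 * Real.pi ^ 2 * Kb) := ⟨_, rfl⟩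
  have hc0 : 0 ≤ c := hc ▸ Real.sqrt_nonneg _
  refine ⟨Real.sqrt (180224 * K) * (2 + c), by positivity, ?_⟩
  intro ε μ hε _ hμ hμ1 T hT η v₁ v₂ hη h1 h2 hd hd1 hd2 hcurl
  obtain ⟨P₁, hP₁⟩ : ∃ P, P = μ ^ (-(1 : ℝ) / 6 + 5 * θ / 36) * T ^ ((1 : ℝ) / 6 + 5 * θ / 18) := ⟨_, rfl⟩
  obtain ⟨P₂, hP₂⟩ : ∃ P, P = μ ^ (-(1 : ℝ) / 3 + θ / 9) * T ^ ((5 : ℝ) / 6 + 2 * θ / 9) := ⟨_, rfl⟩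
  have hP₁0 : 0 < P₁ := hP₁ ▸ by positivity
  have hP₂0 : 0 < P₂ := hP₂ ▸ by positivity
  rw [mul_assoc ε, ← hP₁, ← hP₂]
  have hV : ∀ t ∈ Set.Icc (0 : ℝ) T, Vnorm μ r (⇑(η t)) (⇑(v₁ t)) (⇑(v₂ t)) ≤
    ⨆ t ∈ Set.Icc (0 : ℝ) T, Vnorm μ r (⇑(η t)) (⇑(v₁ t)) (⇑(v₂ t)) := fun t ht => le_iSup₂ (f := fun t (_ : t ∈ Set.Icc (0 : ℝ) T) =>
      Vnorm μ r (⇑(η t)) (⇑(v₁ t)) (⇑(v₂ t))) t ht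
  generalize (⨆ t ∈ Set.Icc (0 : ℝ) T, Vnorm μ r (⇑(η t)) (⇑(v₁ t)) (⇑(v₂ t))) = V at hV ⊢
  have hC0 : 0 < Real.sqrt (180224 * K) * (2 + c) := by positivity
  by_cases hVt : V = ⊤
  · have e : ENNReal.ofReal (Real.sqrt (180224 * K) * (2 + c)) * (ENNReal.ofReal P₁ * V + ENNReal.ofReal (ε * P₂) * V ^ 2) = ⊤ := by
      rw [hVt, ENNReal.mul_top (ENNReal.ofReal_pos.2 hP₁0).ne', top_add, ENNReal.mul_top (ENNReal.ofReal_pos.2 hC0).ne']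
    rw [e]; exact le_top
  obtain ⟨A, hA0, rfl⟩ : ∃ A : ℝ, 0 ≤ A ∧ V = ENNReal.ofReal A := ⟨V.toReal, ENNReal.toReal_nonneg, (ENNReal.ofReal_toReal hVt).symm⟩
  have hV2 : ∀ t ∈ Set.Icc (0 : ℝ) T, Vnorm μ r (⇑(η t)) (⇑(v₁ t)) (⇑(v₂ t)) ^ 2 ≤ ENNReal.ofReal (A ^ 2) := fun t ht => by
    rw [ENNReal.ofReal_pow hA0]; exact pow_le_pow_left' (hV t ht) 2
  have ne := nice_hat hη
  have n1 := nice_hat h1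
  have n2 := nice_hat h2
  have q1 := nice_prod hη h1
  have q2 := nice_prod hη h2
  have q3 := (nice_prod h1 h1).add (nice_prod h2 h2)
  have hm : ∀ φ : 𝓢(E2, ℝ), Measurable (hat φ) := fun φ => (hat φ).continuous.measurable
  have hcore : ∀ σ : ℝ, |σ| = 1 → ∀ y : ℝ → E2, Measurable y → ∀ m : E2 → ℂ, Measurable m → (∀ ξ, ‖m ξ‖ ≤ 4 * ‖ξ‖) →
      ∫⁻ t in Set.Ioc 0 T, ‖∫ ξ, osc μ 0 (y t) ξ * (m ξ * uu μ σ (hat (η t) ξ) (hat (v₁ t) ξ) (hat (v₂ t) ξ) ξ)‖ₑ ^ 2 ≤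
        ENNReal.ofReal (K * 4 ^ 2 * Xrhs μ θ T (2 * A) (c * (ε * A ^ 2))) := by
    intro σ hσ y hy m hmm hb
    refine hK μ T σ (2 * A) (c * (ε * A ^ 2)) 4 hμ hμ1 hT hσ y hy m hmm hb _ _ (uu_meas hμ σ ne n1 n2) (FF_meas hμ σ ε q1 q2 q3)
      (uuFF_bdd hμ hμ1 hσ hε ne n1 n2 q1 q2 q3) (duh_u hμ hσ hη h1 h2 hd hd1 hd2) ?_ ?_
    · intro t ht
      refine (uu_int hμ hσ (hm (η t)) (hm (v₁ t))).trans ?_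
      rw [← Vnorm_sq, mul_pow, ENNReal.ofReal_mul (by norm_num)]
      refine mul_le_mul' (le_of_eq (by norm_num)) (hV2 t ht)
    · intro t ht
      rw [hc]
      exact Fbound hKb hKb0 hμ hε hσ (η t) (v₁ t) (v₂ t) (hV2 t ht)
  have hfin := P_bound hμ hμ1 hη h1 h2 hcurl hcore
  have hle : (11264 : ℝ≥0∞) * ENNReal.ofReal (K * 4 ^ 2 * Xrhs μ θ T (2 * A) (c * (ε * A ^ 2))) ≤
      ENNReal.ofReal (Real.sqrt (180224 * K) * (2 + c) * (P₁ * A + ε * P₂ * A ^ 2)) ^ 2 := by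
    rw [← ENNReal.ofReal_pow (by positivity), show (11264 : ℝ≥0∞) = ENNReal.ofReal 11264 by norm_num,
      ← ENNReal.ofReal_mul (by norm_num)]
    apply ENNReal.ofReal_le_ofReal
    have hsq : Real.sqrt (180224 * K) ^ 2 = 180224 * K := Real.sq_sqrt (by positivity)
    rw [Xrhs_eq hμ hT, ← hP₁, ← hP₂, mul_pow (Real.sqrt (180224 * K) * (2 + c)), mul_pow (Real.sqrt (180224 * K)), hsq]
    have a1 : 0 ≤ P₁ * A := by positivity
    have a2 : 0 ≤ ε * P₂ * A ^ 2 := by positivity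
    have a3 : P₁ ^ 2 * (2 * A) ^ 2 + P₂ ^ 2 * (c * (ε * A ^ 2)) ^ 2 ≤ (2 + c) ^ 2 * (P₁ * A + ε * P₂ * A ^ 2) ^ 2 := by
      have b1 : (2 : ℝ) ^ 2 ≤ (2 + c) ^ 2 := by gcongr; linarith
      have b2 : c ^ 2 ≤ (2 + c) ^ 2 := by gcongr; linarith
      calc _ = 2 ^ 2 * (P₁ * A) ^ 2 + c ^ 2 * (ε * P₂ * A ^ 2) ^ 2 := by ring
        _ ≤ (2 + c) ^ 2 * (P₁ * A) ^ 2 + (2 + c) ^ 2 * (ε * P₂ * A ^ 2) ^ 2 := by gcongr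
        _ = (2 + c) ^ 2 * ((P₁ * A) ^ 2 + (ε * P₂ * A ^ 2) ^ 2) := by ring
        _ ≤ _ := by
          apply mul_le_mul_of_nonneg_left _ (by positivity)
          nlinarith [mul_nonneg a1 a2]
    have a4 := mul_le_mul_of_nonneg_left a3 (by positivity : 0 ≤ 180224 * K)
    linarith
  have hR : ENNReal.ofReal (Real.sqrt (180224 * K) * (2 + c)) *
      (ENNReal.ofReal P₁ * ENNReal.ofReal A + ENNReal.ofReal (ε * P₂) * ENNReal.ofReal A ^ 2) =
      ENNReal.ofReal (Real.sqrt (180224 * K) * (2 + c) * (P₁ * A + ε * P₂ * A ^ 2)) := by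
    rw [← ENNReal.ofReal_pow hA0, ← ENNReal.ofReal_mul hP₁0.le, ← ENNReal.ofReal_mul (by positivity),
      ← ENNReal.ofReal_add (by positivity) (by positivity), ← ENNReal.ofReal_mul hC0.le]
  rw [hR]
  refine (ENNReal.rpow_le_rpow (hfin.trans hle) (by norm_num)).trans (le_of_eq ?_)
  rw [← ENNReal.rpow_natCast, ← ENNReal.rpow_mul]
  norm_num
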